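/- For every α > 0 and k, s, t ∈ ℕ, there exists C = C(k, s, t, α) > 0 such that the following holds for every d ∈ [k−1]. Let F be a strictly 1-balanced k-graph on s vertices with t edges, and let H be any k-graph on sn vertices with δ_d(H) ≥ (δ_{F,d}^T + α)·binom(sn−d, k−d). If p ≥ C·n^{−1/d_1(F) − 1}·(log n)^{1/t}, then with high probability the random k-graph system {H_1, …, H_{tn}}, where each H_i is independently distributed as H(p), contains a transversal F-factor. -/

import Mathlib

/-- A transversal `F`-factor of the `k`-graph system `Hs` on `s*n` vertices. -/
def IsTransversalFFactor {s t n : ℕ} (F : Finset (Finset (Fin s)))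
    (Hs : Fin (t * n) → Finset (Finset (Fin (s * n)))) : Prop :=
  ∃ φ : Fin n → Fin s → Fin (s * n),
    (∀ j, Function.Injective (φ j)) ∧
    (∀ j j' : Fin n, j ≠ j' → ∀ a b, φ j a ≠ φ j' b) ∧
    ∃ c : Fin n × {e // e ∈ F} → Fin (t * n),
      Function.Bijective c ∧
      ∀ (j : Fin n) (e : {e // e ∈ F}), Finset.image (φ j) e.1 ∈ Hs (c (j, e))

/-- The Dirac threshold `δ_{F,d}^T` for transversal `F`-factors in `k`-graph systems. -/
noncomputable def transversalDiracThreshold (k s t d : ℕ) (F : Finset (Finset (Fin s))) : ℝ :=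
  sInf {δ : ℝ | 0 < δ ∧ ∀ α : ℝ, 0 < α → ∃ n₀ : ℕ, ∀ n : ℕ, n₀ ≤ n →
    ∀ Hs : Fin (t * n) → Finset (Finset (Fin (s * n))),
      (∀ i, ∀ e ∈ Hs i, e.card = k) →
      (∀ i (D : Finset (Fin (s * n))), D.card = d →
        (δ + α) * ((s * n - d).choose (k - d) : ℝ) ≤
          (((Hs i).filter fun e => D ⊆ e).card : ℝ)) →
      IsTransversalFFactor F Hs}

/-- `F` is strictly 1-balanced. -/
def StrictlyOneBalanced {V : Type*} [Fintype V] [DecidableEq V]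
    (F : Finset (Finset V)) : Prop :=
  ∀ (W : Finset V) (E' : Finset (Finset V)),
    E' ⊆ F → (∀ e ∈ E', e ⊆ W) → 2 ≤ W.card →
    (W ≠ Finset.univ ∨ E' ≠ F) →
    (E'.card : ℝ) / ((W.card : ℝ) - 1) < (F.card : ℝ) / ((Fintype.card V : ℝ) - 1)

/-- The 1-density `d₁(F) = e(F)/(|V(F)|-1)`. -/
noncomputable def oneDensity {V : Type*} [Fintype V] (F : Finset (Finset V)) : ℝ :=
  (F.card : ℝ) / ((Fintype.card V : ℝ) - 1)

open Classical in
/-- The probability that `σ`, with each `σ i` an independent random sparsification of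
`Hs i` (each edge kept independently with probability `p`), satisfies the event `E`. -/
noncomputable def sysSparsProb {M : ℕ} {V : Type*} [DecidableEq V]
    (Hs : Fin M → Finset (Finset V)) (p : ℝ)
    (E : (Fin M → Finset (Finset V)) → Prop) : ℝ :=
  ∑ σ ∈ Fintype.piFinset (fun i => (Hs i).powerset),
    if E σ then ∏ i, p ^ (σ i).card * (1 - p) ^ ((Hs i).card - (σ i).card) else 0

section Helpers

open Finset

section RandomSubset

variable {X : Type*}

/-- The expectation of `f` over the random subset of `A` keeping each element with
probability `p`. -/
noncomputable def subsetExp (p : ℝ) (A : Finset X) (f : Finset X → ℝ) : ℝ :=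
  ∑ G ∈ A.powerset, p ^ G.card * (1 - p) ^ (A.card - G.card) * f G

lemma subsetExp_congr {p : ℝ} {A : Finset X} {f g : Finset X → ℝ}
    (h : ∀ G, G ⊆ A → f G = g G) : subsetExp p A f = subsetExp p A g := by
  unfold subsetExp
  exact sum_congr rfl fun G hG => by rw [h G (mem_powerset.1 hG)]

lemma subsetExp_mono {p : ℝ} (hp : 0 ≤ p) (hp1 : p ≤ 1) {A : Finset X} {f g : Finset X → ℝ}
    (h : ∀ G, G ⊆ A → f G ≤ g G) : subsetExp p A f ≤ subsetExp p A g := by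
  unfold subsetExp
  refine sum_le_sum fun G hG => mul_le_mul_of_nonneg_left (h G (mem_powerset.1 hG)) ?_
  have : 0 ≤ 1 - p := by linarith
  positivity

lemma subsetExp_empty (p : ℝ) (f : Finset X → ℝ) : subsetExp p ∅ f = f ∅ := by
  simp [subsetExp]

lemma subsetExp_add (p : ℝ) (A : Finset X) (f g : Finset X → ℝ) :
    subsetExp p A (fun G => f G + g G) = subsetExp p A f + subsetExp p A g := by
  simp only [subsetExp, mul_add, sum_add_distrib]

lemma subsetExp_sum {ι : Type*} (p : ℝ) (A : Finset X) (s : Finset ι) (f : ι → Finset X → ℝ) :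
    subsetExp p A (fun G => ∑ i ∈ s, f i G) = ∑ i ∈ s, subsetExp p A (f i) := by
  simp only [subsetExp, mul_sum]
  exact sum_comm

lemma subsetExp_const_mul (p : ℝ) (A : Finset X) (c : ℝ) (f : Finset X → ℝ) :
    subsetExp p A (fun G => c * f G) = c * subsetExp p A f := by
  simp only [subsetExp, mul_sum]
  exact sum_congr rfl fun G _ => by ring

variable [DecidableEq X]

lemma subsetExp_insert (p : ℝ) {A : Finset X} {a : X} (ha : a ∉ A) (f : Finset X → ℝ) :
    subsetExp p (insert a A) f =
      (1 - p) * subsetExp p A f + p * subsetExp p A (fun G => f (insert a G)) := by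
  unfold subsetExp
  rw [sum_powerset_insert ha, mul_sum, mul_sum]
  congr 1
  · refine sum_congr rfl fun G hG => ?_
    have hG' := card_le_card (mem_powerset.1 hG)
    rw [card_insert_of_notMem ha, Nat.succ_sub hG', pow_succ]
    ring
  · refine sum_congr rfl fun G hG => ?_
    have hG' : a ∉ G := fun h => ha (mem_powerset.1 hG h)
    rw [card_insert_of_notMem ha, card_insert_of_notMem hG', Nat.add_sub_add_right, pow_succ]
    ring

lemma subsetExp_const (p : ℝ) (A : Finset X) (c : ℝ) : subsetExp p A (fun _ => c) = c := by
  induction A using Finset.induction_on with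
  | empty => exact subsetExp_empty p _
  | insert a A ha ih => rw [subsetExp_insert p ha, ih]; ring

lemma subsetExp_nonneg {p : ℝ} (hp : 0 ≤ p) (hp1 : p ≤ 1) {A : Finset X} {f : Finset X → ℝ}
    (h : ∀ G, G ⊆ A → 0 ≤ f G) : 0 ≤ subsetExp p A f := by
  rw [← subsetExp_const p A 0]
  exact subsetExp_mono hp hp1 h

lemma subsetExp_mono_prob {p q : ℝ} (hp : 0 ≤ p) (hpq : p ≤ q) (hq : q ≤ 1) {A : Finset X} :
    ∀ {f : Finset X → ℝ}, Monotone f → subsetExp p A f ≤ subsetExp q A f := by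
  induction A using Finset.induction_on with
  | empty => intro f _; simp [subsetExp_empty]
  | insert a A ha ih =>
    intro f hf
    rw [subsetExp_insert p ha, subsetExp_insert q ha]
    have hf' : Monotone (fun G => f (insert a G)) := fun G G' h => hf (insert_subset_insert a h)
    have h1 := ih hf
    have h2 := ih hf'
    have h3 : subsetExp q A f ≤ subsetExp q A (fun G => f (insert a G)) :=
      subsetExp_mono (hp.trans hpq) hq fun G _ => hf (subset_insert a G)
    nlinarith [mul_nonneg (sub_nonneg.2 hpq) (sub_nonneg.2 h3),
      mul_nonneg hp (sub_nonneg.2 h2), mul_nonneg (sub_nonneg.2 (hpq.trans hq)) (sub_nonneg.2 h1)]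

/-- Conditioning on the presence of `E` amounts to planting `E`. -/
lemma subsetExp_plant (p : ℝ) {A : Finset X} : ∀ {E : Finset X}, E ⊆ A → ∀ f : Finset X → ℝ,
    subsetExp p A (fun G => if E ⊆ G then f G else 0) =
      p ^ E.card * subsetExp p A (fun G => f (G ∪ E)) := by
  induction A using Finset.induction_on with
  | empty =>
    intro E hE f
    obtain rfl := subset_empty.1 hE
    simp [subsetExp_empty]
  | insert a A ha ih =>
    intro E hE f
    rw [subsetExp_insert p ha, subsetExp_insert p ha]
    by_cases haE : a ∈ E
    · have h0 : subsetExp p A (fun G => if E ⊆ G then f G else 0) = 0 := by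
        refine Eq.trans (subsetExp_congr fun G hG => ?_) (subsetExp_const p A 0)
        exact if_neg fun h : E ⊆ G => ha (hG (h haE))
      have hE' : E.erase a ⊆ A := by
        intro x hx
        rcases mem_insert.1 (hE (mem_of_mem_erase hx)) with h | h
        · exact absurd h (ne_of_mem_erase hx)
        · exact h
      have h1 : subsetExp p A (fun G => if E ⊆ insert a G then f (insert a G) else 0) =
          p ^ (E.erase a).card * subsetExp p A (fun G => f (G ∪ E)) := by
        rw [subsetExp_congr (g := fun G => if E.erase a ⊆ G then f (insert a G) else 0), ih hE']
        · congr 1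
          refine subsetExp_congr fun G _ => ?_
          congr 1
          ext x; by_cases hx : x = a <;> simp [hx, haE]
        · intro G _
          simp only [subset_insert_iff]
      rw [h0, h1]
      have h2 : subsetExp p A (fun G => f (insert a G ∪ E)) = subsetExp p A (fun G => f (G ∪ E)) := by
        refine subsetExp_congr fun G _ => ?_
        congr 1
        ext x; by_cases hx : x = a <;> simp [hx, haE]
      rw [h2, ← card_erase_add_one haE, pow_succ]
      ring
    · have hE' : E ⊆ A := (subset_insert_iff_of_notMem haE).1 hE
      rw [ih hE']
      have h1 : subsetExp p A (fun G => if E ⊆ insert a G then f (insert a G) else 0) =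
          p ^ E.card * subsetExp p A (fun G => f (insert a G ∪ E)) := by
        rw [subsetExp_congr (g := fun G => if E ⊆ G then f (insert a G) else 0),
          ih hE' (fun G => f (insert a G))]
        · simp only [insert_union]
        · intro G _
          simp only [subset_insert_iff, erase_eq_of_notMem haE]
      rw [h1]
      ring

end RandomSubset

section RandomLabelling

variable {ι β : Type*} [Fintype ι] [DecidableEq ι] [Fintype β]

/-- The expectation of `f` over a random labelling with independent labels distributed as `w`. -/
noncomputable def labelExp (w : β → ℝ) (f : (ι → β) → ℝ) : ℝ :=
  ∑ x : ι → β, (∏ i, w (x i)) * f x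

lemma labelExp_mono {w : β → ℝ} (hw : ∀ b, 0 ≤ w b) {f g : (ι → β) → ℝ} (h : ∀ x, f x ≤ g x) :
    labelExp w f ≤ labelExp w g :=
  sum_le_sum fun x _ => mul_le_mul_of_nonneg_left (h x) (prod_nonneg fun _ _ => hw _)

lemma labelExp_const {w : β → ℝ} (hw : ∑ b, w b = 1) (c : ℝ) :
    labelExp (ι := ι) w (fun _ => c) = c := by
  unfold labelExp
  rw [← sum_mul, ← Fintype.prod_sum (fun (_ : ι) b => w b)]
  simp [hw]

lemma labelExp_add (w : β → ℝ) (f g : (ι → β) → ℝ) :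
    labelExp w (fun x => f x + g x) = labelExp w f + labelExp w g := by
  simp only [labelExp, mul_add, sum_add_distrib]

lemma labelExp_sum {κ : Type*} (w : β → ℝ) (s : Finset κ) (f : κ → (ι → β) → ℝ) :
    labelExp w (fun x => ∑ i ∈ s, f i x) = ∑ i ∈ s, labelExp w (f i) := by
  simp only [labelExp, mul_sum]
  exact sum_comm

lemma labelExp_const_mul (w : β → ℝ) (c : ℝ) (f : (ι → β) → ℝ) :
    labelExp w (fun x => c * f x) = c * labelExp w f := by
  simp only [labelExp, mul_sum]
  exact sum_congr rfl fun G _ => by ring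

lemma labelExp_nonneg {w : β → ℝ} (hw : ∀ b, 0 ≤ w b) {f : (ι → β) → ℝ} (h : ∀ x, 0 ≤ f x) :
    0 ≤ labelExp w f :=
  sum_nonneg fun x _ => mul_nonneg (prod_nonneg fun _ _ => hw _) (h x)

lemma labelExp_eq_sum_update {w : β → ℝ} (hw : ∑ b, w b = 1) (i : ι) (f : (ι → β) → ℝ) :
    labelExp w f = ∑ b, w b * labelExp w (fun x => f (Function.update x i b)) := by
  have h : labelExp w f = ∑ b, w b * labelExp w f := by rw [← sum_mul, hw, one_mul]
  rw [h]
  simp only [labelExp, mul_sum]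
  rw [← sum_product', ← sum_product']
  refine sum_bij' (fun q _ => (q.2 i, Function.update q.2 i q.1))
    (fun q _ => (q.2 i, Function.update q.2 i q.1)) (by simp) (by simp) (by simp) (by simp) ?_
  rintro ⟨b, x⟩ -
  have e1 : ∏ j, w (x j) = w (x i) * ∏ j ∈ univ.erase i, w (x j) :=
    (mul_prod_erase univ (fun j => w (x j)) (mem_univ i)).symm
  have e2 : ∏ j, w (Function.update x i b j) = w b * ∏ j ∈ univ.erase i, w (x j) := by
    rw [← mul_prod_erase univ (fun j => w (Function.update x i b j)) (mem_univ i)]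
    simp only [Function.update_self]
    congr 1
    exact prod_congr rfl fun j hj => by rw [Function.update_of_ne (ne_of_mem_erase hj)]
  simp only [e1, e2, Function.update_idem, Function.update_eq_self]
  ring

lemma labelExp_override {w : β → ℝ} (hw0 : ∀ b, 0 ≤ w b) (hw : ∑ b, w b = 1) (T : Finset ι)
    (y : ι → β) : ∀ {f : (ι → β) → ℝ}, (∀ x, 0 ≤ f x) →
    (∏ i ∈ T, w (y i)) * labelExp w (fun x => f (T.piecewise y x)) ≤ labelExp w f := by
  induction T using Finset.induction_on with
  | empty => intro f _; simp
  | insert j T hj ih =>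
    intro f hf
    have h1 := ih (f := fun x => f (Function.update x j (y j))) fun x => hf _
    rw [labelExp_eq_sum_update hw j f, prod_insert hj]
    have h2 : w (y j) * labelExp w (fun x => f (Function.update x j (y j))) ≤
        ∑ b, w b * labelExp w (fun x => f (Function.update x j b)) :=
      single_le_sum (f := fun b => w b * labelExp w (fun x => f (Function.update x j b)))
        (fun b _ => mul_nonneg (hw0 b) (labelExp_nonneg hw0 fun x => hf _)) (mem_univ _)
    refine le_trans ?_ h2
    rw [mul_assoc]
    refine mul_le_mul_of_nonneg_left ?_ (hw0 _)
    simpa only [piecewise_insert] using h1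

end RandomLabelling

section Spread

variable {ι X : Type*} [Fintype ι] [DecidableEq ι] [DecidableEq X]

/-- The copies all of whose edges lie in `G`. -/
def copiesIn (E : ι → Finset X) (G : Finset X) : Finset ι := univ.filter fun A => E A ⊆ G

/-- The copies in `G` created by planting the copies in `S`. -/
def newCopies (E : ι → Finset X) (G : Finset X) (S : Finset ι) : Finset ι :=
  copiesIn E (G ∪ S.biUnion E) \ copiesIn E G

/-- The copies in `G` whose label lies between `1` and `i`. -/
def revealed {r : ℕ} (E : ι → Finset X) (G : Finset X) (l : ι → Fin (r + 1)) (i : ℕ) : Finset ι :=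
  (copiesIn E G).filter fun A => l A ≠ 0 ∧ (l A : ℕ) ≤ i

/-- Some member of `𝓜` inside `M` together with the revealed copies has at most `ℓ` copies that
are not revealed. -/
def HasFragment {r : ℕ} (E : ι → Finset X) (𝓜 : Finset ι → Prop) (M : Finset ι) (G : Finset X)
    (l : ι → Fin (r + 1)) (i ℓ : ℕ) : Prop :=
  ∃ M', 𝓜 M' ∧ M' ⊆ M ∪ revealed E G l i ∧ (M' \ revealed E G l i).card ≤ ℓ

/-- Planting sub-collections of `M` creates only few copies. -/
def FewNewCopies (E : ι → Finset X) (B : ℕ) (M : Finset ι) (G : Finset X) : Prop :=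
  ∀ S ⊆ M, (newCopies E G S).card ≤ B * S.card

/-- The labelling after planting `S` with label `i`: other new copies get label `0`. -/
def plantLabel {r : ℕ} (E : ι → Finset X) (G : Finset X) (S : Finset ι) (i : Fin (r + 1))
    (l : ι → Fin (r + 1)) : ι → Fin (r + 1) :=
  (S ∪ newCopies E G S).piecewise (fun A => if A ∈ S then i else 0) l

lemma revealed_plant {r : ℕ} (E : ι → Finset X) (G : Finset X) (S : Finset ι) (l : ι → Fin (r + 1))
    (i : Fin (r + 1)) (hi : i ≠ 0) (j : ℕ) (hS : Disjoint S (revealed E G l j)) :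
    revealed E (G ∪ S.biUnion E) (plantLabel E G S i l) j =
      if (i : ℕ) ≤ j then S ∪ revealed E G l j else revealed E G l j := by
  ext A
  by_cases hA : A ∈ S
  · have h1 : E A ⊆ G ∪ S.biUnion E :=
      (subset_biUnion_of_mem E hA).trans subset_union_right
    have h2 : A ∉ revealed E G l j := disjoint_left.1 hS hA
    have h3 : plantLabel E G S i l A = i := by simp [plantLabel, hA]
    have h4 : A ∈ revealed E (G ∪ S.biUnion E) (plantLabel E G S i l) j ↔ (i : ℕ) ≤ j := by
      simp only [revealed, mem_filter, copiesIn, h3]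
      simp [hi, h1]
    rw [h4]
    split_ifs with h <;> simp [h, h2, hA]
  · have h0 : (A ∈ if (i : ℕ) ≤ j then S ∪ revealed E G l j else revealed E G l j) ↔
        A ∈ revealed E G l j := by split_ifs <;> simp [hA]
    rw [h0]
    by_cases hG : E A ⊆ G
    · have h3 : plantLabel E G S i l A = l A := by
        unfold plantLabel
        rw [piecewise_eq_of_notMem]
        simp [hA, newCopies, copiesIn, hG]
      simp only [revealed, mem_filter, copiesIn, h3, mem_univ, true_and]
      simp [hG, hG.trans subset_union_left]
    · have h2 : A ∉ revealed E G l j := by simp [revealed, copiesIn, hG]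
      refine iff_of_false (fun h => ?_) h2
      simp only [revealed, mem_filter, copiesIn, mem_univ, true_and] at h
      refine h.2.1 ?_
      have : A ∈ S ∪ newCopies E G S := by
        simp [newCopies, copiesIn, hG, h.1]
      simp [plantLabel, piecewise_eq_of_mem _ _ _ this, hA]

lemma planting_cost {r : ℕ} (E : ι → Finset X) (t B : ℕ) (hE : ∀ A, (E A).card ≤ t) (X₀ : Finset X)
    {p : ℝ} (hp : 0 ≤ p) (hp1 : p ≤ 1) {w : Fin (r + 1) → ℝ} (hw0 : ∀ b, 0 ≤ w b)
    (hw : ∑ b, w b = 1) (S : Finset ι) (hS : S.biUnion E ⊆ X₀) (i : Fin (r + 1))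
    (f : Finset X → (ι → Fin (r + 1)) → ℝ) (hf : ∀ G l, 0 ≤ f G l) :
    (p ^ t * w i * w 0 ^ B) ^ S.card * subsetExp p X₀ (fun G => labelExp w fun l =>
      if (newCopies E G S).card ≤ B * S.card then
        f (G ∪ S.biUnion E) (plantLabel E G S i l) else 0) ≤
      subsetExp p X₀ fun G => labelExp w (f G) := by
  have hw1 : ∀ b, w b ≤ 1 := fun b => hw ▸ single_le_sum (fun b _ => hw0 b) (mem_univ b)
  have step1 : subsetExp p X₀ (fun G => (w i * w 0 ^ B) ^ S.card * labelExp w fun l =>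
      if (newCopies E G S).card ≤ B * S.card then
        f (G ∪ S.biUnion E) (plantLabel E G S i l) else 0) ≤
      subsetExp p X₀ fun G => labelExp w (f (G ∪ S.biUnion E)) := by
    refine subsetExp_mono hp hp1 fun G _ => ?_
    by_cases hB : (newCopies E G S).card ≤ B * S.card
    · simp only [hB, if_true]
      refine le_trans ?_ (labelExp_override hw0 hw (S ∪ newCopies E G S)
        (fun A => if A ∈ S then i else 0) (f := f (G ∪ S.biUnion E)) fun x => hf _ _)
      refine mul_le_mul_of_nonneg_right ?_ (labelExp_nonneg hw0 fun x => hf _ _)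
      rw [← union_sdiff_self_eq_union, prod_union disjoint_sdiff, mul_pow, ← pow_mul]
      have e1 : ∏ A ∈ S, w (if A ∈ S then i else 0) = w i ^ S.card := by
        rw [← prod_const]
        exact prod_congr rfl fun A hA => by rw [if_pos hA]
      have e2 : ∏ A ∈ newCopies E G S \ S, w (if A ∈ S then i else 0) =
          w 0 ^ (newCopies E G S \ S).card := by
        rw [← prod_const]
        exact prod_congr rfl fun A hA => by rw [if_neg (mem_sdiff.1 hA).2]
      rw [e1, e2]
      refine mul_le_mul_of_nonneg_left ?_ (pow_nonneg (hw0 _) _)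
      exact pow_le_pow_of_le_one (hw0 _) (hw1 _) ((card_le_card sdiff_subset).trans hB)
    · simp only [hB, if_false]
      have : labelExp (ι := ι) w (fun _ => (0 : ℝ)) = 0 := labelExp_const hw 0
      rw [this, mul_zero]
      exact labelExp_nonneg hw0 fun x => hf _ _
  have step2 : p ^ (S.biUnion E).card *
      subsetExp p X₀ (fun G => labelExp w (f (G ∪ S.biUnion E))) ≤
      subsetExp p X₀ fun G => labelExp w (f G) := by
    rw [← subsetExp_plant p hS (fun G => labelExp w (f G))]
    refine subsetExp_mono hp hp1 fun G _ => ?_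
    split_ifs
    · exact le_rfl
    · exact labelExp_nonneg hw0 fun x => hf _ _
  have hcard : (S.biUnion E).card ≤ t * S.card := by
    rw [mul_comm]
    exact card_biUnion_le_card_mul _ _ _ fun A _ => hE A
  rw [subsetExp_const_mul] at step1
  refine le_trans ?_ step2
  calc _ = (p ^ (t * S.card)) * ((w i * w 0 ^ B) ^ S.card * subsetExp p X₀ (fun G => labelExp w fun l =>
      if (newCopies E G S).card ≤ B * S.card then
        f (G ∪ S.biUnion E) (plantLabel E G S i l) else 0)) := by
        rw [pow_mul, ← mul_assoc, ← mul_pow]; ring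
    _ ≤ p ^ (t * S.card) * subsetExp p X₀ fun G => labelExp w (f (G ∪ S.biUnion E)) :=
        mul_le_mul_of_nonneg_left step1 (pow_nonneg hp _)
    _ ≤ _ := by
        refine mul_le_mul_of_nonneg_right (pow_le_pow_of_le_one hp hp1 hcard) ?_
        exact subsetExp_nonneg hp hp1 fun G _ => labelExp_nonneg hw0 fun x => hf _ _

open Classical in
/-- The candidate fragments read off from the planted configuration. -/
noncomputable def fragmentCandidates {r : ℕ} (E : ι → Finset X) (𝓜 : Finset ι → Prop)
    (i ℓ : ℕ) (G : Finset X) (l : ι → Fin (r + 1)) : Finset (Finset ι) :=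
  if h : ∃ M', 𝓜 M' ∧ M' ⊆ revealed E G l (i + 1) ∧ (M' \ revealed E G l i).card ≤ ℓ then
    (h.choose \ revealed E G l i).powerset else ∅

lemma sum_fragmentCandidates_le {r : ℕ} (E : ι → Finset X) (𝓜 : Finset ι → Prop)
    (i ℓ ℓ' : ℕ) (G : Finset X) (l : ι → Fin (r + 1)) {ρ : ℝ} (hρ : 0 ≤ ρ) :
    ∑ S ∈ fragmentCandidates E 𝓜 i ℓ G l, (if ℓ' < S.card then ρ ^ S.card else 0) ≤
      ∑ j ∈ range (ℓ + 1), if ℓ' < j then (ℓ.choose j : ℝ) * ρ ^ j else 0 := by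
  have hnn : ∀ j : ℕ, 0 ≤ (if ℓ' < j then (ℓ.choose j : ℝ) * ρ ^ j else 0) := fun j => by
    split_ifs <;> positivity
  unfold fragmentCandidates
  split_ifs with h
  · have hc := h.choose_spec.2.2
    rw [sum_powerset_apply_card (fun j => if ℓ' < j then ρ ^ j else 0)]
    refine le_trans (sum_le_sum_of_subset_of_nonneg
      (range_subset_range.2 (Nat.succ_le_succ hc)) ?_) (sum_le_sum fun j _ => ?_)
    · intro j _ _
      split_ifs <;> positivity
    · split_ifs with hj
      · rw [nsmul_eq_mul]
        gcongr
      · simp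
  · simpa using sum_nonneg fun j _ => hnn j

open Classical in
lemma exists_fragment {r : ℕ} (E : ι → Finset X) (𝓜 : Finset ι → Prop) (B : ℕ)
    (i ℓ ℓ' : ℕ) (hi : i < r) (M : Finset ι) (G : Finset X) (l : ι → Fin (r + 1))
    (hgood : FewNewCopies E B M G) (hD : HasFragment E 𝓜 M G l i ℓ)
    (hD' : ¬ HasFragment E 𝓜 M G l (i + 1) ℓ') :
    ∃ S ⊆ M, ℓ' < S.card ∧ (newCopies E G S).card ≤ B * S.card ∧
      S ∈ fragmentCandidates E 𝓜 i ℓ (G ∪ S.biUnion E)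
        (plantLabel E G S ⟨i + 1, Nat.succ_lt_succ hi⟩ l) := by
  have hsub : revealed E G l i ⊆ revealed E G l (i + 1) := by
    intro A hA
    simp only [revealed, mem_filter] at hA ⊢
    exact ⟨hA.1, hA.2.1, by omega⟩
  set P : Finset ι → Prop := fun M' => 𝓜 M' ∧ M' ⊆ M ∪ revealed E G l (i + 1) ∧
    (M' \ revealed E G l i).card ≤ ℓ with hP
  have hne : (univ.filter P).Nonempty := by
    obtain ⟨M', h1, h2, h3⟩ := hD
    exact ⟨M', mem_filter.2 ⟨mem_univ _, h1, h2.trans (union_subset_union_right hsub), h3⟩⟩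
  obtain ⟨M', hM', hmin⟩ := exists_min_image (univ.filter P)
    (fun M' => (M' \ revealed E G l (i + 1)).card) hne
  obtain ⟨-, h1, h2, h3⟩ := mem_filter.1 hM'
  set S := M' \ revealed E G l (i + 1) with hS
  have hSM : S ⊆ M := fun A hA => by
    rcases mem_sdiff.1 hA with ⟨hA1, hA2⟩
    exact (mem_union.1 (h2 hA1)).resolve_right hA2
  have hcard : ℓ' < S.card := by
    by_contra hlt
    exact hD' ⟨M', h1, h2, not_lt.1 hlt⟩
  refine ⟨S, hSM, hcard, hgood S hSM, ?_⟩
  have hd1 : Disjoint S (revealed E G l (i + 1)) := sdiff_disjoint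
  have hd0 : Disjoint S (revealed E G l i) := hd1.mono_right hsub
  set k : Fin (r + 1) := ⟨i + 1, Nat.succ_lt_succ hi⟩ with hk
  have hk0 : k ≠ 0 := by
    intro h
    have := congrArg Fin.val h
    simp [hk] at this
  have e1 := revealed_plant E G S l k hk0 (i + 1) hd1
  have e0 := revealed_plant E G S l k hk0 i hd0
  rw [if_pos (by simp [hk])] at e1
  rw [if_neg (by simp [hk])] at e0
  have hex : ∃ M', 𝓜 M' ∧ M' ⊆ revealed E (G ∪ S.biUnion E) (plantLabel E G S k l) (i + 1) ∧
      (M' \ revealed E (G ∪ S.biUnion E) (plantLabel E G S k l) i).card ≤ ℓ := by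
    refine ⟨M', h1, ?_, ?_⟩
    · rw [e1]
      intro A hA
      by_cases hA' : A ∈ revealed E G l (i + 1)
      · exact mem_union_right _ hA'
      · exact mem_union_left _ (mem_sdiff.2 ⟨hA, hA'⟩)
    · rw [e0]; exact h3
  unfold fragmentCandidates
  rw [dif_pos hex, mem_powerset]
  obtain ⟨g1, g2, g3⟩ := hex.choose_spec
  set M₀ := hex.choose
  rw [e1] at g2
  rw [e0] at g3 ⊢
  have hP0 : M₀ ∈ univ.filter P := mem_filter.2 ⟨mem_univ _, g1,
    g2.trans (union_subset_union_left hSM), g3⟩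
  have hle := hmin M₀ hP0
  have hsubS : M₀ \ revealed E G l (i + 1) ⊆ S := fun A hA => by
    rcases mem_sdiff.1 hA with ⟨hA1, hA2⟩
    exact (mem_union.1 (g2 hA1)).resolve_right hA2
  have heq := eq_of_subset_of_card_le hsubS hle
  intro A hA
  have hA' := heq ▸ hA
  exact mem_sdiff.2 ⟨(mem_sdiff.1 hA').1, disjoint_left.1 hd0 hA⟩

open Classical in
lemma round_failure {r : ℕ} (E : ι → Finset X) (𝓜 : Finset ι → Prop) (t B : ℕ)
    (hE : ∀ A, (E A).card ≤ t) (X₀ : Finset X)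
    {p : ℝ} (hp : 0 ≤ p) (hp1 : p ≤ 1) {w : Fin (r + 1) → ℝ} (hw0 : ∀ b, 0 ≤ w b)
    (hw : ∑ b, w b = 1) {ν : Finset ι → ℝ} (hν : ∀ M, 0 ≤ ν M)
    (hsupp : ∀ M, ν M ≠ 0 → ∀ A ∈ M, E A ⊆ X₀)
    {κ ρ : ℝ} (hρ : 0 ≤ ρ) (hspread : ∀ S : Finset ι, (∑ M, if S ⊆ M then ν M else 0) ≤ κ ^ S.card)
    (hκ : 0 ≤ κ) (i ℓ ℓ' : ℕ) (hi : i < r)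
    (hκρ : κ ≤ ρ * (p ^ t * w ⟨i + 1, Nat.succ_lt_succ hi⟩ * w 0 ^ B)) :
    ∑ M, ν M * subsetExp p X₀ (fun G => labelExp w fun l =>
      if FewNewCopies E B M G ∧ HasFragment E 𝓜 M G l i ℓ ∧ ¬ HasFragment E 𝓜 M G l (i + 1) ℓ'
      then 1 else 0) ≤
      ∑ j ∈ range (ℓ + 1), if ℓ' < j then (ℓ.choose j : ℝ) * ρ ^ j else 0 := by
  set k : Fin (r + 1) := ⟨i + 1, Nat.succ_lt_succ hi⟩ with hk
  set c : ℝ := p ^ t * w k * w 0 ^ B with hc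
  have hc0 : 0 ≤ c := by have := hw0 k; have := hw0 0; positivity
  set g : Finset ι → Finset X → (ι → Fin (r + 1)) → ℝ := fun S G l =>
    if S ∈ fragmentCandidates E 𝓜 i ℓ G l then 1 else 0 with hg
  have hg0 : ∀ S G l, 0 ≤ g S G l := fun S G l => by simp only [hg]; split_ifs <;> norm_num
  set Φ : Finset ι → ℝ := fun S => subsetExp p X₀ (fun G => labelExp w fun l =>
      if (newCopies E G S).card ≤ B * S.card then
        g S (G ∪ S.biUnion E) (plantLabel E G S k l) else 0) with hΦ
  have hΦ0 : ∀ S, 0 ≤ Φ S := fun S => subsetExp_nonneg hp hp1 fun G _ =>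
    labelExp_nonneg hw0 fun l => by split_ifs; exacts [hg0 _ _ _, le_rfl]
  have hM : ∀ M, subsetExp p X₀ (fun G => labelExp w fun l =>
      if FewNewCopies E B M G ∧ HasFragment E 𝓜 M G l i ℓ ∧ ¬ HasFragment E 𝓜 M G l (i + 1) ℓ'
      then 1 else 0) ≤ ∑ S, if S ⊆ M then (if ℓ' < S.card then Φ S else 0) else 0 := by
    intro M
    have : ∀ S : Finset ι, (if S ⊆ M then (if ℓ' < S.card then Φ S else 0) else 0) =
        subsetExp p X₀ (fun G => labelExp w fun l => (if S ⊆ M ∧ ℓ' < S.card then 1 else 0) *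
          if (newCopies E G S).card ≤ B * S.card then
            g S (G ∪ S.biUnion E) (plantLabel E G S k l) else 0) := by
      intro S
      simp only [labelExp_const_mul, subsetExp_const_mul]
      by_cases h1 : S ⊆ M <;> by_cases h2 : ℓ' < S.card <;> simp [h1, h2, hΦ]
    simp only [this]
    rw [← subsetExp_sum]
    refine subsetExp_mono hp hp1 fun G _ => ?_
    rw [← labelExp_sum]
    refine labelExp_mono hw0 fun l => ?_
    have hnn : ∀ S ∈ (univ : Finset (Finset ι)), 0 ≤ (if S ⊆ M ∧ ℓ' < S.card then (1 : ℝ) else 0) *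
          if (newCopies E G S).card ≤ B * S.card then
            g S (G ∪ S.biUnion E) (plantLabel E G S k l) else 0 := by
      intro S _
      refine mul_nonneg (by split_ifs <;> norm_num) ?_
      split_ifs; exacts [hg0 _ _ _, le_rfl]
    split_ifs with h
    · obtain ⟨S, h1, h2, h3, h4⟩ := exists_fragment E 𝓜 B i ℓ ℓ' hi M G l h.1 h.2.1 h.2.2
      refine le_trans (le_of_eq ?_) (single_le_sum hnn (mem_univ S))
      simp [h1, h2, h3, hg, h4, hk]
    · exact sum_nonneg hnn
  have hS : ∀ S, (∑ M, if S ⊆ M then ν M else 0) * Φ S ≤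
      ρ ^ S.card * subsetExp p X₀ (fun G => labelExp w (g S G)) := by
    intro S
    by_cases hX : S.biUnion E ⊆ X₀
    · calc _ ≤ κ ^ S.card * Φ S := mul_le_mul_of_nonneg_right (hspread S) (hΦ0 S)
        _ ≤ (ρ * c) ^ S.card * Φ S :=
          mul_le_mul_of_nonneg_right (pow_le_pow_left₀ hκ hκρ _) (hΦ0 S)
        _ = ρ ^ S.card * (c ^ S.card * Φ S) := by rw [mul_pow, mul_assoc]
        _ ≤ _ := mul_le_mul_of_nonneg_left
          (planting_cost E t B hE X₀ hp hp1 hw0 hw S hX k (g S) (hg0 S)) (by positivity)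
    · have : (∑ M, if S ⊆ M then ν M else 0) = 0 := by
        refine sum_eq_zero fun M _ => ?_
        split_ifs with h
        · by_contra hne
          exact hX (biUnion_subset.2 fun A hA => hsupp M hne A (h hA))
        · rfl
      rw [this, zero_mul]
      have := subsetExp_nonneg hp hp1 (A := X₀) (f := fun G => labelExp w (g S G))
        fun G _ => labelExp_nonneg hw0 fun l => hg0 S G l
      positivity
  calc _ ≤ ∑ M, ν M * ∑ S, if S ⊆ M then (if ℓ' < S.card then Φ S else 0) else 0 :=
        sum_le_sum fun M _ => mul_le_mul_of_nonneg_left (hM M) (hν M)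
    _ = ∑ S, if ℓ' < S.card then (∑ M, if S ⊆ M then ν M else 0) * Φ S else 0 := by
        simp only [mul_sum]
        rw [sum_comm]
        refine sum_congr rfl fun S _ => ?_
        split_ifs
        · rw [sum_mul]
          refine sum_congr rfl fun M _ => ?_
          split_ifs <;> simp
        · simp
    _ ≤ ∑ S, subsetExp p X₀ (fun G => labelExp w fun l =>
          (if ℓ' < S.card then ρ ^ S.card else 0) * g S G l) := by
        refine sum_le_sum fun S _ => ?_
        simp only [labelExp_const_mul, subsetExp_const_mul]
        split_ifs
        · exact hS S
        · simp
    _ ≤ subsetExp p X₀ (fun G => labelExp w fun l =>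
          ∑ j ∈ range (ℓ + 1), if ℓ' < j then (ℓ.choose j : ℝ) * ρ ^ j else 0) := by
        rw [← subsetExp_sum]
        refine subsetExp_mono hp hp1 fun G _ => ?_
        rw [← labelExp_sum]
        refine labelExp_mono hw0 fun l => ?_
        refine le_trans (le_of_eq ?_) (sum_fragmentCandidates_le E 𝓜 i ℓ ℓ' G l hρ)
        simp only [hg, mul_ite, mul_one, mul_zero]
        rw [← sum_filter]
        simp
    _ = _ := by simp only [labelExp_const hw, subsetExp_const]

end Spread

section SpreadTheorem

open Classical in
lemma failure_le_sum_rounds {ι X : Type*} [Fintype ι] [DecidableEq ι] [DecidableEq X]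
    {r : ℕ} (E : ι → Finset X) (𝓜 : Finset ι → Prop) (t B : ℕ)
    (hE : ∀ A, (E A).card ≤ t) (X₀ : Finset X)
    {p : ℝ} (hp : 0 ≤ p) (hp1 : p ≤ 1) {w : Fin (r + 1) → ℝ} (hw0 : ∀ b, 0 ≤ w b)
    (hw : ∑ b, w b = 1) {ν : Finset ι → ℝ} (hν : ∀ M, 0 ≤ ν M) (hν1 : ∑ M, ν M = 1)
    (hsupp : ∀ M, ν M ≠ 0 → ∀ A ∈ M, E A ⊆ X₀) (hfac : ∀ M, ν M ≠ 0 → 𝓜 M)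
    (ℓ : ℕ → ℕ) (hℓ0 : ∀ M, ν M ≠ 0 → M.card ≤ ℓ 0) (hℓr : ℓ r = 0)
    {κ : ℝ} (ρ : ℕ → ℝ) (hρ : ∀ i, 0 ≤ ρ i)
    (hspread : ∀ S : Finset ι, (∑ M, if S ⊆ M then ν M else 0) ≤ κ ^ S.card) (hκ : 0 ≤ κ)
    (hκρ : ∀ i, ∀ hi : i < r,
      κ ≤ ρ i * (p ^ t * w ⟨i + 1, Nat.succ_lt_succ hi⟩ * w 0 ^ B)) :
    1 - subsetExp p X₀ (fun G => if ∃ M, 𝓜 M ∧ M ⊆ copiesIn E G then 1 else 0) ≤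
      ∑ M, ν M * subsetExp p X₀ (fun G => if FewNewCopies E B M G then 0 else 1) +
      ∑ i ∈ range r, ∑ j ∈ range (ℓ i + 1),
        if ℓ (i + 1) < j then ((ℓ i).choose j : ℝ) * ρ i ^ j else 0 := by
  set s : Finset X → ℝ := fun G => if ∃ M, 𝓜 M ∧ M ⊆ copiesIn E G then 1 else 0 with hs
  set bad : Finset ι → Finset X → ℝ := fun M G => if FewNewCopies E B M G then 0 else 1 with hbad
  set q : ℕ → Finset ι → Finset X → (ι → Fin (r + 1)) → ℝ := fun i M G l =>
    if FewNewCopies E B M G ∧ HasFragment E 𝓜 M G l i (ℓ i) ∧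
      ¬ HasFragment E 𝓜 M G l (i + 1) (ℓ (i + 1)) then 1 else 0 with hq
  have hq0 : ∀ i M G l, 0 ≤ q i M G l := fun i M G l => by
    simp only [hq]; split_ifs <;> norm_num
  have hs0 : ∀ G, 0 ≤ s G := fun G => by simp only [hs]; split_ifs <;> norm_num
  have hpt : ∀ M, ν M ≠ 0 → ∀ G l, 1 ≤ s G + bad M G + ∑ i ∈ range r, q i M G l := by
    intro M hM G l
    have hsum : 0 ≤ ∑ i ∈ range r, q i M G l := sum_nonneg fun i _ => hq0 i M G l
    by_cases hgood : FewNewCopies E B M G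
    · by_cases hall : ∀ i ≤ r, HasFragment E 𝓜 M G l i (ℓ i)
      · obtain ⟨M', h1, h2, h3⟩ := hall r le_rfl
        rw [hℓr, Nat.le_zero, card_eq_zero, sdiff_eq_empty_iff_subset] at h3
        have : s G = 1 := by
          simp only [hs]
          exact if_pos ⟨M', h1, h3.trans (filter_subset _ _)⟩
        have hb : bad M G = 0 := if_pos hgood
        linarith
      · push Not at hall
        obtain ⟨i, hi, hnot⟩ := hall
        obtain ⟨i, hi1, hi2⟩ : ∃ i < r, HasFragment E 𝓜 M G l i (ℓ i) ∧
            ¬ HasFragment E 𝓜 M G l (i + 1) (ℓ (i + 1)) := by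
          by_contra hcon
          push Not at hcon
          have : ∀ j ≤ r, HasFragment E 𝓜 M G l j (ℓ j) := by
            intro j
            induction j with
            | zero =>
              intro _
              refine ⟨M, hfac M hM, subset_union_left, ?_⟩
              exact (card_le_card sdiff_subset).trans (hℓ0 M hM)
            | succ j ih => intro hj; exact hcon j hj (ih (by omega))
          exact hnot (this i hi)
        have h1 : q i M G l = 1 := if_pos ⟨hgood, hi2⟩
        have h2 := single_le_sum (f := fun i => q i M G l) (fun i _ => hq0 i M G l)
          (mem_range.2 hi1)
        have hb : bad M G = 0 := if_pos hgood
        have := hs0 G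
        linarith
    · have : bad M G = 1 := if_neg hgood
      have := hs0 G
      linarith
  have hM : ∀ M, ν M * 1 ≤ ν M * (subsetExp p X₀ s + subsetExp p X₀ (bad M) +
      ∑ i ∈ range r, subsetExp p X₀ (fun G => labelExp w (q i M G))) := by
    intro M
    by_cases h : ν M = 0
    · simp [h]
    refine mul_le_mul_of_nonneg_left ?_ (hν M)
    rw [← subsetExp_sum, ← subsetExp_add, ← subsetExp_add]
    rw [← subsetExp_const p X₀ 1]
    refine subsetExp_mono hp hp1 fun G _ => ?_
    rw [← labelExp_sum]
    have := labelExp_mono hw0 (hpt M h G)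
    rw [labelExp_add, labelExp_const hw, labelExp_const hw] at this
    exact this
  have hsum := sum_le_sum fun M (_ : M ∈ (univ : Finset (Finset ι))) => hM M
  simp only [mul_one, hν1, mul_add, sum_add_distrib] at hsum
  rw [← sum_mul, hν1, one_mul] at hsum
  have hrounds : ∑ M, ν M * ∑ i ∈ range r, subsetExp p X₀ (fun G => labelExp w (q i M G)) ≤
      ∑ i ∈ range r, ∑ j ∈ range (ℓ i + 1),
        if ℓ (i + 1) < j then ((ℓ i).choose j : ℝ) * ρ i ^ j else 0 := by
    simp only [mul_sum]
    rw [sum_comm]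
    refine sum_le_sum fun i hi => ?_
    exact round_failure E 𝓜 t B hE X₀ hp hp1 hw0 hw hν hsupp (hρ i) hspread hκ i (ℓ i)
      (ℓ (i + 1)) (mem_range.1 hi) (hκρ i (mem_range.1 hi))
  linarith

lemma sum_choose_half_le (ℓ : ℕ) :
    ∑ j ∈ range (ℓ + 1), (if ℓ / 2 < j then (ℓ.choose j : ℝ) * (1 / 64 : ℝ) ^ j else 0) ≤
      (1 / 4 : ℝ) ^ ℓ := by
  have h : ∀ j ∈ range (ℓ + 1), (if ℓ / 2 < j then (ℓ.choose j : ℝ) * (1 / 64 : ℝ) ^ j else 0) ≤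
      (ℓ.choose j : ℝ) * (1 / 8) ^ ℓ := by
    intro j _
    split_ifs with hj
    · refine mul_le_mul_of_nonneg_left ?_ (by positivity)
      have : (1 / 64 : ℝ) ^ j = (1 / 8) ^ (2 * j) := by rw [pow_mul]; norm_num
      rw [this]
      exact pow_le_pow_of_le_one (by norm_num) (by norm_num) (by omega)
    · positivity
  refine (sum_le_sum h).trans ?_
  rw [← sum_mul]
  have := Nat.sum_range_choose ℓ
  have h2 : ∑ j ∈ range (ℓ + 1), (ℓ.choose j : ℝ) = 2 ^ ℓ := by exact_mod_cast this
  rw [h2, ← mul_pow]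
  norm_num

lemma sum_choose_pos_le (ℓ : ℕ) {ρ : ℝ} (h0 : 0 ≤ ρ) (h1 : ρ ≤ 1) :
    ∑ j ∈ range (ℓ + 1), (if 0 < j then (ℓ.choose j : ℝ) * ρ ^ j else 0) ≤ 2 ^ ℓ * ρ := by
  have h : ∀ j ∈ range (ℓ + 1), (if 0 < j then (ℓ.choose j : ℝ) * ρ ^ j else 0) ≤
      (ℓ.choose j : ℝ) * ρ := by
    intro j _
    split_ifs with hj
    · refine mul_le_mul_of_nonneg_left ?_ (by positivity)
      exact pow_le_of_le_one h0 h1 hj.ne'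
    · positivity
  refine (sum_le_sum h).trans ?_
  rw [← sum_mul]
  have := Nat.sum_range_choose ℓ
  have h2 : ∑ j ∈ range (ℓ + 1), (ℓ.choose j : ℝ) = 2 ^ ℓ := by exact_mod_cast this
  rw [h2]

lemma sum_quarter_pow_reflect_le (R : ℕ) : ∑ i ∈ range R, (1 / 4 : ℝ) ^ (R - i) ≤ 1 := by
  have h : ∀ R : ℕ, ∑ i ∈ range R, (1 / 4 : ℝ) ^ (i + 1) ≤ 1 - (1 / 4 : ℝ) ^ R := by
    intro R
    induction R with
    | zero => simp
    | succ R ih =>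
      rw [sum_range_succ]
      have : (0 : ℝ) < (1 / 4) ^ R := by positivity
      rw [pow_succ]
      linarith
  rw [← sum_range_reflect]
  refine le_trans (sum_le_sum fun i hi => ?_) ((h R).trans (by simp))
  have := mem_range.1 hi
  rw [show R - (R - 1 - i) = i + 1 by omega]

open Classical in
/-- A spread family of collections of copies is, with high probability, represented in the random
set, provided that planting copies typically creates few other copies. -/
theorem spread_theorem (t B : ℕ) (ε : ℝ) (hε : 0 < ε) : ∃ n₀ : ℕ, ∀ n ≥ n₀,
    ∀ (ι X : Type) [Fintype ι] [DecidableEq ι] [DecidableEq X] (E : ι → Finset X)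
    (𝓜 : Finset ι → Prop) (_ : ∀ A, (E A).card ≤ t) (X₀ : Finset X)
    (p : ℝ) (_ : 0 ≤ p) (_ : p ≤ 1) (ν : Finset ι → ℝ) (_ : ∀ M, 0 ≤ ν M) (_ : ∑ M, ν M = 1)
    (_ : ∀ M, ν M ≠ 0 → ∀ A ∈ M, E A ⊆ X₀) (_ : ∀ M, ν M ≠ 0 → 𝓜 M)
    (_ : ∀ M, ν M ≠ 0 → M.card ≤ n) (κ : ℝ) (_ : 0 ≤ κ)
    (_ : ∀ S : Finset ι, (∑ M, if S ⊆ M then ν M else 0) ≤ κ ^ S.card)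
    (_ : κ * (512 * 2 ^ B * Real.log n) ≤ p ^ t),
    1 - subsetExp p X₀ (fun G => if ∃ M, 𝓜 M ∧ M ⊆ copiesIn E G then 1 else 0) ≤
      ∑ M, ν M * subsetExp p X₀ (fun G => if FewNewCopies E B M G then 0 else 1) + ε := by
  obtain ⟨h, hh⟩ := exists_pow_lt_of_lt_one (half_pos hε) (show (1 / 4 : ℝ) < 1 by norm_num)
  obtain ⟨R₀, hR₀⟩ := exists_nat_gt ((2 : ℝ) ^ (2 ^ (h + 1)) / (ε / 2))
  refine ⟨2 ^ (h + R₀ + 1), fun n hn => ?_⟩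
  intro ι X _ _ _ E 𝓜 hE X₀ p hp hp1 ν hν hν1 hsupp hfac hcard κ hκ hspread hκp
  have hn0 : n ≠ 0 := by
    have : 0 < 2 ^ (h + R₀ + 1) := by positivity
    omega
  set L := Nat.log 2 n with hL
  have hL1 : h + R₀ + 1 ≤ L := (Nat.le_log_iff_pow_le (by norm_num) hn0).2 hn
  have hnL : 2 ^ L ≤ n := Nat.pow_log_le_self 2 hn0
  have hnL' : n < 2 ^ (L + 1) := Nat.lt_pow_succ_log_self (by norm_num) n
  obtain ⟨R, hR⟩ : ∃ R, L = h + R := ⟨L - h, by omega⟩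
  have hRR : R₀ < R := by omega
  have hRpos : 0 < R := by omega
  have hRpos' : (0 : ℝ) < R := by exact_mod_cast hRpos
  have hlog : (R : ℝ) ≤ 2 * Real.log n := by
    have h1 : Real.log ((2 : ℝ) ^ L) ≤ Real.log n :=
      Real.log_le_log (by positivity) (by exact_mod_cast hnL)
    rw [Real.log_pow] at h1
    have h2 : (R : ℝ) ≤ L := by exact_mod_cast (by omega : R ≤ L)
    have := Real.log_two_gt_d9
    nlinarith
  set w : Fin (R + 1 + 1) → ℝ := fun b =>
    if b = 0 then 1 / 2 else if b = Fin.last _ then 1 / 4 else 1 / (4 * R) with hw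
  have hw0 : ∀ b, 0 ≤ w b := fun b => by
    simp only [hw]; split_ifs <;> positivity
  have hw1 : ∑ b, w b = 1 := by
    rw [Fin.sum_univ_succ, Fin.sum_univ_castSucc]
    have e1 : ∀ i : Fin R, w (Fin.succ (Fin.castSucc i)) = 1 / (4 * R) := by
      intro i
      simp only [hw]
      rw [if_neg (Fin.succ_ne_zero _), if_neg]
      intro hc
      have := congrArg Fin.val hc
      simp at this
      omega
    have e2 : w (Fin.succ (Fin.last R)) = 1 / 4 := by
      simp only [hw]
      rw [if_neg (Fin.succ_ne_zero _), if_pos (Fin.succ_last _)]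
    have e3 : w 0 = 1 / 2 := by simp [hw]
    simp only [e1, e2, e3, sum_const, card_univ, Fintype.card_fin, nsmul_eq_mul]
    field_simp
    norm_num
  set ℓ : ℕ → ℕ := fun i => if i = R + 1 then 0 else n / 2 ^ i with hℓ
  set ρ : ℕ → ℝ := fun i => if i = R then 1 / (64 * R) else 1 / 64 with hρ
  have hw00 : w 0 = 1 / 2 := by simp [hw]
  have hκ' : κ ≤ p ^ t / (256 * R * 2 ^ B) := by
    rw [le_div_iff₀ (by positivity)]
    refine le_trans ?_ hκp
    refine mul_le_mul_of_nonneg_left ?_ hκ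
    have : (0 : ℝ) < 2 ^ B := by positivity
    nlinarith
  have hkey := failure_le_sum_rounds E 𝓜 t B hE X₀ hp hp1 hw0 hw1 hν hν1 hsupp hfac ℓ
    (by intro M hM; simpa [hℓ] using hcard M hM) (by simp [hℓ]) ρ
    (by intro i; simp only [hρ]; split_ifs <;> positivity) hspread hκ
    (by
      intro i hi
      refine hκ'.trans (le_of_eq ?_)
      by_cases hiR : i = R
      · have : w ⟨i + 1, Nat.succ_lt_succ hi⟩ = 1 / 4 := by
          simp only [hw]
          rw [if_neg (by simp [Fin.ext_iff]), if_pos (by simp [Fin.ext_iff, hiR])]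
        rw [this, hw00]
        simp only [hρ, if_pos hiR]
        rw [one_div_pow]
        field_simp
        ring
      · have : w ⟨i + 1, Nat.succ_lt_succ hi⟩ = 1 / (4 * R) := by
          simp only [hw]
          rw [if_neg (by simp [Fin.ext_iff]), if_neg (by simp [Fin.ext_iff]; omega)]
        rw [this, hw00]
        simp only [hρ, if_neg hiR]
        rw [one_div_pow]
        field_simp
        ring)
  refine hkey.trans (add_le_add_right ?_ _)
  rw [sum_range_succ]
  have hlast : ∑ j ∈ range (ℓ R + 1), (if ℓ (R + 1) < j then ((ℓ R).choose j : ℝ) * ρ R ^ j else 0) ≤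
      ε / 2 := by
    have e1 : ℓ (R + 1) = 0 := by simp [hℓ]
    have e2 : ρ R = 1 / (64 * R) := by simp [hρ]
    have e3 : ℓ R ≤ 2 ^ (h + 1) := by
      simp only [hℓ, if_neg (Nat.succ_ne_self R).symm]
      refine Nat.div_le_of_le_mul ?_
      rw [← pow_add]
      refine hnL'.le.trans (le_of_eq ?_)
      congr 1
      omega
    rw [e1, e2]
    have hR1 : (1 : ℝ) ≤ R := by exact_mod_cast hRpos
    refine (sum_choose_pos_le (ℓ R) (by positivity) ?_).trans ?_
    · rw [div_le_one (by positivity)]; linarith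
    · have h5 : (2 : ℝ) ^ (ℓ R) ≤ 2 ^ (2 ^ (h + 1)) := pow_le_pow_right₀ (by norm_num) e3
      rw [div_lt_iff₀ (by positivity)] at hR₀
      have hRR' : (R₀ : ℝ) ≤ R := by exact_mod_cast hRR.le
      rw [mul_one_div, div_le_iff₀ (by positivity)]
      nlinarith
  have hfirst : ∑ i ∈ range R, ∑ j ∈ range (ℓ i + 1),
      (if ℓ (i + 1) < j then ((ℓ i).choose j : ℝ) * ρ i ^ j else 0) ≤ ε / 2 := by
    have h1 : ∀ i ∈ range R, ∑ j ∈ range (ℓ i + 1),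
        (if ℓ (i + 1) < j then ((ℓ i).choose j : ℝ) * ρ i ^ j else 0) ≤
        (1 / 4) ^ h * (1 / 4 : ℝ) ^ (R - i) := by
      intro i hi
      have hi' := mem_range.1 hi
      have e1 : ℓ (i + 1) = ℓ i / 2 := by
        simp only [hℓ]
        rw [if_neg (by omega), if_neg (by omega), pow_succ, Nat.div_div_eq_div_mul]
      have e2 : ρ i = 1 / 64 := by simp only [hρ]; rw [if_neg (by omega)]
      rw [e1, e2]
      refine (sum_choose_half_le (ℓ i)).trans ?_
      rw [← pow_add]
      refine pow_le_pow_of_le_one (by norm_num) (by norm_num) ?_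
      have e3 : ℓ i = n / 2 ^ i := by simp only [hℓ]; rw [if_neg (by omega)]
      rw [e3, Nat.le_div_iff_mul_le (by positivity)]
      have e4 : L = (h + (R - i)) + i := by omega
      rw [e4, pow_add] at hnL
      refine le_trans (Nat.mul_le_mul_right _ ?_) hnL
      exact Nat.lt_two_pow_self.le
    refine (sum_le_sum h1).trans ?_
    rw [← mul_sum]
    have h2 := sum_quarter_pow_reflect_le R
    have h3 : (0 : ℝ) ≤ (1 / 4) ^ h := by positivity
    nlinarith
  linarith

end SpreadTheorem

section Balanced

variable {s : ℕ}

lemma card_mul_le_of_constant_on_edges {γ : Type*} [DecidableEq γ] {F T : Finset (Finset (Fin s))}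
    {k : ℕ} (hs : 2 ≤ s) (hk : 2 ≤ k) (hF : ∀ e ∈ F, e.card = k) (hbal : StrictlyOneBalanced F)
    (hT : T ⊆ F) (u : Fin s → γ) (hu : ∀ f ∈ T, ∀ a ∈ f, ∀ b ∈ f, u a = u b) :
    T.card * (s - 1) + F.card * (univ.image u).card ≤ F.card * s ∧
      (T.Nonempty → T ≠ F →
        T.card * (s - 1) + F.card * (univ.image u).card + 1 ≤ F.card * s) := by
  classical
  set W : γ → Finset (Fin s) := fun g => univ.filter fun a => u a = g with hW
  set P : γ → Finset (Finset (Fin s)) := fun g => T.filter fun f => f ⊆ W g with hP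
  have hPT : ∀ g, P g ⊆ T := fun g => filter_subset _ _
  have hstrict : ∀ g, (P g).Nonempty → P g ≠ F →
      (P g).card * (s - 1) + F.card < F.card * (W g).card := by
    intro g hne hneF
    have h2 : 2 ≤ (W g).card := by
      obtain ⟨f, hf⟩ := hne
      have h1 := card_le_card (mem_filter.1 hf).2
      rw [hF f (hT (hPT g hf))] at h1
      omega
    have h := hbal (W g) (P g) ((hPT g).trans hT) (fun e he => (mem_filter.1 he).2) h2 (Or.inr hneF)
    rw [Fintype.card_fin] at h
    have hw : (0 : ℝ) < (W g).card - 1 := by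
      have : (2 : ℝ) ≤ (W g).card := by exact_mod_cast h2
      linarith
    have hs' : (0 : ℝ) < (s : ℝ) - 1 := by
      have : (2 : ℝ) ≤ s := by exact_mod_cast hs
      linarith
    rw [div_lt_div_iff₀ hw hs'] at h
    have : (((P g).card * (s - 1) + F.card : ℕ) : ℝ) < ((F.card * (W g).card : ℕ) : ℝ) := by
      push_cast [Nat.cast_sub (show 1 ≤ s by omega)]
      linarith
    exact_mod_cast this
  have hle : ∀ g ∈ univ.image u, (P g).card * (s - 1) + F.card ≤ F.card * (W g).card := by
    intro g hg
    obtain ⟨a, -, rfl⟩ := mem_image.1 hg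
    have hw1 : 1 ≤ (W (u a)).card := card_pos.2 ⟨a, by simp [hW]⟩
    rcases (P (u a)).eq_empty_or_nonempty with h0 | hne
    · rw [h0]
      simpa using Nat.mul_le_mul_left F.card hw1
    · by_cases hPF : P (u a) = F
      · by_cases hWu : W (u a) = univ
        · rw [hPF, hWu, card_univ, Fintype.card_fin, ← Nat.mul_succ]
          exact Nat.mul_le_mul_left _ (by omega)
        · exfalso
          have h2 : 2 ≤ (W (u a)).card := by
            obtain ⟨f, hf⟩ := hne
            have h1 := card_le_card (mem_filter.1 hf).2
            rw [hF f (hT (hPT _ hf))] at h1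
            omega
          have h := hbal (W (u a)) F subset_rfl
            (fun e he => by rw [← hPF] at he; exact (mem_filter.1 he).2) h2 (Or.inl hWu)
          rw [Fintype.card_fin] at h
          have hw : (0 : ℝ) < (W (u a)).card - 1 := by
            have : (2 : ℝ) ≤ (W (u a)).card := by exact_mod_cast h2
            linarith
          have hws : ((W (u a)).card : ℝ) ≤ s := by
            have := card_le_univ (W (u a))
            rw [Fintype.card_fin] at this
            exact_mod_cast this
          have := div_le_div_of_nonneg_left (Nat.cast_nonneg (α := ℝ) F.card) hw
            (sub_le_sub_right hws 1)
          linarith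
      · exact (hstrict _ hne hPF).le
  have hcov : T.card ≤ ∑ g ∈ univ.image u, (P g).card := by
    refine le_trans (card_le_card ?_) card_biUnion_le
    intro f hf
    have hfk : 0 < f.card := by rw [hF f (hT hf)]; omega
    obtain ⟨a, ha⟩ := card_pos.1 hfk
    exact mem_biUnion.2 ⟨u a, mem_image_of_mem _ (mem_univ a), mem_filter.2 ⟨hf, fun b hb => by
      simpa [hW] using hu f hf b hb a ha⟩⟩
  have hsum : ∑ g ∈ univ.image u, (W g).card = s := by
    have := card_eq_sum_card_image u (univ : Finset (Fin s))
    rw [card_univ, Fintype.card_fin] at this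
    exact this.symm
  have hL : T.card * (s - 1) + F.card * (univ.image u).card ≤
      ∑ g ∈ univ.image u, ((P g).card * (s - 1) + F.card) := by
    rw [sum_add_distrib, ← sum_mul, sum_const, smul_eq_mul, mul_comm F.card]
    exact Nat.add_le_add_right (Nat.mul_le_mul_right _ hcov) _
  have hR : ∑ g ∈ univ.image u, F.card * (W g).card = F.card * s := by rw [← mul_sum, hsum]
  refine ⟨hL.trans ((sum_le_sum hle).trans hR.le), fun hne hTF => ?_⟩
  obtain ⟨f, hf⟩ := hne
  have hfk : 0 < f.card := by rw [hF f (hT hf)]; omega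
  obtain ⟨a, ha⟩ := card_pos.1 hfk
  have hfP : f ∈ P (u a) := mem_filter.2 ⟨hf, fun b hb => by
      simpa [hW] using hu f hf b hb a ha⟩
  have hlt := sum_lt_sum hle ⟨u a, mem_image_of_mem _ (mem_univ a), hstrict _ ⟨f, hfP⟩
    fun h => hTF (subset_antisymm hT (h ▸ hPT _))⟩
  rw [hR] at hlt
  omega

end Balanced

section Exploration

set_option linter.unusedSectionVars false

variable {s : ℕ} {V K β : Type*} [Fintype V] [DecidableEq V] [Fintype K] [DecidableEq K]
  [Fintype β] [DecidableEq β]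

/-- The coloured edges of a coloured copy of `F`. -/
def coloredEdges (F : Finset (Finset (Fin s))) (A : (Fin s ↪ V) × ({e // e ∈ F} → K)) :
    Finset (K × Finset V) :=
  univ.image fun f : {e // e ∈ F} => (A.2 f, f.1.map A.1)

lemma coloredEdges_injective (F : Finset (Finset (Fin s)))
    (A : (Fin s ↪ V) × ({e // e ∈ F} → K)) :
    Function.Injective fun f : {e // e ∈ F} => (A.2 f, f.1.map A.1) := by
  intro f g h
  exact Subtype.ext (map_injective A.1 (Prod.mk.inj h).2)

lemma card_coloredEdges (F : Finset (Finset (Fin s))) (A : (Fin s ↪ V) × ({e // e ∈ F} → K)) :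
    (coloredEdges F A).card = F.card := by
  rw [coloredEdges, card_image_of_injective _ (coloredEdges_injective F A), card_univ,
    Fintype.card_coe]

/-- The number of copies whose image meets the class `none` and exactly `r - 1` other classes. -/
lemma card_embeddings_le (θ : V → Option β) (Λ : ℕ)
    (hθ : ∀ b, (univ.filter fun v => θ v = b).card ≤ Λ) (r : ℕ) :
    (univ.filter fun φ : Fin s ↪ V => none ∈ univ.image (θ ∘ φ) ∧
      (univ.image (θ ∘ φ)).card = r).card ≤ (s * Λ) ^ s * Fintype.card β ^ (r - 1) := by
  classical
  have hmaps : ∀ φ ∈ (univ.filter fun φ : Fin s ↪ V => none ∈ univ.image (θ ∘ φ) ∧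
      (univ.image (θ ∘ φ)).card = r), (univ.image (θ ∘ φ)).eraseNone ∈
      powersetCard (r - 1) (univ : Finset β) := by
    intro φ hφ
    obtain ⟨-, h1, h2⟩ := mem_filter.1 hφ
    rw [mem_powersetCard]
    refine ⟨subset_univ _, ?_⟩
    rw [← card_map Function.Embedding.some, map_some_eraseNone, card_erase_of_mem h1, h2]
  refine (card_le_mul_card_image_of_maps_to hmaps ((s * Λ) ^ s) ?_).trans ?_
  · intro I hI
    set Q : Finset V := univ.filter fun v => θ v ∈ insertNone I
    have hQ : ∀ φ ∈ (univ.filter fun φ : Fin s ↪ V => none ∈ univ.image (θ ∘ φ) ∧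
        (univ.image (θ ∘ φ)).card = r).filter
          (fun φ : Fin s ↪ V => (univ.image (θ ∘ φ)).eraseNone = I),
        r ≤ s ∧ 1 ≤ r ∧ (φ : Fin s → V) ∈ Fintype.piFinset fun _ : Fin s => Q := by
      intro φ hφ
      obtain ⟨h0, h3⟩ := mem_filter.1 hφ
      obtain ⟨-, h1, h2⟩ := mem_filter.1 h0
      refine ⟨h2 ▸ card_image_le.trans (by simp), h2 ▸ card_pos.2 ⟨_, h1⟩, ?_⟩
      rw [Fintype.mem_piFinset]
      intro a
      refine mem_filter.2 ⟨mem_univ _, ?_⟩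
      rw [← h3, insertNone_eraseNone]
      exact mem_insert_of_mem (mem_image_of_mem (θ ∘ φ) (mem_univ a))
    rcases eq_empty_or_nonempty ((univ.filter fun φ : Fin s ↪ V => none ∈ univ.image (θ ∘ φ) ∧
        (univ.image (θ ∘ φ)).card = r).filter
          (fun φ : Fin s ↪ V => (univ.image (θ ∘ φ)).eraseNone = I))
      with h0 | ⟨φ₀, hφ₀⟩
    · rw [h0]; simp
    have hr := hQ φ₀ hφ₀
    have hQc : Q.card ≤ s * Λ := by
      have : Q ⊆ (insertNone I).biUnion fun b => univ.filter fun v => θ v = b := by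
        intro v hv
        exact mem_biUnion.2 ⟨θ v, (mem_filter.1 hv).2, by simp⟩
      refine (card_le_card this).trans ((card_biUnion_le_card_mul _ _ Λ fun b _ => hθ b).trans ?_)
      refine Nat.mul_le_mul_right _ ?_
      rw [card_insertNone, (mem_powersetCard.1 hI).2]
      omega
    calc _ ≤ (Fintype.piFinset fun _ : Fin s => Q).card :=
          card_le_card_of_injOn (fun φ : Fin s ↪ V => (φ : Fin s → V)) (fun φ hφ => (hQ φ hφ).2.2)
            (fun φ _ ψ _ h => DFunLike.coe_injective h)
      _ = Q.card ^ s := by simp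
      _ ≤ _ := Nat.pow_le_pow_left hQc s
  · refine Nat.mul_le_mul_left _ ?_
    rw [card_powersetCard, card_univ]
    exact Nat.choose_le_pow _ _

end Exploration

section Extensions

set_option linter.unusedSectionVars false

variable {s : ℕ} {V K β : Type*} [Fintype V] [DecidableEq V] [Fintype K] [DecidableEq K]
  [Fintype β] [DecidableEq β]

/-- The blocks of `J` other than those met by an edge of `Y`; the latter are merged. -/
def mergeBlocks (J : V → β) (Y : Finset (K × Finset V)) (v : V) : Option β :=
  if J v ∈ (Y.biUnion fun z => z.2).image J then none else some (J v)

lemma mergeBlocks_congr {J : V → β} (Y : Finset (K × Finset V)) {v w : V} (h : J v = J w) :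
    mergeBlocks J Y v = mergeBlocks J Y w := by
  simp [mergeBlocks, h]

lemma mergeBlocks_eq_none {J : V → β} {Y : Finset (K × Finset V)} {z : K × Finset V} (hz : z ∈ Y)
    {v : V} (hv : v ∈ z.2) : mergeBlocks J Y v = none := by
  rw [mergeBlocks, if_pos]
  exact mem_image_of_mem _ (mem_biUnion.2 ⟨z, hz, hv⟩)

lemma card_fiber_mergeBlocks_le {J : V → β} {Y : Finset (K × Finset V)} {k y : ℕ} (hk : 1 ≤ k)
    (hJ : ∀ b, (univ.filter fun v => J v = b).card ≤ s) (hYk : ∀ z ∈ Y, z.2.card ≤ k)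
    (hy : Y.card ≤ y) (hy1 : 1 ≤ y) (b : Option β) :
    (univ.filter fun v => mergeBlocks J Y v = b).card ≤ s * (k * y) := by
  cases b with
  | none =>
    set O := (Y.biUnion fun z => z.2).image J with hO
    have hOc : O.card ≤ k * y := by
      refine card_image_le.trans ((card_biUnion_le_card_mul _ _ k hYk).trans ?_)
      rw [mul_comm]
      exact Nat.mul_le_mul_left _ hy
    have : (univ.filter fun v => mergeBlocks J Y v = none) ⊆
        O.biUnion fun b => univ.filter fun v => J v = b := by
      intro v hv
      have h := (mem_filter.1 hv).2
      rw [mergeBlocks] at h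
      split_ifs at h with h1
      exact mem_biUnion.2 ⟨J v, h1, by simp⟩
    refine (card_le_card this).trans ((card_biUnion_le_card_mul _ _ s fun b _ => hJ b).trans ?_)
    rw [mul_comm]
    exact Nat.mul_le_mul_left _ hOc
  | some b =>
    refine (card_le_card (t := univ.filter fun v => J v = b) ?_).trans ((hJ b).trans ?_)
    · intro v hv
      have h := (mem_filter.1 hv).2
      rw [mergeBlocks] at h
      split_ifs at h with h1
      simpa using h
    · exact Nat.le_mul_of_pos_right _ (Nat.mul_pos hk hy1)

/-- The edges of a coloured copy which lie in `Z`. -/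
def oldEdges (F : Finset (Finset (Fin s))) (Z : Finset (K × Finset V))
    (A : (Fin s ↪ V) × ({e // e ∈ F} → K)) : Finset {e // e ∈ F} :=
  univ.filter fun f => (A.2 f, f.1.map A.1) ∈ Z

lemma card_coloredEdges_sdiff (F : Finset (Finset (Fin s))) (Z : Finset (K × Finset V))
    (A : (Fin s ↪ V) × ({e // e ∈ F} → K)) :
    (coloredEdges F A \ Z).card = F.card - (oldEdges F Z A).card := by
  have h : (oldEdges F Z A).card = (coloredEdges F A ∩ Z).card := by
    rw [← card_image_of_injective _ (coloredEdges_injective F A)]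
    congr 1
    ext z
    simp only [oldEdges, coloredEdges, mem_image, mem_filter, mem_univ, true_and, mem_inter]
    constructor
    · rintro ⟨f, hf, rfl⟩; exact ⟨⟨f, rfl⟩, hf⟩
    · rintro ⟨⟨f, rfl⟩, hf⟩; exact ⟨f, hf, rfl⟩
  have := card_sdiff_add_card_inter (coloredEdges F A) Z
  rw [card_coloredEdges] at this
  omega

lemma oldEdges_eq_univ_iff (F : Finset (Finset (Fin s))) (Z : Finset (K × Finset V))
    (A : (Fin s ↪ V) × ({e // e ∈ F} → K)) :
    oldEdges F Z A = univ ↔ coloredEdges F A ⊆ Z := by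
  rw [eq_univ_iff_forall]
  simp only [oldEdges, coloredEdges, mem_filter, mem_univ, true_and, image_subset_iff,
    forall_const]

/-- The coloured copies through `x` with prescribed set of old edges: the underlying embeddings
are constant, up to merging, on old edges, and there are few colourings of each embedding. -/
lemma card_copies_with_oldEdges_le {F : Finset (Finset (Fin s))} {k : ℕ} (hk : 1 ≤ k)
    (hF : ∀ e ∈ F, e.card = k) {EM : Finset (K × Finset V)} {J : V → β}
    (hEMJ : ∀ z ∈ EM, ∀ v ∈ z.2, ∀ w ∈ z.2, J v = J w)
    (hEMc : ∀ i j e, (i, e) ∈ EM → (j, e) ∈ EM → i = j)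
    {Y : Finset (K × Finset V)} {y : ℕ} (hy : Y.card + 1 ≤ y) {x : K × Finset V}
    (T : Finset {e // e ∈ F}) :
    (univ.filter fun A : (Fin s ↪ V) × ({e // e ∈ F} → K) =>
      x ∈ coloredEdges F A ∧ oldEdges F (Y ∪ EM) A = T).card ≤
    (univ.filter fun φ : Fin s ↪ V => none ∈ univ.image (mergeBlocks J (insert x Y) ∘ φ) ∧
        ∀ f ∈ T, ∀ a ∈ f.1, ∀ b ∈ f.1, (mergeBlocks J (insert x Y) ∘ φ) a =
          (mergeBlocks J (insert x Y) ∘ φ) b).card *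
      (y ^ F.card * Fintype.card K ^ (F.card - T.card)) := by
  classical
  set Φ := univ.filter fun φ : Fin s ↪ V => none ∈ univ.image (mergeBlocks J (insert x Y) ∘ φ) ∧
        ∀ f ∈ T, ∀ a ∈ f.1, ∀ b ∈ f.1, (mergeBlocks J (insert x Y) ∘ φ) a =
          (mergeBlocks J (insert x Y) ∘ φ) b with hΦ
  set cols : (Fin s ↪ V) → {e // e ∈ F} → Finset K := fun φ f =>
    if f ∈ T then univ.filter (fun i => (i, f.1.map φ) ∈ Y ∪ EM) else univ with hcols
  have hsub : (univ.filter fun A : (Fin s ↪ V) × ({e // e ∈ F} → K) =>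
      x ∈ coloredEdges F A ∧ oldEdges F (Y ∪ EM) A = T) ⊆
      Φ.biUnion fun φ => (Fintype.piFinset (cols φ)).image fun c => (φ, c) := by
    rintro ⟨φ, c⟩ hA
    obtain ⟨-, hxA, hold⟩ := mem_filter.1 hA
    have hTold : ∀ f, f ∈ T → (c f, f.1.map φ) ∈ Y ∪ EM := by
      intro f hf
      rw [← hold] at hf
      exact (mem_filter.1 hf).2
    refine mem_biUnion.2 ⟨φ, mem_filter.2 ⟨mem_univ _, ?_, ?_⟩, mem_image.2 ⟨c, ?_, rfl⟩⟩
    · obtain ⟨f, -, hf⟩ := mem_image.1 hxA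
      have : 0 < f.1.card := by rw [hF _ f.2]; omega
      obtain ⟨a, ha⟩ := card_pos.1 this
      refine mem_image.2 ⟨a, mem_univ _, ?_⟩
      refine mergeBlocks_eq_none (mem_insert_self x Y) ?_
      rw [← hf]
      exact mem_map_of_mem _ ha
    · intro f hf a ha b hb
      rcases mem_union.1 (hTold f hf) with h | h
      · simp only [Function.comp]
        rw [mergeBlocks_eq_none (mem_insert_of_mem h) (mem_map_of_mem φ ha),
          mergeBlocks_eq_none (mem_insert_of_mem h) (mem_map_of_mem φ hb)]
      · exact mergeBlocks_congr _ (hEMJ _ h _ (mem_map_of_mem φ ha) _ (mem_map_of_mem φ hb))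
    · rw [Fintype.mem_piFinset]
      intro f
      simp only [hcols]
      split_ifs with hf
      · exact mem_filter.2 ⟨mem_univ _, hTold f hf⟩
      · exact mem_univ _
  refine (card_le_card hsub).trans (card_biUnion_le_card_mul _ _ _ fun φ _ => ?_)
  refine card_image_le.trans ?_
  rw [Fintype.card_piFinset]
  have hy1 : 1 ≤ y := by omega
  have hcard : ∀ f, (cols φ f).card ≤ y * (if f ∈ T then 1 else Fintype.card K) := by
    intro f
    simp only [hcols]
    split_ifs with hf
    · rw [mul_one]
      refine le_trans ?_ hy
      have h1 : (univ.filter fun i => (i, f.1.map φ) ∈ Y ∪ EM) ⊆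
          (Y.image Prod.fst) ∪ (univ.filter fun i => (i, f.1.map φ) ∈ EM) := by
        intro i hi
        rcases mem_union.1 (mem_filter.1 hi).2 with h | h
        · exact mem_union_left _ (mem_image.2 ⟨_, h, rfl⟩)
        · exact mem_union_right _ (mem_filter.2 ⟨mem_univ _, h⟩)
      refine (card_le_card h1).trans ((card_union_le _ _).trans (add_le_add card_image_le ?_))
      rw [card_le_one]
      intro i hi j hj
      exact hEMc i j _ (mem_filter.1 hi).2 (mem_filter.1 hj).2
    · rw [card_univ]
      exact Nat.le_mul_of_pos_left _ hy1
  refine (prod_le_prod' fun f _ => hcard f).trans (le_of_eq ?_)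
  rw [prod_mul_distrib, prod_const, card_univ, Fintype.card_coe]
  congr 1
  rw [prod_ite, prod_const_one, one_mul, prod_const]
  congr 1
  rw [filter_not, filter_mem_eq_inter, univ_inter, ← compl_eq_univ_sdiff, card_compl,
    Fintype.card_coe]

lemma sum_extensions_le {F : Finset (Finset (Fin s))} {k : ℕ} (hs : 2 ≤ s) (hk : 2 ≤ k)
    (ht : 0 < F.card) (hF : ∀ e ∈ F, e.card = k)
    (hbal : StrictlyOneBalanced F) {EM : Finset (K × Finset V)} {J : V → β}
    (hJ : ∀ b, (univ.filter fun v => J v = b).card ≤ s)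
    (hEMk : ∀ z ∈ EM, z.2.card = k)
    (hEMJ : ∀ z ∈ EM, ∀ v ∈ z.2, ∀ w ∈ z.2, J v = J w)
    (hEMc : ∀ i j e, (i, e) ∈ EM → (j, e) ∈ EM → i = j)
    {p ζ : ℝ} (hp : 0 ≤ p)
    (hζ : ∀ j r : ℕ, 1 ≤ j → j ≤ F.card → 1 ≤ r → F.card * r + 1 ≤ F.card + j * (s - 1) →
      (Fintype.card K * p) ^ j * (Fintype.card β : ℝ) ^ (r - 1) ≤ ζ)
    {Y : Finset (K × Finset V)} (hYk : ∀ z ∈ Y, z.2.card = k) {y : ℕ} (hy : Y.card + 1 ≤ y)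
    {x : K × Finset V} (hx : x ∈ EM) :
    ∑ A ∈ univ.filter (fun A : (Fin s ↪ V) × ({e // e ∈ F} → K) =>
      x ∈ coloredEdges F A ∧ ¬ coloredEdges F A ⊆ Y ∪ EM),
        p ^ (coloredEdges F A \ (Y ∪ EM)).card ≤
      2 ^ F.card * (y ^ F.card * (s * (s * (s * (k * y))) ^ s)) * ζ := by
  classical
  set Λ := s * (k * y) with hΛ
  set θ := mergeBlocks J (insert x Y) with hθ
  have hinsk : ∀ z ∈ insert x Y, z.2.card ≤ k := by
    intro z hz
    rcases mem_insert.1 hz with rfl | h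
    · exact (hEMk _ hx).le
    · exact (hYk z h).le
  have hθc : ∀ b, (univ.filter fun v => θ v = b).card ≤ Λ := fun b =>
    card_fiber_mergeBlocks_le (by omega) hJ hinsk ((card_insert_le _ _).trans hy) (by omega) b
  have hmap : ∀ A ∈ univ.filter (fun A : (Fin s ↪ V) × ({e // e ∈ F} → K) =>
      x ∈ coloredEdges F A ∧ ¬ coloredEdges F A ⊆ Y ∪ EM),
      oldEdges F (Y ∪ EM) A ∈ univ.filter fun T : Finset {e // e ∈ F} => T ≠ univ ∧ T.Nonempty := by
    intro A hA
    obtain ⟨-, hxA, hnot⟩ := mem_filter.1 hA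
    refine mem_filter.2 ⟨mem_univ _, fun h => hnot ((oldEdges_eq_univ_iff F _ A).1 h), ?_⟩
    obtain ⟨f, -, hf⟩ := mem_image.1 hxA
    refine ⟨f, mem_filter.2 ⟨mem_univ _, ?_⟩⟩
    rw [hf]
    exact mem_union_right _ hx
  rw [← sum_fiberwise_of_maps_to hmap]
  have hterm : ∀ T ∈ univ.filter (fun T : Finset {e // e ∈ F} => T ≠ univ ∧ T.Nonempty),
      ∑ A ∈ (univ.filter (fun A : (Fin s ↪ V) × ({e // e ∈ F} → K) =>
        x ∈ coloredEdges F A ∧ ¬ coloredEdges F A ⊆ Y ∪ EM)).filter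
          (fun A => oldEdges F (Y ∪ EM) A = T), p ^ (coloredEdges F A \ (Y ∪ EM)).card ≤
      (y ^ F.card * (s * (s * Λ) ^ s)) * ζ := by
    intro T hT
    obtain ⟨-, hTu, hTne⟩ := mem_filter.1 hT
    set j := F.card - T.card with hj
    have hTlt : T.card < F.card := by
      have := card_lt_univ_of_notMem (s := T) (x := (by
        exact (Classical.choose (not_forall.1 (mt eq_univ_iff_forall.2 hTu)))))
        (Classical.choose_spec (not_forall.1 (mt eq_univ_iff_forall.2 hTu)))
      rwa [Fintype.card_coe] at this
    rw [sum_congr rfl (g := fun _ => p ^ j) (fun A hA => by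
      rw [card_coloredEdges_sdiff, (mem_filter.1 hA).2]), sum_const, nsmul_eq_mul]
    set Φ := univ.filter fun φ : Fin s ↪ V => none ∈ univ.image (θ ∘ φ) ∧
        ∀ f ∈ T, ∀ a ∈ f.1, ∀ b ∈ f.1, (θ ∘ φ) a = (θ ∘ φ) b with hΦ
    have h1 : (((univ.filter (fun A : (Fin s ↪ V) × ({e // e ∈ F} → K) =>
        x ∈ coloredEdges F A ∧ ¬ coloredEdges F A ⊆ Y ∪ EM)).filter
          (fun A => oldEdges F (Y ∪ EM) A = T)).card : ℝ) ≤
        Φ.card * (y ^ F.card * Fintype.card K ^ j) := by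
      have h := card_copies_with_oldEdges_le (by omega) hF hEMJ hEMc hy (x := x) T
      refine le_trans (Nat.cast_le.2 (card_le_card ?_)) (by exact_mod_cast h)
      intro A hA
      obtain ⟨h1, h2⟩ := mem_filter.1 hA
      exact mem_filter.2 ⟨mem_univ _, (mem_filter.1 h1).2.1, h2⟩
    set Rs := (Icc 1 s).filter fun r => F.card * r + 1 ≤ F.card + j * (s - 1) with hRs
    have hΦmap : Φ ⊆ Rs.biUnion fun r => univ.filter fun φ : Fin s ↪ V =>
        none ∈ univ.image (θ ∘ φ) ∧ (univ.image (θ ∘ φ)).card = r := by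
      intro φ hφ
      obtain ⟨-, hn, hc⟩ := mem_filter.1 hφ
      refine mem_biUnion.2 ⟨(univ.image (θ ∘ φ)).card, ?_, mem_filter.2 ⟨mem_univ _, hn, rfl⟩⟩
      have hb := (card_mul_le_of_constant_on_edges (T := T.map (Function.Embedding.subtype _))
        hs hk hF hbal (fun e he => by
          obtain ⟨f, -, rfl⟩ := mem_map.1 he
          exact f.2) (θ ∘ φ) (fun e he => by
          obtain ⟨f, hf, rfl⟩ := mem_map.1 he
          exact hc f hf)).2 (hTne.map) (fun h => by
          have := congrArg card h
          rw [card_map] at this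
          omega)
      rw [card_map] at hb
      refine mem_filter.2 ⟨mem_Icc.2 ⟨card_pos.2 ⟨_, hn⟩, card_image_le.trans (by simp)⟩, ?_⟩
      have e1 : F.card * s = F.card * (s - 1) + F.card := by
        rw [← Nat.mul_succ]; congr 1; omega
      have e2 : F.card * (s - 1) = T.card * (s - 1) + j * (s - 1) := by
        rw [← Nat.add_mul]; congr 1; omega
      omega
    have h2 : (Φ.card : ℝ) * (Fintype.card K * p) ^ j ≤ s * (s * Λ : ℝ) ^ s * ζ := by
      have hP : (0 : ℝ) ≤ (Fintype.card K * p) ^ j := by positivity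
      have h3 : (Φ.card : ℝ) ≤ ∑ r ∈ Rs, ((s * Λ : ℝ) ^ s * (Fintype.card β : ℝ) ^ (r - 1)) := by
        have := (card_le_card hΦmap).trans (card_biUnion_le.trans
          (sum_le_sum fun r _ => card_embeddings_le θ Λ hθc r))
        exact_mod_cast this
      have hζ0 : ∀ r ∈ Rs, (Fintype.card K * p) ^ j * (Fintype.card β : ℝ) ^ (r - 1) ≤ ζ :=
        fun r hr => hζ j r (by omega) (by omega) (mem_Icc.1 (mem_filter.1 hr).1).1
          (mem_filter.1 hr).2
      have hζnn : Rs.Nonempty → 0 ≤ ζ := fun ⟨r, hr⟩ => le_trans (by positivity) (hζ0 r hr)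
      calc (Φ.card : ℝ) * (Fintype.card K * p) ^ j
          ≤ (∑ r ∈ Rs, ((s * Λ : ℝ) ^ s * (Fintype.card β : ℝ) ^ (r - 1))) *
              (Fintype.card K * p) ^ j := mul_le_mul_of_nonneg_right h3 hP
        _ = ∑ r ∈ Rs, (s * Λ : ℝ) ^ s *
              ((Fintype.card K * p) ^ j * (Fintype.card β : ℝ) ^ (r - 1)) := by
            rw [sum_mul]; exact sum_congr rfl fun r _ => by ring
        _ ≤ ∑ r ∈ Rs, (s * Λ : ℝ) ^ s * ζ :=
            sum_le_sum fun r hr => mul_le_mul_of_nonneg_left (hζ0 r hr) (by positivity)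
        _ = Rs.card * ((s * Λ : ℝ) ^ s * ζ) := by rw [sum_const, nsmul_eq_mul]
        _ ≤ s * ((s * Λ : ℝ) ^ s * ζ) := by
            have hζ1 : 0 ≤ ζ := le_trans (by positivity) (hζ 1 1 le_rfl ht le_rfl (by omega))
            refine mul_le_mul_of_nonneg_right ?_ (by positivity)
            have : Rs.card ≤ s := (card_filter_le _ _).trans (by simp)
            exact_mod_cast this
        _ = _ := by ring
    calc _ ≤ Φ.card * (y ^ F.card * Fintype.card K ^ j) * p ^ j :=
          mul_le_mul_of_nonneg_right h1 (by positivity)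
      _ = y ^ F.card * (Φ.card * (Fintype.card K * p) ^ j) := by rw [mul_pow]; ring
      _ ≤ y ^ F.card * (s * (s * Λ : ℝ) ^ s * ζ) := mul_le_mul_of_nonneg_left h2 (by positivity)
      _ = _ := by ring
  refine (sum_le_sum hterm).trans ?_
  rw [sum_const, nsmul_eq_mul, mul_assoc]
  have hζ1 : 0 ≤ ζ := le_trans (by positivity) (hζ 1 1 le_rfl ht le_rfl (by omega))
  have hcard : (univ.filter (fun T : Finset {e // e ∈ F} => T ≠ univ ∧ T.Nonempty)).card ≤
      2 ^ F.card := by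
    refine (card_filter_le _ _).trans ?_
    rw [card_univ, Fintype.card_finset, Fintype.card_coe]
  have hcard' : ((univ.filter (fun T : Finset {e // e ∈ F} => T ≠ univ ∧ T.Nonempty)).card : ℝ) ≤
      2 ^ F.card := by exact_mod_cast hcard
  refine (mul_le_mul_of_nonneg_right hcard' (by positivity)).trans (le_of_eq ?_)
  rw [hΛ]
  push_cast
  ring

end Extensions

section Chains

variable {ι X : Type*} [Fintype ι] [DecidableEq ι] [DecidableEq X]

/-- There are `j` successive copies through `x`, each contained in `EM`, the previous ones and
`G`, but not in `EM` and the previous ones. -/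
def ExtensionChain (E : ι → Finset X) (EM : Finset X) (x : X) :
    ℕ → Finset X → Finset X → Prop
  | 0, _, _ => True
  | j + 1, Y, G => ∃ A, x ∈ E A ∧ ¬ E A ⊆ Y ∪ EM ∧ E A ⊆ Y ∪ EM ∪ G ∧
      ExtensionChain E EM x j (Y ∪ E A) G

omit [Fintype ι] [DecidableEq ι] in
lemma ExtensionChain.of_union {E : ι → Finset X} {EM : Finset X} {x : X} {U : Finset X} :
    ∀ {j : ℕ} {Y G : Finset X}, U ⊆ Y → ExtensionChain E EM x j Y (G ∪ U) →
      ExtensionChain E EM x j Y G := by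
  intro j
  induction j with
  | zero => intro Y G _ _; trivial
  | succ j ih =>
    rintro Y G hU ⟨A, h1, h2, h3, h4⟩
    refine ⟨A, h1, h2, h3.trans ?_, ih (hU.trans subset_union_left) h4⟩
    refine union_subset subset_union_left (union_subset subset_union_right ?_)
    exact hU.trans (subset_union_left.trans subset_union_left)

omit [DecidableEq ι] in
open Classical in
lemma subsetExp_extensionChain_le {E : ι → Finset X} {EM : Finset X} {x : X} {t : ℕ}
    (hE : ∀ A, (E A).card ≤ t) (P : Finset X → Prop) (hP : ∀ Y A, P Y → P (Y ∪ E A))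
    {X₀ : Finset X} {p η : ℝ} (hp : 0 ≤ p) (hp1 : p ≤ 1) (hη0 : 0 ≤ η) {y : ℕ}
    (hη : ∀ Y, P Y → Y.card ≤ y →
      ∑ A ∈ univ.filter (fun A => x ∈ E A ∧ ¬ E A ⊆ Y ∪ EM), p ^ (E A \ (Y ∪ EM)).card ≤ η) :
    ∀ (j : ℕ) (Y : Finset X), P Y → Y.card + t * j ≤ y →
      subsetExp p X₀ (fun G => if ExtensionChain E EM x j Y G then 1 else 0) ≤ η ^ j := by
  intro j
  induction j with
  | zero => intro Y _ _; simp [ExtensionChain, subsetExp_const]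
  | succ j ih =>
    intro Y hPY hY
    rw [Nat.mul_succ] at hY
    set S := univ.filter (fun A => x ∈ E A ∧ ¬ E A ⊆ Y ∪ EM) with hS
    set f : ι → Finset X → ℝ := fun A G =>
      if ExtensionChain E EM x j (Y ∪ E A) G then 1 else 0 with hf
    have hf0 : ∀ A G, 0 ≤ f A G := fun A G => by simp only [hf]; split_ifs <;> norm_num
    have h1 : subsetExp p X₀ (fun G => if ExtensionChain E EM x (j + 1) Y G then 1 else 0) ≤
        subsetExp p X₀ (fun G => ∑ A ∈ S, if E A \ (Y ∪ EM) ⊆ G then f A G else 0) := by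
      refine subsetExp_mono hp hp1 fun G _ => ?_
      have hnn : ∀ A ∈ S, 0 ≤ if E A \ (Y ∪ EM) ⊆ G then f A G else 0 := fun A _ => by
        split_ifs
        · exact hf0 A G
        · exact le_rfl
      by_cases hc : ExtensionChain E EM x (j + 1) Y G
      · rw [if_pos hc]
        obtain ⟨A, h1, h2, h3, h4⟩ := hc
        refine le_trans (le_of_eq ?_) (single_le_sum hnn (mem_filter.2 ⟨mem_univ A, h1, h2⟩))
        rw [if_pos (show E A \ (Y ∪ EM) ⊆ G from sdiff_le_iff.2 h3)]
        simp only [hf]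
        rw [if_pos h4]
      · rw [if_neg hc]
        exact sum_nonneg hnn
    refine h1.trans ?_
    rw [subsetExp_sum]
    have h2 : ∀ A ∈ S, subsetExp p X₀ (fun G => if E A \ (Y ∪ EM) ⊆ G then f A G else 0) ≤
        p ^ (E A \ (Y ∪ EM)).card * η ^ j := by
      intro A _
      by_cases hU : E A \ (Y ∪ EM) ⊆ X₀
      · rw [subsetExp_plant p hU]
        refine mul_le_mul_of_nonneg_left ?_ (by positivity)
        refine le_trans (subsetExp_mono hp hp1 fun G _ => ?_) (ih (Y ∪ E A) (hP _ _ hPY) ?_)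
        · simp only [hf]
          split_ifs with h1 h2
          · exact le_rfl
          · exact absurd (h1.of_union (sdiff_subset.trans subset_union_right)) h2
          · norm_num
          · exact le_rfl
        · have := card_union_le Y (E A)
          have := hE A
          omega
      · refine le_trans (le_of_eq ?_) (by positivity)
        refine Eq.trans (subsetExp_congr fun G hG => ?_) (subsetExp_const p X₀ 0)
        exact if_neg fun h => hU (h.trans hG)
    refine (sum_le_sum h2).trans ?_
    rw [← sum_mul, pow_succ, mul_comm]
    exact mul_le_mul_of_nonneg_left (hη Y hPY (by omega)) (by positivity)

omit [Fintype ι] [DecidableEq ι] in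
lemma exists_core_of_not_extensionChain {E : ι → Finset X} {EM : Finset X} {x : X} {t : ℕ}
    (hE : ∀ A, (E A).card ≤ t) (P : Finset X → Prop) (hP : ∀ Y A, P Y → P (Y ∪ E A))
    {G : Finset X} : ∀ (b : ℕ) (Y : Finset X), P Y → ¬ ExtensionChain E EM x b Y G →
      ∃ Y', P Y' ∧ Y'.card ≤ Y.card + t * b ∧
        ∀ A, x ∈ E A → E A ⊆ Y ∪ EM ∪ G → E A ⊆ Y' ∪ EM := by
  intro b
  induction b with
  | zero => intro Y _ h; exact absurd trivial h
  | succ b ih =>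
    intro Y hPY h
    by_cases hA : ∃ A, x ∈ E A ∧ ¬ E A ⊆ Y ∪ EM ∧ E A ⊆ Y ∪ EM ∪ G
    · obtain ⟨A, h1, h2, h3⟩ := hA
      obtain ⟨Y', hP', hc, hY'⟩ := ih (Y ∪ E A) (hP _ _ hPY) fun h4 => h ⟨A, h1, h2, h3, h4⟩
      refine ⟨Y', hP', ?_, fun A' hx hA' => hY' A' hx (hA'.trans ?_)⟩
      · have := card_union_le Y (E A)
        have := hE A
        rw [Nat.mul_succ]
        omega
      · exact union_subset_union (union_subset_union subset_union_left subset_rfl) subset_rfl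
    · refine ⟨Y, hPY, Nat.le_add_right _ _, fun A hx hA' => ?_⟩
      by_contra hcon
      exact hA ⟨A, hx, hcon, hA'⟩

lemma fewNewCopies_of_not_extensionChain {E : ι → Finset X} {M : Finset ι} {t B b : ℕ}
    (hE : ∀ A, (E A).card ≤ t) (P : Finset X → Prop) (hP0 : P ∅)
    (hP : ∀ Y A, P Y → P (Y ∪ E A)) {G : Finset X}
    (hB : ∀ x ∈ M.biUnion E, ∀ Y, P Y → Y.card ≤ t * b →
      (univ.filter fun A => x ∈ E A ∧ E A ⊆ Y ∪ M.biUnion E).card ≤ B)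
    (hG : ∀ x ∈ M.biUnion E, ¬ ExtensionChain E (M.biUnion E) x b ∅ G) :
    FewNewCopies E (t * B) M G := by
  intro S hS
  have hsub : newCopies E G S ⊆ (S.biUnion E).biUnion fun x =>
      univ.filter fun A => x ∈ E A ∧ E A ⊆ M.biUnion E ∪ G := by
    intro A hA
    simp only [newCopies, copiesIn, mem_sdiff, mem_filter, mem_univ, true_and] at hA
    obtain ⟨h1, h2⟩ := hA
    obtain ⟨x, hx, hxG⟩ := not_subset.1 h2
    have hxS : x ∈ S.biUnion E := (mem_union.1 (h1 hx)).resolve_left hxG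
    refine mem_biUnion.2 ⟨x, hxS, mem_filter.2 ⟨mem_univ _, hx, h1.trans ?_⟩⟩
    exact union_subset subset_union_right
      ((biUnion_subset_biUnion_of_subset_left _ hS).trans subset_union_left)
  refine (card_le_card hsub).trans ((card_biUnion_le_card_mul _ _ B fun x hx => ?_).trans ?_)
  · have hxM : x ∈ M.biUnion E := biUnion_subset_biUnion_of_subset_left _ hS hx
    obtain ⟨Y, hPY, hc, hY⟩ := exists_core_of_not_extensionChain hE P hP b ∅ hP0 (hG x hxM)
    rw [card_empty, zero_add] at hc
    refine (card_le_card ?_).trans (hB x hxM Y hPY hc)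
    intro A hA
    obtain ⟨-, h1, h2⟩ := mem_filter.1 hA
    exact mem_filter.2 ⟨mem_univ _, h1, hY A h1 (by simpa using h2)⟩
  · rw [mul_assoc, mul_comm B, ← mul_assoc, mul_comm t]
    exact Nat.mul_le_mul_right _ (card_biUnion_le_card_mul _ _ t fun A _ => hE A)

open Classical in
/-- If copies extend `EM` at an expected rate of at most `η`, then planting copies from `M`
creates few new copies, except with probability about `η ^ b`. -/
lemma subsetExp_fewNewCopies_le {E : ι → Finset X} {M : Finset ι} {t B b : ℕ}
    (hE : ∀ A, (E A).card ≤ t) (P : Finset X → Prop) (hP0 : P ∅)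
    (hP : ∀ Y A, P Y → P (Y ∪ E A))
    (hB : ∀ x ∈ M.biUnion E, ∀ Y, P Y → Y.card ≤ t * b →
      (univ.filter fun A => x ∈ E A ∧ E A ⊆ Y ∪ M.biUnion E).card ≤ B)
    {X₀ : Finset X} {p η : ℝ} (hp : 0 ≤ p) (hp1 : p ≤ 1) (hη0 : 0 ≤ η)
    (hη : ∀ x ∈ M.biUnion E, ∀ Y, P Y → Y.card ≤ t * b →
      ∑ A ∈ univ.filter (fun A => x ∈ E A ∧ ¬ E A ⊆ Y ∪ M.biUnion E),
        p ^ (E A \ (Y ∪ M.biUnion E)).card ≤ η) :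
    subsetExp p X₀ (fun G => if FewNewCopies E (t * B) M G then 0 else 1) ≤
      t * M.card * η ^ b := by
  have h1 : subsetExp p X₀ (fun G => if FewNewCopies E (t * B) M G then 0 else 1) ≤
      subsetExp p X₀ (fun G => ∑ x ∈ M.biUnion E,
        if ExtensionChain E (M.biUnion E) x b ∅ G then 1 else 0) := by
    refine subsetExp_mono hp hp1 fun G _ => ?_
    have hnn : ∀ x ∈ M.biUnion E,
        (0 : ℝ) ≤ if ExtensionChain E (M.biUnion E) x b ∅ G then 1 else 0 := fun x _ => by
      split_ifs <;> norm_num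
    by_cases hF : FewNewCopies E (t * B) M G
    · rw [if_pos hF]; exact sum_nonneg hnn
    · rw [if_neg hF]
      have : ¬ ∀ x ∈ M.biUnion E, ¬ ExtensionChain E (M.biUnion E) x b ∅ G :=
        fun h => hF (fewNewCopies_of_not_extensionChain hE P hP0 hP hB h)
      push Not at this
      obtain ⟨x, hx, hc⟩ := this
      refine le_trans (le_of_eq ?_) (single_le_sum hnn hx)
      rw [if_pos hc]
  refine h1.trans ?_
  rw [subsetExp_sum]
  refine (sum_le_sum fun x hx => subsetExp_extensionChain_le hE P hP hp hp1 hη0 (hη x hx) b ∅ hP0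
    (by simp)).trans ?_
  rw [sum_const, nsmul_eq_mul]
  refine mul_le_mul_of_nonneg_right ?_ (by positivity)
  have := card_biUnion_le_card_mul M E t fun A _ => hE A
  rw [mul_comm] at this
  exact_mod_cast this

end Chains

section CopiesThrough

variable {s : ℕ} {V K β : Type*} [Fintype V] [DecidableEq V] [Fintype K] [DecidableEq K]
  [Fintype β] [DecidableEq β]

lemma card_copies_through_le {F : Finset (Finset (Fin s))} {k : ℕ} (hs : 2 ≤ s) (hk : 2 ≤ k)
    (ht : 0 < F.card) (hF : ∀ e ∈ F, e.card = k) (hbal : StrictlyOneBalanced F)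
    {EM : Finset (K × Finset V)} {J : V → β}
    (hJ : ∀ b, (univ.filter fun v => J v = b).card ≤ s)
    (hEMk : ∀ z ∈ EM, z.2.card = k)
    (hEMJ : ∀ z ∈ EM, ∀ v ∈ z.2, ∀ w ∈ z.2, J v = J w)
    (hEMc : ∀ i j e, (i, e) ∈ EM → (j, e) ∈ EM → i = j)
    {Y : Finset (K × Finset V)} (hYk : ∀ z ∈ Y, z.2.card = k) {y : ℕ} (hy : Y.card + 1 ≤ y)
    {x : K × Finset V} (hx : x ∈ EM) :
    (univ.filter (fun A : (Fin s ↪ V) × ({e // e ∈ F} → K) =>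
      x ∈ coloredEdges F A ∧ coloredEdges F A ⊆ Y ∪ EM)).card ≤
      (s * (s * (k * y))) ^ s * y ^ F.card := by
  classical
  have hinsk : ∀ z ∈ insert x Y, z.2.card ≤ k := by
    intro z hz
    rcases mem_insert.1 hz with rfl | h
    · exact (hEMk _ hx).le
    · exact (hYk z h).le
  have hθc := fun b =>
    card_fiber_mergeBlocks_le (b := b) (show 1 ≤ k by omega) hJ hinsk
      ((card_insert_le _ _).trans hy) (by omega)
  have h := card_copies_with_oldEdges_le (by omega) hF hEMJ hEMc hy (x := x)
    (univ : Finset {e // e ∈ F})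
  simp only [oldEdges_eq_univ_iff] at h
  refine h.trans ?_
  rw [card_univ, Fintype.card_coe, Nat.sub_self, pow_zero, mul_one]
  refine Nat.mul_le_mul_right _ ?_
  have h1 := card_embeddings_le (s := s) _ _ hθc 1
  rw [Nat.sub_self, pow_zero, mul_one] at h1
  refine (card_le_card ?_).trans h1
  intro φ hφ
  obtain ⟨-, hn, hc⟩ := mem_filter.1 hφ
  refine mem_filter.2 ⟨mem_univ _, hn, ?_⟩
  have hb := (card_mul_le_of_constant_on_edges hs hk hF hbal subset_rfl
    (mergeBlocks J (insert x Y) ∘ φ) (fun f hf => hc ⟨f, hf⟩ (mem_univ _))).1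
  have h0 := card_pos.2 ⟨_, hn⟩
  have e1 : F.card * s = F.card * (s - 1) + F.card * 1 := by
    rw [← Nat.mul_add]; congr 1; omega
  have e2 : F.card * (univ.image (mergeBlocks J (insert x Y) ∘ φ)).card ≤ F.card * 1 := by omega
  have := Nat.le_of_mul_le_mul_left e2 ht
  omega

end CopiesThrough

section ColoredFactors

variable {s : ℕ} {V K : Type*}

/-- A family of vertex-disjoint coloured copies of `F`, in which no colour is repeated. -/
structure IsRainbowPacking (F : Finset (Finset (Fin s)))
    (M : Finset ((Fin s ↪ V) × ({e // e ∈ F} → K))) : Prop where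
  disjoint : ∀ A ∈ M, ∀ B ∈ M, ∀ a b, A.1 a = B.1 b → A = B
  rainbow : ∀ A ∈ M, ∀ B ∈ M, ∀ f g, A.2 f = B.2 g → A = B ∧ f = g

lemma IsRainbowPacking.exists_blocks [Fintype V] {F : Finset (Finset (Fin s))}
    {M : Finset ((Fin s ↪ V) × ({e // e ∈ F} → K))} (hM : IsRainbowPacking F M)
    (hcard : Fintype.card V = s * M.card) :
    ∃ J : V → {A // A ∈ M}, (∀ (A : {A // A ∈ M}) a, J (A.1.1 a) = A) ∧
      ∀ A, ∃ c : V → Fin s, Set.InjOn c {v | J v = A} := by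
  classical
  set g : {A // A ∈ M} × Fin s → V := fun x => x.1.1.1 x.2 with hg
  have hinj : Function.Injective g := by
    rintro ⟨A, a⟩ ⟨B, b⟩ h
    obtain rfl : A = B := Subtype.ext (hM.disjoint _ A.2 _ B.2 _ _ h)
    exact Prod.ext rfl (A.1.1.injective h)
  have hbij : Function.Bijective g := by
    rw [Fintype.bijective_iff_injective_and_card]
    refine ⟨hinj, ?_⟩
    rw [Fintype.card_prod, Fintype.card_coe, Fintype.card_fin, hcard, mul_comm]
  set e := Equiv.ofBijective g hbij
  refine ⟨fun v => (e.symm v).1, fun A a => ?_, fun A => ⟨fun v => (e.symm v).2, ?_⟩⟩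
  · have : A.1.1 a = e (A, a) := rfl
    simp only [this, Equiv.symm_apply_apply]
  · intro v hv w hw h
    have h1 : (e.symm v).1 = A := hv
    have h2 : (e.symm w).1 = A := hw
    exact e.symm.injective (Prod.ext (h1.trans h2.symm) h)

open Classical in
lemma subsetExp_not_fewNewCopies_le {V K : Type} [Fintype V] [DecidableEq V] [Fintype K]
    [DecidableEq K] {F : Finset (Finset (Fin s))} {k b : ℕ} (hs : 2 ≤ s) (hk : 2 ≤ k)
    (ht : 0 < F.card) (hF : ∀ e ∈ F, e.card = k) (hbal : StrictlyOneBalanced F)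
    {M : Finset ((Fin s ↪ V) × ({e // e ∈ F} → K))} (hM : IsRainbowPacking F M)
    (hcard : Fintype.card V = s * M.card) {X₀ : Finset (K × Finset V)} {p ζ : ℝ} (hp : 0 ≤ p)
    (hp1 : p ≤ 1)
    (hζ : ∀ j r : ℕ, 1 ≤ j → j ≤ F.card → 1 ≤ r → F.card * r + 1 ≤ F.card + j * (s - 1) →
      (Fintype.card K * p) ^ j * (M.card : ℝ) ^ (r - 1) ≤ ζ) :
    subsetExp p X₀ (fun G => if FewNewCopies (coloredEdges F)
      (F.card * ((s * (s * (k * (F.card * b + 1)))) ^ s * (F.card * b + 1) ^ F.card)) M G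
        then 0 else 1) ≤
      F.card * M.card * (2 ^ F.card * ((F.card * b + 1 : ℕ) ^ F.card *
        (s * (s * (s * (k * (F.card * b + 1 : ℕ)))) ^ s)) * ζ) ^ b := by
  obtain ⟨J, hJM, hJc⟩ := hM.exists_blocks hcard
  have hζ0 : 0 ≤ ζ := le_trans (by positivity) (hζ 1 1 le_rfl ht le_rfl (by omega))
  have hcopy : ∀ A : (Fin s ↪ V) × ({e // e ∈ F} → K), ∀ z ∈ coloredEdges F A, z.2.card = k := by
    intro A z hz
    obtain ⟨f, -, rfl⟩ := mem_image.1 hz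
    rw [card_map, hF _ f.2]
  have hJ : ∀ A, (univ.filter fun v => J v = A).card ≤ s := by
    intro A
    obtain ⟨c, hc⟩ := hJc A
    refine (card_le_card_of_injOn (t := univ) c (fun _ _ => mem_univ _) ?_).trans (by simp)
    intro v hv w hw h
    exact hc (by simpa using hv) (by simpa using hw) h
  have hEMk : ∀ z ∈ M.biUnion (coloredEdges F), z.2.card = k := by
    intro z hz
    obtain ⟨A, -, hz⟩ := mem_biUnion.1 hz
    exact hcopy A z hz
  have hmem : ∀ A : {A // A ∈ M}, ∀ (f : {e // e ∈ F}), ∀ v ∈ f.1.map A.1.1, J v = A := by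
    intro A f v hv
    obtain ⟨a, -, rfl⟩ := mem_map.1 hv
    exact hJM A a
  have hEMJ : ∀ z ∈ M.biUnion (coloredEdges F), ∀ v ∈ z.2, ∀ w ∈ z.2, J v = J w := by
    intro z hz v hv w hw
    obtain ⟨A, hA, hz⟩ := mem_biUnion.1 hz
    obtain ⟨f, -, rfl⟩ := mem_image.1 hz
    rw [hmem ⟨A, hA⟩ f v hv, hmem ⟨A, hA⟩ f w hw]
  have hEMc : ∀ i j e, (i, e) ∈ M.biUnion (coloredEdges F) →
      (j, e) ∈ M.biUnion (coloredEdges F) → i = j := by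
    intro i j e hi hj
    obtain ⟨A, hA, hi⟩ := mem_biUnion.1 hi
    obtain ⟨B, hB, hj⟩ := mem_biUnion.1 hj
    obtain ⟨f, -, hf⟩ := mem_image.1 hi
    obtain ⟨g, -, hg⟩ := mem_image.1 hj
    obtain ⟨hfi, hfe⟩ := Prod.mk.inj hf
    obtain ⟨hgj, hge⟩ := Prod.mk.inj hg
    have : 0 < e.card := by rw [← hfe, card_map, hF _ f.2]; omega
    obtain ⟨v, hv⟩ := card_pos.1 this
    have h1 := hmem ⟨A, hA⟩ f v (by rw [hfe]; exact hv)
    have h2 := hmem ⟨B, hB⟩ g v (by rw [hge]; exact hv)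
    obtain rfl : A = B := congrArg Subtype.val (h1.symm.trans h2)
    have hfg : f = g := Subtype.ext (map_injective A.1 (hfe.trans hge.symm))
    rw [← hfi, ← hgj, hfg]
  refine subsetExp_fewNewCopies_le (b := b) (fun A => (card_coloredEdges F A).le)
    (fun Y => ∀ z ∈ Y, z.2.card = k) (by simp) ?_ ?_ hp hp1 (by positivity) ?_
  · intro Y A hY z hz
    rcases mem_union.1 hz with h | h
    · exact hY z h
    · exact hcopy A z h
  · intro x hx Y hY hYc
    exact card_copies_through_le hs hk ht hF hbal hJ hEMk hEMJ hEMc hY (by omega) hx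
  · intro x hx Y hY hYc
    exact sum_extensions_le hs hk ht hF hbal hJ hEMk hEMJ hEMc hp
      (by simpa using hζ) hY (by omega) hx

end ColoredFactors

section Asymptotics

lemma mul_pow_le_of_density {t s j r : ℕ} (ht : 0 < t) {n D L p : ℝ} (hn : 1 ≤ n)
    (hD : 1 ≤ D) (hL : 1 ≤ L) (hp : 0 ≤ p) (hdens : (n * p) ^ t * n ^ (s - 1) ≤ D * L)
    (hjt : j ≤ t) (hr : 1 ≤ r) (hjr : t * r + 1 ≤ t + j * (s - 1)) :
    (t * n * p) ^ j * n ^ (r - 1) ≤ t ^ t * (D * L) * n ^ (-(1 / t : ℝ)) := by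
  have hn0 : 0 < n := by linarith
  have ht1 : (1 : ℝ) ≤ t := by exact_mod_cast ht
  have hDL : 1 ≤ D * L := by nlinarith
  refine (pow_le_pow_iff_left₀ (by positivity) (by positivity) ht.ne').1 ?_
  have h1 : (n ^ (-(1 / t : ℝ))) ^ t = n⁻¹ := by
    rw [← Real.rpow_natCast, ← Real.rpow_mul hn0.le]
    have : (-(1 / t : ℝ)) * t = -1 := by field_simp
    rw [this, Real.rpow_neg_one]
  rw [mul_pow (t ^ t * (D * L)), h1, ← div_eq_mul_inv, le_div_iff₀ hn0]
  have h2 : ((n * p) ^ t * n ^ (s - 1)) ^ j ≤ (D * L) ^ t :=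
    (pow_le_pow_left₀ (by positivity) hdens j).trans (pow_le_pow_right₀ hDL hjt)
  have hexp : t * (r - 1) + 1 ≤ j * (s - 1) := by
    obtain ⟨r, rfl⟩ := Nat.exists_eq_add_of_le' hr
    rw [Nat.mul_succ] at hjr
    simp only [Nat.add_sub_cancel]
    omega
  calc ((t * n * p) ^ j * n ^ (r - 1)) ^ t * n
      = (t ^ j) ^ t * (((n * p) ^ t) ^ j * n ^ (t * (r - 1) + 1)) := by
        rw [pow_succ n, pow_mul' n]
        ring
    _ ≤ (t ^ t) ^ t * (((n * p) ^ t) ^ j * n ^ (j * (s - 1))) := by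
        gcongr
    _ = (t ^ t) ^ t * ((n * p) ^ t * n ^ (s - 1)) ^ j := by
        rw [mul_pow ((n * p) ^ t), ← pow_mul n, mul_comm j]
    _ ≤ (t ^ t) ^ t * (D * L) ^ t := by gcongr
    _ = _ := by rw [← mul_pow]

lemma exists_failure_bound {t : ℕ} (ht : 0 < t) {D Q ε : ℝ} (hε : 0 < ε) : ∃ n₀ : ℕ, ∀ n : ℕ,
    n₀ ≤ n → t * (n : ℝ) * (Q * (t ^ t * (D * Real.log n) * (n : ℝ) ^ (-(1 / t : ℝ)))) ^ (2 * t)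
      ≤ ε := by
  have hlim : Filter.Tendsto (fun n : ℕ => (t * (Q * (t ^ t * D)) ^ (2 * t)) *
      (Real.log n ^ (2 * t) / n)) Filter.atTop (nhds 0) := by
    have h1 : Filter.Tendsto (fun x : ℝ => Real.log x ^ (2 * t) / x) Filter.atTop (nhds 0) :=
      (Real.isLittleO_pow_log_id_atTop (n := 2 * t)).tendsto_div_nhds_zero
    have := (h1.comp tendsto_natCast_atTop_atTop).const_mul (t * (Q * (t ^ t * D)) ^ (2 * t))
    simpa using this
  obtain ⟨n₀, hn₀⟩ := Filter.eventually_atTop.1 (hlim.eventually (gt_mem_nhds hε))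
  refine ⟨n₀ + 1, fun n hn => ?_⟩
  have hn0 : (0 : ℝ) < n := by exact_mod_cast (show 0 < n by omega)
  refine le_trans (le_of_eq ?_) (hn₀ n (by omega)).le
  have h1 : ((n : ℝ) ^ (-(1 / t : ℝ))) ^ (2 * t) = (n : ℝ)⁻¹ ^ 2 := by
    rw [mul_comm 2 t, pow_mul, ← Real.rpow_natCast _ t, ← Real.rpow_mul hn0.le]
    have ht1 : (0 : ℝ) < t := by exact_mod_cast ht
    have : (-(1 / t : ℝ)) * t = -1 := by field_simp
    rw [this, Real.rpow_neg_one]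
  rw [show Q * (t ^ t * (D * Real.log n) * (n : ℝ) ^ (-(1 / t : ℝ))) =
    (Q * (t ^ t * D)) * Real.log n * (n : ℝ) ^ (-(1 / t : ℝ)) by ring, mul_pow, h1, mul_pow]
  field_simp

end Asymptotics

section SliceConcentration

variable {α : Type*} [DecidableEq α]

lemma sum_powersetCard_sum_insert (U : Finset α) (r : ℕ) (f : Finset α → ℝ) :
    ∑ A ∈ powersetCard r U, ∑ w ∈ U \ A, f (insert w A) =
      (r + 1 : ℕ) * ∑ B ∈ powersetCard (r + 1) U, f B := by
  have h : ∑ B ∈ powersetCard (r + 1) U, ∑ _w ∈ B, f B =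
      (r + 1 : ℕ) * ∑ B ∈ powersetCard (r + 1) U, f B := by
    rw [mul_sum]
    refine sum_congr rfl fun B hB => ?_
    rw [sum_const, (mem_powersetCard.1 hB).2, nsmul_eq_mul]
  rw [← h, sum_sigma', sum_sigma']
  refine sum_nbij' (fun x => ⟨insert x.2 x.1, x.2⟩) (fun x => ⟨x.1.erase x.2, x.2⟩) ?_ ?_ ?_ ?_ ?_
  · rintro ⟨A, w⟩ hx
    obtain ⟨hA, hw⟩ := mem_sigma.1 hx
    obtain ⟨hAU, hAc⟩ := mem_powersetCard.1 hA
    obtain ⟨hwU, hwA⟩ := mem_sdiff.1 hw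
    refine mem_sigma.2 ⟨mem_powersetCard.2 ⟨insert_subset hwU hAU, ?_⟩, mem_insert_self _ _⟩
    simp only [card_insert_of_notMem hwA, hAc]
  · rintro ⟨B, w⟩ hx
    obtain ⟨hB, hw⟩ := mem_sigma.1 hx
    obtain ⟨hBU, hBc⟩ := mem_powersetCard.1 hB
    simp only at hw hBU hBc
    refine mem_sigma.2 ⟨mem_powersetCard.2 ⟨(erase_subset _ _).trans hBU, ?_⟩,
      mem_sdiff.2 ⟨hBU hw, notMem_erase _ _⟩⟩
    simp only [card_erase_of_mem hw, hBc, Nat.add_sub_cancel]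
  · rintro ⟨A, w⟩ hx
    obtain ⟨hwU, hwA⟩ := mem_sdiff.1 (mem_sigma.1 hx).2
    simp only [erase_insert hwA]
  · rintro ⟨B, w⟩ hx
    have hw := (mem_sigma.1 hx).2
    simp only at hw
    simp only [insert_erase hw]
  · intro x _
    rfl

lemma two_point_exp_le {a b y z c : ℝ} (ha : 0 ≤ a) (hb : 0 ≤ b) (h0 : a * y + b * z = 0)
    (hy : |y| ≤ c) (hz : |z| ≤ c) (hc : c ≤ 1) :
    a * Real.exp y + b * Real.exp z ≤ (a + b) * Real.exp (c ^ 2) := by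
  have key : ∀ w : ℝ, |w| ≤ c → Real.exp w ≤ w + Real.exp (c ^ 2) := by
    intro w hw
    have h1 := abs_le.1 (Real.abs_exp_sub_one_sub_id_le (hw.trans hc))
    have h2 := Real.add_one_le_exp (c ^ 2)
    have h3 : w ^ 2 ≤ c ^ 2 := sq_le_sq' (by linarith [(abs_le.1 hw).1]) (abs_le.1 hw).2
    linarith [h1.2]
  nlinarith [mul_le_mul_of_nonneg_left (key y hy) ha, mul_le_mul_of_nonneg_left (key z hz) hb]

/-- Exponential moments of a function on a slice which changes by at most `c` under swaps. -/
lemma sum_exp_neg_powersetCard_le {c : ℝ} (hc0 : 0 ≤ c) (hc : c ≤ 1) (U : Finset α) :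
    ∀ (r : ℕ) (f : Finset α → ℝ),
    (∀ A ⊆ U, ∀ u ∈ U, ∀ w ∈ U, u ∉ A → w ∉ A → |f (insert u A) - f (insert w A)| ≤ c) →
    ∀ μ : ℝ, (U.card.choose r : ℝ) * μ = ∑ A ∈ powersetCard r U, f A →
      ∑ A ∈ powersetCard r U, Real.exp (-f A) ≤
        (U.card.choose r : ℝ) * Real.exp (-μ + c ^ 2 * U.card) := by
  induction U using Finset.induction_on with
  | empty =>
    intro r f _ μ hμ
    cases r with
    | zero => simp_all
    | succ r =>
      rw [powersetCard_eq_empty.2 (by simp), sum_empty]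
      positivity
  | insert x U hx ih =>
    intro r f hf μ hμ
    cases r with
    | zero =>
      simp only [powersetCard_zero, sum_singleton, Nat.choose_zero_right, Nat.cast_one,
        one_mul] at hμ ⊢
      rw [hμ]
      gcongr
      have : 0 ≤ c ^ 2 * ((insert x U).card : ℝ) := by positivity
      linarith
    | succ r =>
      have hdisj : Disjoint (powersetCard (r + 1) U) ((powersetCard r U).image (insert x)) := by
        rw [disjoint_left]
        intro B hB hB'
        obtain ⟨A, -, rfl⟩ := mem_image.1 hB'
        exact hx ((mem_powersetCard.1 hB).1 (mem_insert_self _ _))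
      have hinj : Set.InjOn (insert x) (powersetCard r U : Set (Finset α)) := by
        intro A hA B hB h
        have hA' : x ∉ A := fun h => hx ((mem_powersetCard.1 (mem_coe.1 hA)).1 h)
        have hB' : x ∉ B := fun h => hx ((mem_powersetCard.1 (mem_coe.1 hB)).1 h)
        rw [← erase_insert hA', ← erase_insert hB', h]
      have hsplit : ∀ g : Finset α → ℝ, ∑ A ∈ powersetCard (r + 1) (insert x U), g A =
          ∑ A ∈ powersetCard (r + 1) U, g A + ∑ A ∈ powersetCard r U, g (insert x A) := by
        intro g
        rw [powersetCard_succ_insert hx, sum_union hdisj, sum_image hinj]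
      rw [hsplit] at hμ ⊢
      rw [card_insert_of_notMem hx, Nat.choose_succ_succ'] at hμ ⊢
      push_cast at hμ ⊢
      set S0 := ∑ A ∈ powersetCard (r + 1) U, f A with hS0
      set S1 := ∑ A ∈ powersetCard r U, f (insert x A) with hS1
      set C0 : ℝ := (U.card.choose (r + 1) : ℝ) with hC0
      set C1 : ℝ := (U.card.choose r : ℝ) with hC1
      have hf0 : ∀ A ⊆ U, ∀ u ∈ U, ∀ w ∈ U, u ∉ A → w ∉ A →
          |f (insert u A) - f (insert w A)| ≤ c := fun A hA u hu w hw =>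
        hf A (hA.trans (subset_insert _ _)) u (mem_insert_of_mem hu) w (mem_insert_of_mem hw)
      have hf1 : ∀ A ⊆ U, ∀ u ∈ U, ∀ w ∈ U, u ∉ A → w ∉ A →
          |f (insert x (insert u A)) - f (insert x (insert w A))| ≤ c := by
        intro A hA u hu w hw huA hwA
        rw [insert_comm x u, insert_comm x w]
        refine hf (insert x A) (insert_subset_insert _ hA) u (mem_insert_of_mem hu) w
          (mem_insert_of_mem hw) ?_ ?_
        · rw [mem_insert, not_or]
          exact ⟨fun h => hx (h ▸ hu), huA⟩
        · rw [mem_insert, not_or]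
          exact ⟨fun h => hx (h ▸ hw), hwA⟩
      have hn : (0 : ℝ) ≤ U.card := Nat.cast_nonneg _
      have hexp : ∀ ν : ℝ, Real.exp (-ν + c ^ 2 * U.card) ≤ Real.exp (-ν + c ^ 2 * (U.card + 1)) := by
        intro ν
        gcongr
        linarith
      rcases lt_trichotomy U.card r with hlt | heq | hgt
      · have e0 : powersetCard (r + 1) U = ∅ := powersetCard_eq_empty.2 (by omega)
        have e1 : powersetCard r U = ∅ := powersetCard_eq_empty.2 hlt
        rw [e0, e1, sum_empty, sum_empty, add_zero]
        positivity
      · have e0 : powersetCard (r + 1) U = ∅ := powersetCard_eq_empty.2 (by omega)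
        have h0 : C0 = 0 := by rw [hC0, Nat.choose_eq_zero_of_lt (by omega), Nat.cast_zero]
        have h1 : C1 = 1 := by rw [hC1, heq, Nat.choose_self, Nat.cast_one]
        have hs0 : S0 = 0 := by rw [hS0, e0, sum_empty]
        rw [h0, hs0, h1] at hμ
        have := ih r (fun A => f (insert x A)) hf1 μ (by
          rw [← hC1, h1]; linarith)
        rw [e0, sum_empty, zero_add, h0, add_zero]
        exact this.trans (mul_le_mul_of_nonneg_left (hexp μ) (by positivity))
      · have h0 : 0 < C0 := by rw [hC0]; exact_mod_cast Nat.choose_pos (by omega)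
        have h1 : 0 < C1 := by rw [hC1]; exact_mod_cast Nat.choose_pos (by omega)
        have ih0 := ih (r + 1) f hf0 (S0 / C0) (by rw [← hC0, ← hS0]; field_simp)
        have ih1 := ih r (fun A => f (insert x A)) hf1 (S1 / C1) (by rw [← hC1, ← hS1]; field_simp)
        have hΔ : |S1 / C1 - S0 / C0| ≤ c := by
          have hcount : C1 * ((U.card : ℝ) - r) = C0 * (r + 1) := by
            have := Nat.choose_succ_right_eq U.card r
            have h2 : ((U.card.choose (r + 1) * (r + 1) : ℕ) : ℝ) =
              ((U.card.choose r * (U.card - r) : ℕ) : ℝ) := by rw [this]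
            push_cast [Nat.cast_sub hgt.le] at h2
            rw [hC1, hC0]; linarith
          have hd := sum_powersetCard_sum_insert U r f
          have hd1 : ∑ A ∈ powersetCard r U, ∑ w ∈ U \ A, f (insert x A) =
              ((U.card : ℝ) - r) * S1 := by
            rw [hS1, mul_sum]
            refine sum_congr rfl fun A hA => ?_
            obtain ⟨hAU, hAc⟩ := mem_powersetCard.1 hA
            rw [sum_const, card_sdiff_of_subset hAU, hAc, nsmul_eq_mul, Nat.cast_sub hgt.le]
          have hdiff : |((U.card : ℝ) - r) * S1 - (r + 1 : ℕ) * S0| ≤ C1 * ((U.card : ℝ) - r) * c := by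
            rw [← hd1, hS0, ← hd, ← sum_sub_distrib]
            refine (abs_sum_le_sum_abs _ _).trans ?_
            have : C1 * ((U.card : ℝ) - r) * c =
                ∑ A ∈ powersetCard r U, ((U.card : ℝ) - r) * c := by
              rw [sum_const, card_powersetCard, nsmul_eq_mul, hC1]; ring
            rw [this]
            refine sum_le_sum fun A hA => ?_
            obtain ⟨hAU, hAc⟩ := mem_powersetCard.1 hA
            rw [← sum_sub_distrib]
            refine (abs_sum_le_sum_abs _ _).trans ?_
            have h3 : ((U.card : ℝ) - r) * c = ∑ w ∈ U \ A, c := by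
              rw [sum_const, card_sdiff_of_subset hAU, hAc, nsmul_eq_mul, Nat.cast_sub hgt.le]
            rw [h3]
            exact sum_le_sum fun w hw => hf A (hAU.trans (subset_insert _ _)) x (mem_insert_self _ _) w
              (mem_insert_of_mem (mem_sdiff.1 hw).1) (fun h => hx (hAU h)) (mem_sdiff.1 hw).2
          have hP : 0 < C1 * ((U.card : ℝ) - r) := by
            have : (r : ℝ) < U.card := by exact_mod_cast hgt
            exact mul_pos h1 (by linarith)
          have : C1 * ((U.card : ℝ) - r) * (S1 / C1 - S0 / C0) =
              ((U.card : ℝ) - r) * S1 - (r + 1 : ℕ) * S0 := by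
            have e1 : C1 * ((U.card : ℝ) - r) * (S1 / C1) = ((U.card : ℝ) - r) * S1 := by
              field_simp
            have e2 : C1 * ((U.card : ℝ) - r) * (S0 / C0) = (r + 1 : ℕ) * S0 := by
              rw [hcount]; push_cast; field_simp
            rw [mul_sub, e1, e2]
          rw [← this, abs_mul, abs_of_pos hP] at hdiff
          exact le_of_mul_le_mul_left hdiff hP
        have hμ' : C0 * (μ - S0 / C0) + C1 * (μ - S1 / C1) = 0 := by
          have e1 : C1 * (S1 / C1) = S1 := by field_simp
          have e2 : C0 * (S0 / C0) = S0 := by field_simp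
          rw [mul_sub, mul_sub, e1, e2]; linarith
        have hmid : |μ - S0 / C0| ≤ c ∧ |μ - S1 / C1| ≤ c := by
          have hpos : 0 < C0 + C1 := by linarith
          obtain ⟨hΔ1, hΔ2⟩ := abs_le.1 hΔ
          set a := S1 / C1
          set b := S0 / C0
          have e1 : (C0 + C1) * (μ - b) = C1 * (a - b) := by linarith
          have e2 : (C0 + C1) * (μ - a) = - (C0 * (a - b)) := by linarith
          constructor <;> rw [abs_le] <;> constructor
          · nlinarith
          · nlinarith
          · nlinarith
          · nlinarith
        have htp := two_point_exp_le h0.le h1.le hμ' hmid.1 hmid.2 hc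
        have x0 : Real.exp (-(S0 / C0) + c ^ 2 * U.card) =
            Real.exp (-μ + c ^ 2 * U.card) * Real.exp (μ - S0 / C0) := by
          rw [← Real.exp_add]; congr 1; ring
        have x1 : Real.exp (-(S1 / C1) + c ^ 2 * U.card) =
            Real.exp (-μ + c ^ 2 * U.card) * Real.exp (μ - S1 / C1) := by
          rw [← Real.exp_add]; congr 1; ring
        have x2 : Real.exp (-μ + c ^ 2 * (U.card + 1)) =
            Real.exp (-μ + c ^ 2 * U.card) * Real.exp (c ^ 2) := by
          rw [← Real.exp_add]; congr 1; ring
        rw [x0] at ih0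
        rw [x1] at ih1
        rw [x2]
        have := mul_le_mul_of_nonneg_left htp (Real.exp_pos (-μ + c ^ 2 * U.card)).le
        linarith

/-- Lower tail for a function on a slice which changes by at most `c` under swaps. -/
lemma card_filter_le_sub_le {c x : ℝ} (hc : 0 < c) (hx : 0 ≤ x) (U : Finset α)
    (hxc : x ≤ 2 * c * U.card) (r : ℕ) (f : Finset α → ℝ)
    (hf : ∀ A ⊆ U, ∀ u ∈ U, ∀ w ∈ U, u ∉ A → w ∉ A → |f (insert u A) - f (insert w A)| ≤ c)
    (μ : ℝ) (hμ : (U.card.choose r : ℝ) * μ = ∑ A ∈ powersetCard r U, f A) :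
    (((powersetCard r U).filter fun A => f A < μ - x).card : ℝ) ≤
      U.card.choose r * Real.exp (-(x ^ 2 / (4 * c ^ 2 * U.card))) := by
  classical
  rcases Nat.eq_zero_or_pos U.card with h0 | hpos
  · rw [h0]
    have : ((powersetCard r U).filter fun A => f A < μ - x).card ≤ (0 : ℕ).choose r := by
      rw [← h0, ← card_powersetCard]
      exact card_filter_le _ _
    simp only [Nat.cast_zero, mul_zero, div_zero, neg_zero, Real.exp_zero, mul_one]
    exact_mod_cast this
  have hN : (0 : ℝ) < U.card := by exact_mod_cast hpos
  set l := x / (2 * c ^ 2 * U.card) with hl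
  have hl0 : 0 ≤ l := by positivity
  have hlc : l * c ≤ 1 := by
    rw [hl, div_mul_eq_mul_div, div_le_one (by positivity)]
    nlinarith
  have key := sum_exp_neg_powersetCard_le (c := l * c) (by positivity) hlc U r
    (fun A => l * f A) (by
      intro A hA u hu w hw huA hwA
      rw [← mul_sub, abs_mul, abs_of_nonneg hl0]
      exact mul_le_mul_of_nonneg_left (hf A hA u hu w hw huA hwA) hl0) (l * μ) (by
      rw [← mul_sum, ← hμ]; ring)
  have h1 : (((powersetCard r U).filter fun A => f A < μ - x).card : ℝ) *
      Real.exp (-(l * (μ - x))) ≤ ∑ A ∈ powersetCard r U, Real.exp (-(l * f A)) := by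
    rw [← nsmul_eq_mul, ← sum_const]
    refine (sum_le_sum fun A hA => ?_).trans
      (sum_le_sum_of_subset_of_nonneg (filter_subset _ _) fun _ _ _ => (Real.exp_pos _).le)
    rw [Real.exp_le_exp, neg_le_neg_iff]
    exact mul_le_mul_of_nonneg_left (mem_filter.1 hA).2.le hl0
  have h2 : Real.exp (-(l * μ) + (l * c) ^ 2 * U.card) =
      Real.exp (-(x ^ 2 / (4 * c ^ 2 * U.card))) * Real.exp (-(l * (μ - x))) := by
    rw [← Real.exp_add]
    congr 1
    rw [hl]
    field_simp
    ring
  rw [h2, ← mul_assoc] at key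
  exact le_of_mul_le_mul_right (h1.trans key) (Real.exp_pos _)

end SliceConcentration

section DegreeInheritance

variable {V : Type*} [DecidableEq V]

/-- The relative minimum `d`-degree of `H` inside `U` is at least `δ`. -/
def HostDeg (H : Finset (Finset V)) (d c : ℕ) (δ : ℝ) (U : Finset V) : Prop :=
  ∀ D ⊆ U, D.card = d →
    δ * ((U.card - d).choose c : ℝ) ≤ ((H.filter fun e => D ⊆ e ∧ e ⊆ U).card : ℝ)

lemma choose_sub_sub_le (d : ℕ) : ∀ {N r : ℕ}, d ≤ r → r ≤ N →
    (N - d).choose (r - d) ≤ N.choose r := by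
  induction d with
  | zero => intro N r _ _; simp
  | succ d ih =>
    intro N r h1 h2
    have : (N - d).choose (r - d) = (N - (d + 1)).choose (r - (d + 1)) +
        (N - (d + 1)).choose (r - (d + 1) + 1) := by
      rw [← Nat.choose_succ_succ']
      congr 1 <;> omega
    have := ih (N := N) (r := r) (by omega) h2
    omega

lemma card_filter_mem_powersetCard_le (W : Finset V) (u : V) (c : ℕ) :
    ((powersetCard c W).filter fun L => u ∈ L).card ≤ W.card ^ (c - 1) := by
  refine le_trans ?_ (Nat.choose_le_pow W.card (c - 1))
  rw [← card_powersetCard]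
  refine card_le_card_of_injOn (fun L => L.erase u) ?_ ?_
  · intro L hL
    obtain ⟨hL, hu⟩ := mem_filter.1 hL
    obtain ⟨hLW, hLc⟩ := mem_powersetCard.1 hL
    exact mem_coe.2 (mem_powersetCard.2 ⟨(erase_subset _ _).trans hLW, by
      rw [card_erase_of_mem hu, hLc]⟩)
  · intro L hL L' hL' h
    rw [← insert_erase (mem_filter.1 hL).2, ← insert_erase (mem_filter.1 hL').2]
    exact congrArg _ h

lemma card_filter_superset_powersetCard (W L : Finset V) {r : ℕ} (hL : L ⊆ W) (hr : L.card ≤ r) :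
    ((powersetCard r W).filter fun A => L ⊆ A).card = (W.card - L.card).choose (r - L.card) := by
  rw [← card_sdiff_of_subset hL, ← card_powersetCard]
  refine card_nbij' (fun A => A \ L) (fun A => A ∪ L) ?_ ?_ ?_ ?_
  · intro A hA
    obtain ⟨hA, hLA⟩ := mem_filter.1 hA
    obtain ⟨hAW, hAc⟩ := mem_powersetCard.1 hA
    exact mem_coe.2 (mem_powersetCard.2 ⟨sdiff_subset_sdiff hAW le_rfl, by
      rw [card_sdiff_of_subset hLA, hAc]⟩)
  · intro A hA
    obtain ⟨hAW, hAc⟩ := mem_powersetCard.1 hA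
    have hd : Disjoint A L := disjoint_of_subset_left hAW sdiff_disjoint
    refine mem_coe.2 (mem_filter.2 ⟨mem_powersetCard.2
      ⟨union_subset (hAW.trans sdiff_subset) hL, ?_⟩, subset_union_right⟩)
    rw [card_union_of_disjoint hd, hAc]
    omega
  · intro A hA
    exact sdiff_union_of_subset (mem_filter.1 hA).2
  · intro A hA
    have hd : Disjoint A L :=
      disjoint_of_subset_left (mem_powersetCard.1 hA).1 sdiff_disjoint
    exact union_sdiff_cancel_right hd

/-- Few subsets of given size fail to inherit the degree of a fixed `d`-set. -/
lemma card_filter_link_le {H : Finset (Finset V)} {d c N₁ : ℕ} {δ e : ℝ} {U D : Finset V}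
    (hH : ∀ E ∈ H, E.card = d + c) (hc : 1 ≤ c) (he : 0 ≤ e) (he2 : e ≤ 2)
    (hU : HostDeg H d c δ U) (hD : D ⊆ U) (hDd : D.card = d) (h1 : d + c ≤ N₁) (h2 : N₁ ≤ U.card) :
    (((powersetCard N₁ U).filter fun A => D ⊆ A ∧
      ((H.filter fun E => D ⊆ E ∧ E ⊆ A).card : ℝ) < (δ - e) * ((N₁ - d).choose c : ℝ)).card : ℝ) ≤
    U.card.choose N₁ *
      Real.exp (-((e * ((N₁ - d).choose c : ℝ)) ^ 2 /
        (4 * ((U.card : ℝ) ^ (c - 1)) ^ 2 * U.card))) := by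
  set W := U \ D with hW
  have hWc : W.card = U.card - d := by rw [hW, card_sdiff_of_subset hD, hDd]
  set 𝓛 := (powersetCard c W).filter fun L => D ∪ L ∈ H with h𝓛
  set r := N₁ - d with hr
  have hrW : r ≤ W.card := by omega
  have hcr : c ≤ r := by omega
  have hdisj : ∀ {A : Finset V}, A ⊆ W → Disjoint D A := fun hA =>
    disjoint_of_subset_right hA disjoint_sdiff
  have hcount : ∀ A ⊆ W, (H.filter fun E => D ⊆ E ∧ E ⊆ D ∪ A).card =
      (𝓛.filter fun L => L ⊆ A).card := by
    intro A hA
    refine card_nbij' (fun E => E \ D) (fun L => D ∪ L) ?_ ?_ ?_ ?_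
    · intro E hE
      obtain ⟨hEH, hDE, hEA⟩ := mem_filter.1 hE
      have hs : E \ D ⊆ A := by
        intro v hv
        obtain ⟨hv, hvD⟩ := mem_sdiff.1 hv
        exact (mem_union.1 (hEA hv)).resolve_left hvD
      refine mem_coe.2 (mem_filter.2 ⟨mem_filter.2 ⟨mem_powersetCard.2 ⟨hs.trans hA, ?_⟩, ?_⟩, hs⟩)
      · rw [card_sdiff_of_subset hDE, hH E hEH, hDd, Nat.add_sub_cancel_left]
      · rwa [union_sdiff_of_subset hDE]
    · intro L hL
      obtain ⟨hL, hLA⟩ := mem_filter.1 hL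
      exact mem_coe.2 (mem_filter.2 ⟨(mem_filter.1 hL).2, subset_union_left,
        union_subset_union_right hLA⟩)
    · intro E hE
      exact union_sdiff_of_subset (mem_filter.1 hE).2.1
    · intro L hL
      exact union_sdiff_cancel_left (hdisj ((mem_filter.1 hL).2.trans hA))
  have hdeg : δ * (W.card.choose c : ℝ) ≤ 𝓛.card := by
    have := hU D hD hDd
    rw [← hWc] at this
    have h3 := hcount W le_rfl
    rw [hW, union_sdiff_of_subset hD, ← hW] at h3
    rw [h3, filter_true_of_mem (fun L hL =>
      (mem_powersetCard.1 (mem_filter.1 hL).1).1)] at this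
    exact this
  have hUpos : 0 < U.card := by omega
  have hUR : (0 : ℝ) < U.card := by exact_mod_cast hUpos
  have hU1 : (1 : ℝ) ≤ U.card := by exact_mod_cast hUpos
  have hWpos : 0 < W.card := by omega
  have hWR : (0 : ℝ) < W.card := by exact_mod_cast hWpos
  have hWU : (W.card : ℝ) ≤ U.card := by exact_mod_cast (by omega : W.card ≤ U.card)
  set c₀ : ℝ := (U.card : ℝ) ^ (c - 1) with hc₀
  have hc₀pos : 0 < c₀ := by positivity
  set f : Finset V → ℝ := fun A => ((𝓛.filter fun L => L ⊆ A).card : ℝ) with hf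
  have hup : ∀ A u, f A ≤ f (insert u A) ∧ f (insert u A) ≤ f A + c₀ := by
    intro A u
    constructor
    · simp only [hf]
      exact_mod_cast card_le_card (fun L hL => mem_filter.2 ⟨(mem_filter.1 hL).1,
        (mem_filter.1 hL).2.trans (subset_insert _ _)⟩ :
        (𝓛.filter fun L => L ⊆ A) ⊆ 𝓛.filter fun L => L ⊆ insert u A)
    · have h3 : (𝓛.filter fun L => L ⊆ insert u A).card ≤
          (𝓛.filter fun L => L ⊆ A).card + W.card ^ (c - 1) := by
        refine le_trans ?_ (Nat.add_le_add_left (card_filter_mem_powersetCard_le W u c) _)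
        refine le_trans (card_le_card ?_) (card_union_le _ _)
        intro L hL
        obtain ⟨hL, hLA⟩ := mem_filter.1 hL
        by_cases hu : u ∈ L
        · exact mem_union_right _ (mem_filter.2 ⟨(mem_filter.1 hL).1, hu⟩)
        · exact mem_union_left _ (mem_filter.2 ⟨hL, (subset_insert_iff_of_notMem hu).1 hLA⟩)
      have h4 : ((W.card ^ (c - 1) : ℕ) : ℝ) ≤ c₀ := by
        push_cast
        exact pow_le_pow_left₀ hWR.le hWU _
      have h5 : f (insert u A) ≤ f A + ((W.card ^ (c - 1) : ℕ) : ℝ) := by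
        simp only [hf]; exact_mod_cast h3
      linarith
  have hC : (0 : ℝ) < W.card.choose r := by exact_mod_cast Nat.choose_pos hrW
  have hCc : (0 : ℝ) < W.card.choose c := by exact_mod_cast Nat.choose_pos (hcr.trans hrW)
  set μ : ℝ := (𝓛.card : ℝ) * r.choose c / W.card.choose c with hμ
  have hsum : (W.card.choose r : ℝ) * μ = ∑ A ∈ powersetCard r W, f A := by
    have h3 : ∑ A ∈ powersetCard r W, (𝓛.filter fun L => L ⊆ A).card =
        𝓛.card * (W.card - c).choose (r - c) := by
      simp_rw [card_filter]
      rw [sum_comm, ← smul_eq_mul, ← sum_const]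
      refine sum_congr rfl fun L hL => ?_
      obtain ⟨hLW, hLc⟩ := mem_powersetCard.1 (mem_filter.1 hL).1
      rw [← card_filter, card_filter_superset_powersetCard W L hLW (by omega), hLc]
    have h4 := Nat.choose_mul (n := W.card) (k := r) (s := c) hcr
    have h5 : (W.card.choose r : ℝ) * r.choose c = W.card.choose c * (W.card - c).choose (r - c) := by
      exact_mod_cast h4
    have h6 : ∑ A ∈ powersetCard r W, f A = 𝓛.card * ((W.card - c).choose (r - c) : ℝ) := by
      simp only [hf]; exact_mod_cast h3
    rw [h6, hμ, mul_div_assoc', div_eq_iff hCc.ne']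
    linear_combination (𝓛.card : ℝ) * h5
  have hμge : δ * (r.choose c : ℝ) ≤ μ := by
    rw [hμ, le_div_iff₀ hCc]
    have := mul_le_mul_of_nonneg_right hdeg (Nat.cast_nonneg (α := ℝ) (r.choose c))
    linarith
  set x : ℝ := e * (r.choose c : ℝ) with hx
  have hxle : x ≤ 2 * c₀ * W.card := by
    have h3 : (r.choose c : ℝ) ≤ (W.card : ℝ) ^ c := by
      exact_mod_cast (Nat.choose_le_pow r c).trans (Nat.pow_le_pow_left hrW c)
    have h4 : (W.card : ℝ) ^ c ≤ c₀ * W.card := by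
      rw [← Nat.sub_add_cancel hc, pow_succ]
      exact mul_le_mul_of_nonneg_right (pow_le_pow_left₀ hWR.le hWU _) hWR.le
    rw [hx, mul_assoc]
    exact mul_le_mul he2 (h3.trans h4) (Nat.cast_nonneg _) (by norm_num)
  have key := card_filter_le_sub_le hc₀pos (by positivity) W hxle r f (by
    intro A _ u _ w _ _ _
    obtain ⟨a1, a2⟩ := hup A u
    obtain ⟨b1, b2⟩ := hup A w
    rw [abs_le]
    constructor <;> linarith) μ hsum
  have hinj : ((powersetCard N₁ U).filter fun A => D ⊆ A ∧
      ((H.filter fun E => D ⊆ E ∧ E ⊆ A).card : ℝ) < (δ - e) * (r.choose c : ℝ)).card ≤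
      ((powersetCard r W).filter fun A => f A < μ - x).card := by
    refine card_le_card_of_injOn (fun A => A \ D) ?_ ?_
    · intro A hA
      obtain ⟨hA, hDA, hlt⟩ := mem_filter.1 hA
      obtain ⟨hAU, hAc⟩ := mem_powersetCard.1 hA
      have hAW : A \ D ⊆ W := sdiff_subset_sdiff hAU le_rfl
      refine mem_coe.2 (mem_filter.2 ⟨mem_powersetCard.2 ⟨hAW, ?_⟩, ?_⟩)
      · rw [card_sdiff_of_subset hDA, hAc, hDd]
      · have h3 := hcount _ hAW
        rw [union_sdiff_of_subset hDA] at h3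
        rw [h3] at hlt
        have : (δ - e) * (r.choose c : ℝ) ≤ μ - x := by rw [sub_mul, hx]; linarith
        exact lt_of_lt_of_le hlt this
    · intro A hA B hB h
      rw [← union_sdiff_of_subset (mem_filter.1 hA).2.1,
        ← union_sdiff_of_subset (mem_filter.1 hB).2.1]
      exact congrArg _ h
  refine le_trans (by exact_mod_cast hinj) (key.trans ?_)
  refine mul_le_mul ?_ ?_ (Real.exp_pos _).le (Nat.cast_nonneg _)
  · rw [hWc]
    exact_mod_cast choose_sub_sub_le d (by omega) h2
  · rw [Real.exp_le_exp, neg_le_neg_iff]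
    refine div_le_div_of_nonneg_left (by positivity) (by positivity) ?_
    exact mul_le_mul_of_nonneg_left hWU (by positivity)

open Classical in
/-- Most subsets of given size inherit the minimum degree condition. -/
lemma card_filter_not_hostDeg_le {H : Finset (Finset V)} {d c N₁ : ℕ} {δ e : ℝ} {U : Finset V}
    (hH : ∀ E ∈ H, E.card = d + c) (hc : 1 ≤ c) (he : 0 ≤ e) (he2 : e ≤ 2)
    (hU : HostDeg H d c δ U) (h1 : d + c ≤ N₁) (h2 : N₁ ≤ U.card) :
    (((powersetCard N₁ U).filter fun A => ¬ HostDeg H d c (δ - e) A).card : ℝ) ≤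
    (U.card : ℝ) ^ d * (U.card.choose N₁ *
      Real.exp (-((e * ((N₁ - d).choose c : ℝ)) ^ 2 /
        (4 * ((U.card : ℝ) ^ (c - 1)) ^ 2 * U.card)))) := by
  have hsub : ((powersetCard N₁ U).filter fun A => ¬ HostDeg H d c (δ - e) A) ⊆
      (powersetCard d U).biUnion fun D => (powersetCard N₁ U).filter fun A => D ⊆ A ∧
      ((H.filter fun E => D ⊆ E ∧ E ⊆ A).card : ℝ) < (δ - e) * ((N₁ - d).choose c : ℝ) := by
    intro A hA
    obtain ⟨hA, hbad⟩ := mem_filter.1 hA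
    obtain ⟨hAU, hAc⟩ := mem_powersetCard.1 hA
    unfold HostDeg at hbad
    push Not at hbad
    obtain ⟨D, hDA, hDd, hlt⟩ := hbad
    rw [hAc] at hlt
    exact mem_biUnion.2 ⟨D, mem_powersetCard.2 ⟨hDA.trans hAU, hDd⟩, mem_filter.2 ⟨hA, hDA, hlt⟩⟩
  have h3 : (((powersetCard N₁ U).filter fun A => ¬ HostDeg H d c (δ - e) A).card : ℝ) ≤
      ∑ D ∈ powersetCard d U, (((powersetCard N₁ U).filter fun A => D ⊆ A ∧
      ((H.filter fun E => D ⊆ E ∧ E ⊆ A).card : ℝ) <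
        (δ - e) * ((N₁ - d).choose c : ℝ)).card : ℝ) := by
    exact_mod_cast (card_le_card hsub).trans card_biUnion_le
  refine h3.trans ((sum_le_sum fun D hD => card_filter_link_le hH hc he he2 hU
    (mem_powersetCard.1 hD).1 (mem_powersetCard.1 hD).2 h1 h2).trans ?_)
  rw [sum_const, card_powersetCard, nsmul_eq_mul]
  refine mul_le_mul_of_nonneg_right ?_ (by positivity)
  exact_mod_cast Nat.choose_le_pow _ _

end DegreeInheritance

section SpreadCombination

lemma sum_powerset_descFactorial {β : Type*} [DecidableEq β] (S : Finset β) (m₁ m₂ : ℕ) :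
    ∑ T ∈ S.powerset, m₁.descFactorial T.card * m₂.descFactorial (S.card - T.card) =
      (m₁ + m₂).descFactorial S.card := by
  rw [sum_powerset_apply_card (fun a => m₁.descFactorial a * m₂.descFactorial (S.card - a)),
    Nat.descFactorial_eq_factorial_mul_choose, Nat.add_choose_eq,
    Nat.sum_antidiagonal_eq_sum_range_succ (fun i j => m₁.choose i * m₂.choose j), mul_sum]
  refine sum_congr rfl fun a ha => ?_
  have ha' : a ≤ S.card := by simpa [Nat.lt_succ_iff] using ha
  rw [Nat.descFactorial_eq_factorial_mul_choose, Nat.descFactorial_eq_factorial_mul_choose,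
    ← Nat.choose_mul_factorial_mul_factorial ha', smul_eq_mul]
  ring

lemma sum_ite_mixture {γ β : Type*} [Fintype β] [DecidableEq β] (𝒢 : Finset γ) (κ : ℝ)
    (w : γ → β → β → ℝ) (g : β → β → β) (P : β → Prop) [DecidablePred P] :
    (∑ M, if P M then (κ * ∑ A ∈ 𝒢, ∑ M₁, ∑ M₂, if g M₁ M₂ = M then w A M₁ M₂ else 0) else 0) =
      κ * ∑ A ∈ 𝒢, ∑ M₁, ∑ M₂, if P (g M₁ M₂) then w A M₁ M₂ else 0 := by
  have e1 : ∀ M, (if P M then (κ * ∑ A ∈ 𝒢, ∑ M₁, ∑ M₂,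
      if g M₁ M₂ = M then w A M₁ M₂ else 0) else 0) = κ * ∑ A ∈ 𝒢, ∑ M₁, ∑ M₂,
      if M = g M₁ M₂ then (if P M then w A M₁ M₂ else 0) else 0 := by
    intro M
    by_cases hM : P M
    · simp only [hM, if_true, eq_comm]
    · simp only [hM, if_false, ite_self, sum_const_zero, mul_zero]
  rw [sum_congr rfl fun M _ => e1 M, ← mul_sum, sum_comm]
  congr 1
  refine sum_congr rfl fun A _ => ?_
  rw [sum_comm]
  refine sum_congr rfl fun M₁ _ => ?_
  rw [sum_comm]
  refine sum_congr rfl fun M₂ _ => ?_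
  rw [sum_ite_eq' univ (g M₁ M₂)]
  simp

variable {V : Type*} [DecidableEq V]

lemma card_filter_subset_disjoint_mul (U X Y : Finset V) (N₁ : ℕ) (hN : N₁ ≤ U.card) (hX : X ⊆ U)
    (hY : Y ⊆ U) (hXY : Disjoint X Y) :
    ((powersetCard N₁ U).filter fun A => X ⊆ A ∧ Disjoint Y A).card *
      U.card.descFactorial (X.card + Y.card) =
    U.card.choose N₁ * (N₁.descFactorial X.card * (U.card - N₁).descFactorial Y.card) := by
  have hset : ((powersetCard N₁ U).filter fun A => X ⊆ A ∧ Disjoint Y A) =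
      ((powersetCard N₁ (U \ Y)).filter fun A => X ⊆ A) := by
    ext A
    simp only [mem_filter, mem_powersetCard, subset_sdiff]
    constructor
    · rintro ⟨⟨h1, h2⟩, h3, h4⟩
      exact ⟨⟨⟨h1, h4.symm⟩, h2⟩, h3⟩
    · rintro ⟨⟨⟨h1, h4⟩, h2⟩, h3⟩
      exact ⟨⟨h1, h2⟩, h3, h4.symm⟩
  have hXU : X ⊆ U \ Y := subset_sdiff.2 ⟨hX, hXY⟩
  have hXYc : X.card + Y.card ≤ U.card := by
    rw [← card_union_of_disjoint hXY]
    exact card_le_card (union_subset hX hY)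
  rcases lt_or_ge N₁ X.card with h1 | h1
  · rw [Nat.descFactorial_eq_zero_iff_lt.2 h1, zero_mul, mul_zero, Nat.mul_eq_zero]
    left
    rw [card_eq_zero, filter_eq_empty_iff]
    rintro A hA ⟨hXA, -⟩
    have := card_le_card hXA
    have := (mem_powersetCard.1 hA).2
    omega
  rcases lt_or_ge (U.card - N₁) Y.card with h2 | h2
  · rw [Nat.descFactorial_eq_zero_iff_lt.2 h2, mul_zero, mul_zero, Nat.mul_eq_zero]
    left
    rw [hset, powersetCard_eq_empty.2 (by rw [card_sdiff_of_subset hY]; omega)]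
    simp
  rw [hset, card_filter_superset_powersetCard _ _ hXU h1, card_sdiff_of_subset hY]
  have f1 := Nat.choose_mul_factorial_mul_factorial (n := U.card - Y.card - X.card)
    (k := N₁ - X.card) (by omega)
  rw [show U.card - Y.card - X.card - (N₁ - X.card) = U.card - N₁ - Y.card by omega] at f1
  have f2 := Nat.factorial_mul_descFactorial hXYc
  rw [show U.card - (X.card + Y.card) = U.card - Y.card - X.card by omega] at f2
  have f3 := Nat.choose_mul_factorial_mul_factorial hN
  have f4 := Nat.factorial_mul_descFactorial h1
  have f5 := Nat.factorial_mul_descFactorial h2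
  have hpos : 0 < (N₁ - X.card).factorial * (U.card - N₁ - Y.card).factorial := by positivity
  refine Nat.eq_of_mul_eq_mul_right hpos ?_
  rw [← f1] at f2
  rw [← f4, ← f5, ← f2] at f3
  linarith

variable {s : ℕ}

/-- `M` is a collection of `m` vertex-disjoint copies of `F` in `H`, all inside `U`. -/
structure IsPacking (F : Finset (Finset (Fin s))) (H : Finset (Finset V)) (U : Finset V) (m : ℕ)
    (M : Finset (Fin s ↪ V)) : Prop where
  card_eq : M.card = m
  disjoint : ∀ φ ∈ M, ∀ ψ ∈ M, ∀ a b, φ a = ψ b → φ = ψ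
  mem : ∀ φ ∈ M, ∀ a, φ a ∈ U
  edge : ∀ φ ∈ M, ∀ f ∈ F, f.map φ ∈ H

open Classical in
/-- There is a well-spread probability distribution on packings of size `m` in `U`. -/
def HasSpreadPacking [Fintype V] (F : Finset (Finset (Fin s))) (H : Finset (Finset V)) (K : ℝ)
    (m : ℕ) (U : Finset V) : Prop :=
  ∃ ν : Finset (Fin s ↪ V) → ℝ, (∀ M, 0 ≤ ν M) ∧ ∑ M, ν M = 1 ∧
    (∀ M, ν M ≠ 0 → IsPacking F H U m M) ∧
    ∀ S : Finset (Fin s ↪ V), ((s * m).descFactorial (s * S.card) : ℝ) *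
      (∑ M, if S ⊆ M then ν M else 0) ≤ K ^ S.card * m.descFactorial S.card

/-- The vertices covered by a family of embeddings. -/
def coveredVerts (T : Finset (Fin s ↪ V)) : Finset V :=
  T.biUnion fun φ => univ.map φ

lemma mem_coveredVerts {T : Finset (Fin s ↪ V)} {v : V} :
    v ∈ coveredVerts T ↔ ∃ φ ∈ T, ∃ a, φ a = v := by
  simp [coveredVerts]

lemma card_coveredVerts {T : Finset (Fin s ↪ V)}
    (h : ∀ φ ∈ T, ∀ ψ ∈ T, ∀ a b, φ a = ψ b → φ = ψ) : (coveredVerts T).card = s * T.card := by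
  rw [coveredVerts, card_biUnion]
  · simp [mul_comm]
  · intro φ hφ ψ hψ hne
    rw [Function.onFun, disjoint_left]
    intro v hv hv'
    obtain ⟨a, -, rfl⟩ := mem_map.1 hv
    obtain ⟨b, -, hb⟩ := mem_map.1 hv'
    exact hne (h φ hφ ψ hψ a b hb.symm)

lemma IsPacking.union {F : Finset (Finset (Fin s))} {H : Finset (Finset V)} {A B U : Finset V}
    {m₁ m₂ : ℕ} {M₁ M₂ : Finset (Fin s ↪ V)} (hs : 0 < s) (h₁ : IsPacking F H A m₁ M₁)
    (h₂ : IsPacking F H B m₂ M₂) (hAB : Disjoint A B) (hA : A ⊆ U) (hB : B ⊆ U) :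
    IsPacking F H U (m₁ + m₂) (M₁ ∪ M₂) where
  card_eq := by
    classical
    rw [card_union_of_disjoint, h₁.card_eq, h₂.card_eq]
    rw [disjoint_left]
    intro φ h h'
    exact disjoint_left.1 hAB (h₁.mem φ h ⟨0, hs⟩) (h₂.mem φ h' ⟨0, hs⟩)
  disjoint := by
    intro φ hφ ψ hψ a b hab
    rcases mem_union.1 hφ with hφ | hφ <;> rcases mem_union.1 hψ with hψ | hψ
    · exact h₁.disjoint φ hφ ψ hψ a b hab
    · exact absurd (h₂.mem ψ hψ b) (disjoint_left.1 hAB (hab ▸ h₁.mem φ hφ a))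
    · exact absurd (h₂.mem φ hφ a) (disjoint_left.1 hAB (hab.symm ▸ h₁.mem ψ hψ b))
    · exact h₂.disjoint φ hφ ψ hψ a b hab
  mem := by
    intro φ hφ a
    rcases mem_union.1 hφ with hφ | hφ
    · exact hA (h₁.mem φ hφ a)
    · exact hB (h₂.mem φ hφ a)
  edge := by
    intro φ hφ f hf
    rcases mem_union.1 hφ with hφ | hφ
    · exact h₁.edge φ hφ f hf
    · exact h₂.edge φ hφ f hf

open Classical in
lemma HasSpreadPacking.combine [Fintype V] {F : Finset (Finset (Fin s))} {H : Finset (Finset V)}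
    {K K' η : ℝ} {m₁ m₂ : ℕ} {U : Finset V} (hs : 0 < s) (hU : U.card = s * (m₁ + m₂))
    (hK' : 0 ≤ K') (hη0 : 0 ≤ η) (hη : η < 1) (hKK : K' ≤ (1 - η) * K)
    (𝒢 : Finset (Finset V)) (h𝒢 : 𝒢 ⊆ powersetCard (s * m₁) U)
    (h𝒢c : (1 - η) * (U.card.choose (s * m₁) : ℝ) ≤ 𝒢.card)
    (h₁ : ∀ A ∈ 𝒢, HasSpreadPacking F H K' m₁ A)
    (h₂ : ∀ A ∈ 𝒢, HasSpreadPacking F H K' m₂ (U \ A)) :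
    HasSpreadPacking F H K (m₁ + m₂) U := by
  have hN1 : s * m₁ ≤ U.card := by rw [hU]; exact Nat.mul_le_mul_left _ (Nat.le_add_right _ _)
  have hN2 : U.card - s * m₁ = s * m₂ := by rw [hU, mul_add, Nat.add_sub_cancel_left]
  have hch : (0 : ℝ) < U.card.choose (s * m₁) := by exact_mod_cast Nat.choose_pos hN1
  have h𝒢pos : (0 : ℝ) < 𝒢.card := lt_of_lt_of_le (mul_pos (by linarith) hch) h𝒢c
  have ex₁ : ∀ A, ∃ ν : Finset (Fin s ↪ V) → ℝ, A ∈ 𝒢 → ((∀ M, 0 ≤ ν M) ∧ ∑ M, ν M = 1 ∧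
    (∀ M, ν M ≠ 0 → IsPacking F H A m₁ M) ∧
    ∀ S : Finset (Fin s ↪ V), ((s * m₁).descFactorial (s * S.card) : ℝ) *
      (∑ M, if S ⊆ M then ν M else 0) ≤ K' ^ S.card * m₁.descFactorial S.card) := fun A => by
    by_cases hA : A ∈ 𝒢
    · obtain ⟨ν, hν⟩ := h₁ A hA
      exact ⟨ν, fun _ => hν⟩
    · exact ⟨0, fun h => absurd h hA⟩
  have ex₂ : ∀ A, ∃ ν : Finset (Fin s ↪ V) → ℝ, A ∈ 𝒢 → ((∀ M, 0 ≤ ν M) ∧ ∑ M, ν M = 1 ∧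
    (∀ M, ν M ≠ 0 → IsPacking F H (U \ A) m₂ M) ∧
    ∀ S : Finset (Fin s ↪ V), ((s * m₂).descFactorial (s * S.card) : ℝ) *
      (∑ M, if S ⊆ M then ν M else 0) ≤ K' ^ S.card * m₂.descFactorial S.card) := fun A => by
    by_cases hA : A ∈ 𝒢
    · obtain ⟨ν, hν⟩ := h₂ A hA
      exact ⟨ν, fun _ => hν⟩
    · exact ⟨0, fun h => absurd h hA⟩
  choose ν₁ hν₁ using ex₁
  choose ν₂ hν₂ using ex₂
  set ν : Finset (Fin s ↪ V) → ℝ := fun M => (𝒢.card : ℝ)⁻¹ * ∑ A ∈ 𝒢, ∑ M₁, ∑ M₂,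
    if M₁ ∪ M₂ = M then ν₁ A M₁ * ν₂ A M₂ else 0 with hν
  have hterm : ∀ A ∈ 𝒢, ∀ M₁ M₂, 0 ≤ ν₁ A M₁ * ν₂ A M₂ := fun A hA M₁ M₂ =>
    mul_nonneg ((hν₁ A hA).1 _) ((hν₂ A hA).1 _)
  have hν0 : ∀ M, 0 ≤ ν M := fun M => mul_nonneg (by positivity)
    (sum_nonneg fun A hA => sum_nonneg fun M₁ _ => sum_nonneg fun M₂ _ => by
      split_ifs
      · exact hterm A hA M₁ M₂
      · exact le_rfl)
  have hpush : ∀ (P : Finset (Fin s ↪ V) → Prop) [DecidablePred P], (∑ M, if P M then ν M else 0) =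
      (𝒢.card : ℝ)⁻¹ * ∑ A ∈ 𝒢, ∑ M₁, ∑ M₂,
        if P (M₁ ∪ M₂) then ν₁ A M₁ * ν₂ A M₂ else 0 := by
    intro P _
    exact sum_ite_mixture 𝒢 (𝒢.card : ℝ)⁻¹ (fun A M₁ M₂ => ν₁ A M₁ * ν₂ A M₂) (· ∪ ·) P
  have hsupp : ∀ A ∈ 𝒢, ∀ M₁ M₂, ν₁ A M₁ * ν₂ A M₂ ≠ 0 →
      IsPacking F H A m₁ M₁ ∧ IsPacking F H (U \ A) m₂ M₂ := fun A hA M₁ M₂ h =>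
    ⟨(hν₁ A hA).2.2.1 M₁ (left_ne_zero_of_mul h), (hν₂ A hA).2.2.1 M₂ (right_ne_zero_of_mul h)⟩
  have hpack : ∀ M, ν M ≠ 0 → IsPacking F H U (m₁ + m₂) M := by
    intro M hM
    have := right_ne_zero_of_mul hM
    obtain ⟨A, hA, hA'⟩ := exists_ne_zero_of_sum_ne_zero this
    obtain ⟨M₁, -, hM₁⟩ := exists_ne_zero_of_sum_ne_zero hA'
    obtain ⟨M₂, -, h⟩ := exists_ne_zero_of_sum_ne_zero hM₁
    split_ifs at h with hE
    · subst hE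
      obtain ⟨p₁, p₂⟩ := hsupp A hA M₁ M₂ h
      exact p₁.union hs p₂ disjoint_sdiff (mem_powersetCard.1 (h𝒢 hA)).1 sdiff_subset
    · exact absurd rfl h
  have htot : ∑ M, ν M = 1 := by
    have := hpush fun _ => True
    simp only [if_true] at this
    rw [this]
    have e : ∀ A ∈ 𝒢, ∑ M₁, ∑ M₂, ν₁ A M₁ * ν₂ A M₂ = 1 := by
      intro A hA
      rw [← sum_mul_sum, (hν₁ A hA).2.1, (hν₂ A hA).2.1, one_mul]
    rw [sum_congr rfl e, sum_const, nsmul_eq_mul, mul_one, inv_mul_cancel₀ h𝒢pos.ne']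
  refine ⟨ν, hν0, htot, hpack, fun S => ?_⟩
  have hK : 0 ≤ K := by
    by_contra hK
    push Not at hK
    nlinarith
  by_cases hS : ∃ M, ν M ≠ 0 ∧ S ⊆ M
  swap
  · push Not at hS
    rw [sum_eq_zero, mul_zero]
    · positivity
    · intro M _
      split_ifs with h
      · by_contra hne
        exact hS M hne h
      · rfl
  obtain ⟨M₀, hM₀, hSM₀⟩ := hS
  have hP₀ := hpack M₀ hM₀
  have hSd : ∀ φ ∈ S, ∀ ψ ∈ S, ∀ a b, φ a = ψ b → φ = ψ := fun φ hφ ψ hψ =>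
    hP₀.disjoint φ (hSM₀ hφ) ψ (hSM₀ hψ)
  have hSU : coveredVerts S ⊆ U := by
    intro v hv
    obtain ⟨φ, hφ, a, rfl⟩ := mem_coveredVerts.1 hv
    exact hP₀.mem φ (hSM₀ hφ) a
  have hr : S.card ≤ m₁ + m₂ := hP₀.card_eq ▸ card_le_card hSM₀
  rcases S.eq_empty_or_nonempty with rfl | hSne
  · simp [htot]
  set r := S.card with hrdef
  have hr1 : 1 ≤ r := hSne.card_pos
  set P₁ : Finset V → Finset (Fin s ↪ V) → ℝ := fun A T => ∑ M, if T ⊆ M then ν₁ A M else 0 with hP₁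
  set P₂ : Finset V → Finset (Fin s ↪ V) → ℝ := fun A T => ∑ M, if T ⊆ M then ν₂ A M else 0 with hP₂
  have hP₁0 : ∀ A ∈ 𝒢, ∀ T, 0 ≤ P₁ A T := fun A hA T => sum_nonneg fun M _ => by
    split_ifs
    · exact (hν₁ A hA).1 M
    · exact le_rfl
  have hP₂0 : ∀ A ∈ 𝒢, ∀ T, 0 ≤ P₂ A T := fun A hA T => sum_nonneg fun M _ => by
    split_ifs
    · exact (hν₂ A hA).1 M
    · exact le_rfl
  set good : Finset (Fin s ↪ V) → Finset V → Prop := fun T A =>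
    coveredVerts T ⊆ A ∧ Disjoint (coveredVerts (S \ T)) A with hgood
  have hA_le : ∀ A ∈ 𝒢, (∑ M₁, ∑ M₂, if S ⊆ M₁ ∪ M₂ then ν₁ A M₁ * ν₂ A M₂ else 0) ≤
      ∑ T ∈ S.powerset, if good T A then P₁ A T * P₂ A (S \ T) else 0 := by
    intro A hA
    have e : ∀ T, (if good T A then P₁ A T * P₂ A (S \ T) else 0) = ∑ M₁, ∑ M₂,
        if good T A ∧ T ⊆ M₁ ∧ S \ T ⊆ M₂ then ν₁ A M₁ * ν₂ A M₂ else 0 := by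
      intro T
      by_cases hg : good T A
      · rw [if_pos hg]
        simp only [hP₁, hP₂]
        rw [sum_mul_sum]
        refine sum_congr rfl fun M₁ _ => sum_congr rfl fun M₂ _ => ?_
        by_cases a1 : T ⊆ M₁ <;> by_cases a2 : S \ T ⊆ M₂ <;> simp [hg, a1, a2]
      · simp [hg]
    simp_rw [e]
    rw [sum_comm (s := S.powerset)]
    refine sum_le_sum fun M₁ _ => ?_
    rw [sum_comm (s := S.powerset)]
    refine sum_le_sum fun M₂ _ => ?_
    have hnn : ∀ T, 0 ≤ if good T A ∧ T ⊆ M₁ ∧ S \ T ⊆ M₂ then ν₁ A M₁ * ν₂ A M₂ else 0 := by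
      intro T
      split_ifs
      · exact hterm A hA M₁ M₂
      · exact le_rfl
    by_cases hne : ν₁ A M₁ * ν₂ A M₂ = 0
    · rw [hne]; simp
    split_ifs with hSM
    · obtain ⟨p₁, p₂⟩ := hsupp A hA M₁ M₂ hne
      have hsub2 : S \ (S ∩ M₁) ⊆ M₂ := by
        intro φ hφ
        obtain ⟨a1, a2⟩ := mem_sdiff.1 hφ
        exact (mem_union.1 (hSM a1)).resolve_left fun h => a2 (mem_inter.2 ⟨a1, h⟩)
      have hcond : good (S ∩ M₁) A ∧ S ∩ M₁ ⊆ M₁ ∧ S \ (S ∩ M₁) ⊆ M₂ := by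
        refine ⟨⟨?_, ?_⟩, inter_subset_right, hsub2⟩
        · intro v hv
          obtain ⟨φ, hφ, a, rfl⟩ := mem_coveredVerts.1 hv
          exact p₁.mem φ (mem_inter.1 hφ).2 a
        · rw [disjoint_left]
          intro v hv
          obtain ⟨φ, hφ, a, rfl⟩ := mem_coveredVerts.1 hv
          exact (mem_sdiff.1 (p₂.mem φ (hsub2 hφ) a)).2
      refine le_trans ?_ (single_le_sum (fun T _ => hnn T)
        (mem_powerset.2 (inter_subset_left : S ∩ M₁ ⊆ S)))
      rw [if_pos hcond]
    · exact sum_nonneg fun T _ => hnn T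
  have hNr : (0 : ℝ) < (s * (m₁ + m₂)).descFactorial (s * r) := by
    exact_mod_cast Nat.pos_of_ne_zero fun h =>
      absurd (Nat.descFactorial_eq_zero_iff_lt.1 h) (not_lt.2 (Nat.mul_le_mul_left _ hr))
  have hT : ∀ T ∈ S.powerset, ((s * (m₁ + m₂)).descFactorial (s * r) : ℝ) *
      (∑ A ∈ 𝒢, if good T A then P₁ A T * P₂ A (S \ T) else 0) ≤
      (U.card.choose (s * m₁) : ℝ) * (K' ^ r *
        (m₁.descFactorial T.card * m₂.descFactorial (r - T.card) : ℕ)) := by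
    intro T hTS
    rw [mem_powerset] at hTS
    have hTc : T.card ≤ r := card_le_card hTS
    have hSTc : (S \ T).card = r - T.card := card_sdiff_of_subset hTS
    have cT : (coveredVerts T).card = s * T.card :=
      card_coveredVerts fun φ hφ ψ hψ => hSd φ (hTS hφ) ψ (hTS hψ)
    have cST : (coveredVerts (S \ T)).card = s * (r - T.card) := by
      rw [card_coveredVerts fun φ hφ ψ hψ =>
        hSd φ (mem_sdiff.1 hφ).1 ψ (mem_sdiff.1 hψ).1, hSTc]
    have hcount := card_filter_subset_disjoint_mul U (coveredVerts T) (coveredVerts (S \ T)) (s * m₁)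
      hN1 (fun v hv => hSU (by
        obtain ⟨φ, hφ, a, h⟩ := mem_coveredVerts.1 hv
        exact mem_coveredVerts.2 ⟨φ, hTS hφ, a, h⟩)) (fun v hv => hSU (by
        obtain ⟨φ, hφ, a, h⟩ := mem_coveredVerts.1 hv
        exact mem_coveredVerts.2 ⟨φ, (mem_sdiff.1 hφ).1, a, h⟩)) (by
        rw [disjoint_left]
        intro v hv hv'
        obtain ⟨φ, hφ, a, rfl⟩ := mem_coveredVerts.1 hv
        obtain ⟨ψ, hψ, b, h⟩ := mem_coveredVerts.1 hv'
        have := hSd ψ (mem_sdiff.1 hψ).1 φ (hTS hφ) b a h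
        exact (mem_sdiff.1 hψ).2 (this ▸ hφ))
    rw [cT, cST, hN2, ← mul_add, Nat.add_sub_cancel' hTc] at hcount
    set D : ℝ := ((s * m₁).descFactorial (s * T.card) : ℝ) *
      ((s * m₂).descFactorial (s * (r - T.card)) : ℝ) with hD
    set G := (powersetCard (s * m₁) U).filter fun A =>
      coveredVerts T ⊆ A ∧ Disjoint (coveredVerts (S \ T)) A with hG
    have hcR : (G.card : ℝ) * ((s * (m₁ + m₂)).descFactorial (s * r) : ℝ) =
        (U.card.choose (s * m₁) : ℝ) * D := by
      rw [hD, ← hU]; exact_mod_cast hcount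
    set Z : ℝ := K' ^ r * (m₁.descFactorial T.card * m₂.descFactorial (r - T.card) : ℕ) with hZ
    have hZ0 : 0 ≤ Z := by positivity
    rw [← sum_filter]
    have hsubG : (𝒢.filter fun A => good T A) ⊆ G := filter_subset_filter _ h𝒢
    have hD0 : 0 ≤ D := by positivity
    rcases hD0.eq_or_lt with hD0 | hDpos
    · rw [← hD0, mul_zero] at hcR
      have hG0 : G.card = 0 := by
        rcases mul_eq_zero.1 hcR with h | h
        · exact_mod_cast h
        · exact absurd h hNr.ne'
      rw [card_eq_zero] at hG0
      rw [hG0, subset_empty] at hsubG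
      rw [hsubG, sum_empty, mul_zero]
      positivity
    · have hprod : ∀ A ∈ 𝒢.filter (fun A => good T A), D * (P₁ A T * P₂ A (S \ T)) ≤ Z := by
        intro A hA
        have hA := (mem_filter.1 hA).1
        have b1 := (hν₁ A hA).2.2.2 T
        have b2 := (hν₂ A hA).2.2.2 (S \ T)
        rw [hSTc] at b2
        have := mul_le_mul b1 b2 (mul_nonneg (Nat.cast_nonneg _) (hP₂0 A hA _)) (by positivity)
        have e : K' ^ T.card * (m₁.descFactorial T.card : ℝ) *
            (K' ^ (r - T.card) * (m₂.descFactorial (r - T.card) : ℝ)) = Z := by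
          rw [hZ, ← Nat.add_sub_cancel' hTc, pow_add, Nat.add_sub_cancel_left]
          push_cast
          ring
        rw [e] at this
        refine le_trans (le_of_eq ?_) this
        rw [hD]; ring
      have hsumle : D * ∑ A ∈ 𝒢.filter (fun A => good T A), P₁ A T * P₂ A (S \ T) ≤ G.card * Z := by
        rw [mul_sum]
        refine (sum_le_sum hprod).trans ?_
        rw [sum_const, nsmul_eq_mul]
        exact mul_le_mul_of_nonneg_right (by exact_mod_cast card_le_card hsubG) hZ0
      have := mul_le_mul_of_nonneg_left hsumle hNr.le
      refine le_of_mul_le_mul_left ?_ hDpos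
      calc _ = ((s * (m₁ + m₂)).descFactorial (s * r) : ℝ) *
            (D * ∑ A ∈ 𝒢.filter (fun A => good T A), P₁ A T * P₂ A (S \ T)) := by ring
        _ ≤ _ := this
        _ = (G.card : ℝ) * ((s * (m₁ + m₂)).descFactorial (s * r) : ℝ) * Z := by ring
        _ = _ := by rw [hcR]; ring
  have hmain : ((s * (m₁ + m₂)).descFactorial (s * r) : ℝ) *
      (∑ A ∈ 𝒢, ∑ M₁, ∑ M₂, if S ⊆ M₁ ∪ M₂ then ν₁ A M₁ * ν₂ A M₂ else 0) ≤
      (U.card.choose (s * m₁) : ℝ) * (K' ^ r * ((m₁ + m₂).descFactorial r : ℝ)) := by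
    refine (mul_le_mul_of_nonneg_left (sum_le_sum hA_le) hNr.le).trans ?_
    rw [sum_comm, mul_sum]
    refine (sum_le_sum hT).trans (le_of_eq ?_)
    rw [← mul_sum, ← mul_sum, ← Nat.cast_sum, sum_powerset_descFactorial]
  rw [hpush]
  have hpow : K' ^ r ≤ (1 - η) * K ^ r := by
    refine (pow_le_pow_left₀ hK' hKK r).trans ?_
    rw [mul_pow]
    refine mul_le_mul_of_nonneg_right ?_ (by positivity)
    exact pow_le_of_le_one (by linarith) (by linarith) (by omega)
  rw [← mul_assoc, mul_comm _ (𝒢.card : ℝ)⁻¹, mul_assoc, inv_mul_le_iff₀ h𝒢pos]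
  refine hmain.trans ?_
  have hKr : 0 ≤ K ^ r := by positivity
  calc (U.card.choose (s * m₁) : ℝ) * (K' ^ r * ((m₁ + m₂).descFactorial r : ℝ))
      ≤ (U.card.choose (s * m₁) : ℝ) * ((1 - η) * K ^ r * ((m₁ + m₂).descFactorial r : ℝ)) := by
        gcongr
    _ = ((1 - η) * (U.card.choose (s * m₁) : ℝ)) * (K ^ r * ((m₁ + m₂).descFactorial r : ℝ)) := by
        ring
    _ ≤ _ := by gcongr

end SpreadCombination

section SpreadExistence

lemma one_mem_diracThresholdSet {k s t d : ℕ} (hs : 0 < s) (ht : 0 < t) (hdk : d ≤ k)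
    (F : Finset (Finset (Fin s))) :
    ∃ δ : ℝ, δ ∈ {δ : ℝ | 0 < δ ∧ ∀ α : ℝ, 0 < α → ∃ n₀ : ℕ, ∀ n : ℕ, n₀ ≤ n →
    ∀ Hs : Fin (t * n) → Finset (Finset (Fin (s * n))),
      (∀ i, ∀ e ∈ Hs i, e.card = k) →
      (∀ i (D : Finset (Fin (s * n))), D.card = d →
        (δ + α) * ((s * n - d).choose (k - d) : ℝ) ≤
          (((Hs i).filter fun e => D ⊆ e).card : ℝ)) →
      IsTransversalFFactor F Hs} := by
  refine ⟨1, one_pos, fun α hα => ⟨k + 1, fun n hn Hs hHs hdeg => ?_⟩⟩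
  exfalso
  have hn1 : n ≤ s * n := Nat.le_mul_of_pos_left n hs
  have htn : 0 < t * n := Nat.mul_pos ht (by omega)
  obtain ⟨D, hD, hDd⟩ := exists_subset_card_eq (s := (univ : Finset (Fin (s * n)))) (n := d)
    (by rw [card_univ, Fintype.card_fin]; omega)
  have h1 := hdeg ⟨0, htn⟩ D hDd
  have h2 : ((Hs ⟨0, htn⟩).filter fun e => D ⊆ e).card ≤ (s * n - d).choose (k - d) := by
    have h3 := card_filter_superset_powersetCard (univ : Finset (Fin (s * n))) D (r := k)
      (subset_univ _) (by omega)
    rw [card_univ, Fintype.card_fin, hDd] at h3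
    rw [← h3]
    refine card_le_card fun e he => ?_
    obtain ⟨he, hDe⟩ := mem_filter.1 he
    exact mem_filter.2 ⟨mem_powersetCard.2 ⟨subset_univ _, hHs _ e he⟩, hDe⟩
  have h3 : (0 : ℝ) < (s * n - d).choose (k - d) := by
    exact_mod_cast Nat.choose_pos (by omega)
  have h4 : (((Hs ⟨0, htn⟩).filter fun e => D ⊆ e).card : ℝ) ≤ (s * n - d).choose (k - d) := by
    exact_mod_cast h2
  nlinarith

/-- Above the threshold, a single host graph has a perfect packing. -/
lemma exists_isPacking {k s t d : ℕ} (hs : 0 < s) (ht : 0 < t) (hdk : d ≤ k)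
    (F : Finset (Finset (Fin s))) {α : ℝ} (hα : 0 < α) :
    ∃ m₀ : ℕ, ∀ m ≥ m₀, ∀ (V : Type) [DecidableEq V] (H : Finset (Finset V)) (U : Finset V),
      (∀ e ∈ H, e.card = k) → U.card = s * m →
      HostDeg H d (k - d) (transversalDiracThreshold k s t d F + α) U →
      ∃ M, IsPacking F H U m M := by
  obtain ⟨δ, ⟨-, hδ⟩, hlt⟩ := exists_lt_of_csInf_lt (one_mem_diracThresholdSet (d := d) hs ht hdk F)
    (lt_add_of_pos_right (sInf _) (half_pos hα))
  obtain ⟨n₀, hn₀⟩ := hδ (α / 2) (half_pos hα)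
  refine ⟨n₀, fun m hm V _ H U hH hU hdeg => ?_⟩
  classical
  have eU : Fin (s * m) ≃ U := (Fintype.equivFinOfCardEq (by rw [Fintype.card_coe, hU])).symm
  set ψ : Fin (s * m) ↪ V := eU.toEmbedding.trans (Function.Embedding.subtype _) with hψ
  have hψU : ∀ x, ψ x ∈ U := fun x => (eU x).2
  have hψs : ∀ v ∈ U, ∃ x, ψ x = v := fun v hv => ⟨eU.symm ⟨v, hv⟩, by simp [hψ]⟩
  set H' : Finset (Finset (Fin (s * m))) := univ.filter fun E => E.map ψ ∈ H with hH'
  obtain ⟨φ, hφi, hφd, c, -, hc⟩ := hn₀ m hm (fun _ => H')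
    (fun _ e he => by
      rw [← card_map ψ]
      exact hH _ (mem_filter.1 he).2)
    (fun _ D hD => by
      have h1 := hdeg (D.map ψ) (fun v hv => by
        obtain ⟨x, -, rfl⟩ := mem_map.1 hv
        exact hψU x) (by rw [card_map, hD])
      rw [hU] at h1
      have h2 : (H.filter fun e => D.map ψ ⊆ e ∧ e ⊆ U).card ≤ (H'.filter fun e => D ⊆ e).card := by
        refine (card_le_card ?_).trans (card_image_le (f := fun E : Finset (Fin (s * m)) => E.map ψ))
        intro e he
        obtain ⟨heH, hDe, heU⟩ := mem_filter.1 he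
        have he' : (univ.filter fun x => ψ x ∈ e).map ψ = e := by
          ext v
          simp only [mem_map, mem_filter, mem_univ, true_and]
          constructor
          · rintro ⟨x, hx, rfl⟩
            exact hx
          · intro hv
            obtain ⟨x, rfl⟩ := hψs v (heU hv)
            exact ⟨x, hv, rfl⟩
        refine mem_image.2 ⟨univ.filter fun x => ψ x ∈ e, mem_filter.2 ⟨mem_filter.2 ⟨mem_univ _, ?_⟩,
          ?_⟩, he'⟩
        · rw [he']; exact heH
        · intro x hx
          exact mem_filter.2 ⟨mem_univ _, hDe (mem_map_of_mem ψ hx)⟩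
      have h3 : ((H.filter fun e => D.map ψ ⊆ e ∧ e ⊆ U).card : ℝ) ≤
          ((H'.filter fun e => D ⊆ e).card : ℝ) := by exact_mod_cast h2
      refine le_trans ?_ (h1.trans h3)
      refine mul_le_mul_of_nonneg_right ?_ (Nat.cast_nonneg _)
      unfold transversalDiracThreshold
      linarith)
  set g : Fin m → (Fin s ↪ V) := fun j => (⟨φ j, hφi j⟩ : Fin s ↪ Fin (s * m)).trans ψ with hg
  have hgd : ∀ j j' a b, g j a = g j' b → j = j' := by
    intro j j' a b h
    by_contra hne
    exact hφd j j' hne a b (ψ.injective h)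
  refine ⟨univ.image g, ?_, ?_, ?_, ?_⟩
  · rw [card_image_of_injective _ (fun j j' h => hgd j j' ⟨0, hs⟩ ⟨0, hs⟩ (by rw [h])), card_univ,
      Fintype.card_fin]
  · intro x hx y hy a b hab
    obtain ⟨j, -, rfl⟩ := mem_image.1 hx
    obtain ⟨j', -, rfl⟩ := mem_image.1 hy
    rw [hgd j j' a b hab]
  · intro x hx a
    obtain ⟨j, -, rfl⟩ := mem_image.1 hx
    exact hψU _
  · intro x hx f hf
    obtain ⟨j, -, rfl⟩ := mem_image.1 hx
    have := (mem_filter.1 (hc j ⟨f, hf⟩)).2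
    simp only [hg]
    rw [← map_map, map_eq_image (⟨φ j, hφi j⟩ : Fin s ↪ Fin (s * m))]
    exact this

variable {V : Type} [DecidableEq V]

lemma HostDeg.mono {H : Finset (Finset V)} {d c : ℕ} {δ δ' : ℝ} {U : Finset V}
    (h : HostDeg H d c δ U) (hδ : δ' ≤ δ) : HostDeg H d c δ' U := fun D hD hDd =>
  (mul_le_mul_of_nonneg_right hδ (Nat.cast_nonneg _)).trans (h D hD hDd)

lemma IsPacking.hasSpreadPacking [Fintype V] {s : ℕ} {F : Finset (Finset (Fin s))}
    {H : Finset (Finset V)} {U : Finset V} {m L : ℕ} {M : Finset (Fin s ↪ V)} {K : ℝ}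
    (hM : IsPacking F H U m M) (hmL : m ≤ L) (hK : ((s * L : ℕ) : ℝ) ^ s ≤ K) :
    HasSpreadPacking F H K m U := by
  classical
  have hK0 : 0 ≤ K := le_trans (by positivity) hK
  refine ⟨fun M' => if M' = M then 1 else 0, ?_, by simp, ?_, ?_⟩
  · intro M'
    dsimp only
    split_ifs <;> norm_num
  · intro M' h
    by_cases h' : M' = M
    · rw [h']; exact hM
    · dsimp only at h
      rw [if_neg h'] at h
      exact absurd rfl h
  · intro S
    have e : (∑ M', if S ⊆ M' then (if M' = M then (1 : ℝ) else 0) else 0) =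
        if S ⊆ M then 1 else 0 := by
      rw [sum_eq_single M]
      · simp
      · intro M' _ h
        simp [h]
      · simp
    have e' : (∑ M', if S ⊆ M' then (if M' = M then (1 : ℝ) else 0) else 0) ≤ 1 := by
      rw [e]; split_ifs <;> norm_num
    by_cases hS : S ⊆ M
    · have hr : S.card ≤ m := hM.card_eq ▸ card_le_card hS
      have h1 : (1 : ℝ) ≤ m.descFactorial S.card := by
        exact_mod_cast Nat.one_le_iff_ne_zero.2 fun h =>
          absurd (Nat.descFactorial_eq_zero_iff_lt.1 h) (not_lt.2 hr)
      have h2 : ((s * m).descFactorial (s * S.card) : ℝ) ≤ K ^ S.card := by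
        calc ((s * m).descFactorial (s * S.card) : ℝ) ≤ (((s * L) ^ (s * S.card) : ℕ) : ℝ) := by
              exact_mod_cast (Nat.descFactorial_le_pow _ _).trans
                (Nat.pow_le_pow_left (Nat.mul_le_mul_left _ hmL) _)
          _ = (((s * L : ℕ) : ℝ) ^ s) ^ S.card := by push_cast; rw [← pow_mul]
          _ ≤ _ := pow_le_pow_left₀ (by positivity) hK _
      calc _ ≤ ((s * m).descFactorial (s * S.card) : ℝ) * 1 := by
            refine mul_le_mul_of_nonneg_left ?_ (by positivity)
            convert e'
        _ ≤ K ^ S.card * 1 := by rw [mul_one, mul_one]; exact h2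
        _ ≤ _ := mul_le_mul_of_nonneg_left h1 (by positivity)
    · have e0 : (∑ M', if S ⊆ M' then (if M' = M then (1 : ℝ) else 0) else 0) = 0 := by
        rw [e, if_neg hS]
      refine le_trans (le_of_eq ?_) (by positivity)
      rw [mul_eq_zero]
      right
      convert e0

lemma exists_halving_level (d c s : ℕ) (hs : 1 ≤ s) (hc : 1 ≤ c) {α : ℝ} (hα : 0 < α) (m₀ : ℕ) :
    ∃ j₀ : ℕ, m₀ ≤ 2 ^ j₀ ∧ 10 * (9 / 10 : ℝ) ^ j₀ ≤ α ∧ ∀ j ≥ j₀, d + c ≤ 2 ^ j ∧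
      ∀ N N₁ : ℕ, s * 2 ^ j ≤ N₁ → 2 ^ j ≤ N → N ≤ s * 2 ^ (j + 2) → N ≤ 4 * N₁ →
        (N : ℝ) ^ d * Real.exp (-(((9 / 10 : ℝ) ^ j * ((N₁ - d).choose c : ℝ)) ^ 2 /
          (4 * ((N : ℝ) ^ (c - 1)) ^ 2 * N))) ≤ (1 / 2) ^ j / 8 := by
  set γ : ℝ := 1 / (4 * (64 : ℝ) ^ c * (c.factorial : ℝ) ^ 2) with hγ
  have hγ0 : 0 < γ := by positivity
  have hlim : Filter.Tendsto (fun j : ℕ => γ * (81 / 50 : ℝ) ^ j) Filter.atTop Filter.atTop :=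
    (tendsto_pow_atTop_atTop_of_one_lt (by norm_num)).const_mul_atTop hγ0
  have hlim2 := (Real.tendsto_pow_mul_exp_neg_atTop_nhds_zero (2 * (d + 1))).comp hlim
  set Q : ℝ := ((s : ℝ) * 4) ^ d * 8 * (γ⁻¹) ^ (2 * (d + 1)) with hQ
  have hQ0 : 0 < Q := by positivity
  have ev1 := hlim2.eventually (gt_mem_nhds (inv_pos.2 hQ0))
  have ev2 : ∀ᶠ j : ℕ in Filter.atTop, (9 / 10 : ℝ) ^ j < α / 10 :=
    (tendsto_pow_atTop_nhds_zero_of_lt_one (by norm_num) (by norm_num)).eventually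
      (gt_mem_nhds (by linarith : (0 : ℝ) < α / 10))
  obtain ⟨j₀, hj₀⟩ := Filter.eventually_atTop.1 (ev1.and ev2)
  have two_pow : ∀ n : ℕ, n ≤ 2 ^ n := fun n => Nat.lt_two_pow_self.le
  refine ⟨j₀ + m₀ + 2 * (d + c), ?_, ?_, ?_⟩
  · exact (two_pow m₀).trans (Nat.pow_le_pow_right (by norm_num) (by omega))
  · have := (hj₀ (j₀ + m₀ + 2 * (d + c)) (by omega)).2
    linarith
  intro j hj
  have hdc : 2 * (d + c) ≤ 2 ^ j :=
    (two_pow _).trans (Nat.pow_le_pow_right (by norm_num) (by omega))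
  refine ⟨by omega, fun N N₁ h1 h2 h3 h4 => ?_⟩
  have h1' : 2 ^ j ≤ N₁ := (Nat.le_mul_of_pos_left _ hs).trans h1
  have hNpos : (0 : ℝ) < N := by
    exact_mod_cast lt_of_lt_of_le (Nat.pow_pos (by norm_num)) h2
  have hch : ((N : ℝ) / 8) ^ c / c.factorial ≤ ((N₁ - d).choose c : ℝ) := by
    refine le_trans ?_ (Nat.pow_le_choose c (N₁ - d))
    refine div_le_div_of_nonneg_right ?_ (by positivity)
    refine pow_le_pow_left₀ (by positivity) ?_ _
    rw [div_le_iff₀ (by norm_num)]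
    have : N ≤ (N₁ - d + 1 - c) * 8 := by omega
    exact_mod_cast this
  have hexpo : γ * (81 / 50 : ℝ) ^ j ≤ ((9 / 10 : ℝ) ^ j * ((N₁ - d).choose c : ℝ)) ^ 2 /
      (4 * ((N : ℝ) ^ (c - 1)) ^ 2 * N) := by
    rw [le_div_iff₀ (by positivity)]
    have e1 : ((N : ℝ) ^ (c - 1)) ^ 2 * N * N = (N : ℝ) ^ c * (N : ℝ) ^ c := by
      obtain ⟨c', rfl⟩ : ∃ c', c = c' + 1 := ⟨c - 1, by omega⟩
      rw [Nat.add_sub_cancel]; ring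
    have e2 : (81 / 50 : ℝ) ^ j = ((9 / 10 : ℝ) ^ j) ^ 2 * 2 ^ j := by
      rw [← pow_mul, mul_comm j 2, pow_mul, ← mul_pow]; norm_num
    have h2R : (2 : ℝ) ^ j ≤ N := by exact_mod_cast h2
    have e3 : (64 : ℝ) ^ c = 8 ^ c * 8 ^ c := by rw [← mul_pow]; norm_num
    calc γ * (81 / 50 : ℝ) ^ j * (4 * ((N : ℝ) ^ (c - 1)) ^ 2 * N)
        = γ * 4 * ((9 / 10 : ℝ) ^ j) ^ 2 * (((N : ℝ) ^ (c - 1)) ^ 2 * N * 2 ^ j) := by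
          rw [e2]; ring
      _ ≤ γ * 4 * ((9 / 10 : ℝ) ^ j) ^ 2 * (((N : ℝ) ^ (c - 1)) ^ 2 * N * N) := by gcongr
      _ = ((9 / 10 : ℝ) ^ j * (((N : ℝ) / 8) ^ c / c.factorial)) ^ 2 := by
          rw [e1, hγ, e3, div_pow (N : ℝ) 8 c]
          field_simp
      _ ≤ _ := by gcongr
  have hj1 := (hj₀ j (by omega)).1
  simp only [Function.comp] at hj1
  have hNd : (N : ℝ) ^ d ≤ ((s : ℝ) * 4) ^ d * ((2 : ℝ) ^ j) ^ d := by
    rw [← mul_pow]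
    refine pow_le_pow_left₀ hNpos.le ?_ _
    have : (N : ℝ) ≤ s * 2 ^ (j + 2) := by exact_mod_cast h3
    refine this.trans (le_of_eq ?_)
    rw [pow_add]; ring
  have h2j : (2 : ℝ) ^ j ≤ ((81 / 50 : ℝ) ^ j) ^ 2 := by
    rw [← pow_mul, mul_comm j 2, pow_mul]
    exact pow_le_pow_left₀ (by norm_num) (by norm_num) _
  set y : ℝ := (81 / 50 : ℝ) ^ j with hy
  have hy0 : 0 < y := by positivity
  have hE := Real.exp_pos (-(γ * y))
  have key : ((s : ℝ) * 4) ^ d * ((2 : ℝ) ^ j) ^ (d + 1) * 8 * Real.exp (-(γ * y)) ≤ 1 := by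
    calc ((s : ℝ) * 4) ^ d * ((2 : ℝ) ^ j) ^ (d + 1) * 8 * Real.exp (-(γ * y))
        ≤ ((s : ℝ) * 4) ^ d * (y ^ 2) ^ (d + 1) * 8 * Real.exp (-(γ * y)) := by gcongr
      _ = Q * ((γ * y) ^ (2 * (d + 1)) * Real.exp (-(γ * y))) := by
        rw [hQ, mul_pow γ y, inv_pow, ← pow_mul]
        field_simp
      _ ≤ Q * Q⁻¹ := by gcongr
      _ = 1 := mul_inv_cancel₀ hQ0.ne'
  calc _ ≤ ((s : ℝ) * 4) ^ d * ((2 : ℝ) ^ j) ^ d * Real.exp (-(γ * y)) := by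
        refine mul_le_mul hNd ?_ (Real.exp_pos _).le (by positivity)
        rw [Real.exp_le_exp, neg_le_neg_iff]
        exact hexpo
    _ = (((s : ℝ) * 4) ^ d * ((2 : ℝ) ^ j) ^ (d + 1) * 8 * Real.exp (-(γ * y))) *
          ((1 / 2) ^ j / 8) := by
        rw [pow_succ ((2 : ℝ) ^ j) d, one_div, inv_pow]
        field_simp
    _ ≤ 1 * ((1 / 2) ^ j / 8) := by gcongr
    _ = _ := one_mul _

open Classical in
lemma hasSpreadPacking_step [Fintype V] {s d c j : ℕ} (hs : 1 ≤ s) (hc : 1 ≤ c)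
    {F : Finset (Finset (Fin s))} {H : Finset (Finset V)} (hH : ∀ e ∈ H, e.card = d + c)
    {θ K₀ : ℝ} (hK₀ : 0 ≤ K₀) (hdc : d + c ≤ 2 ^ j)
    (hnum : ∀ N N₁ : ℕ, s * 2 ^ j ≤ N₁ → 2 ^ j ≤ N → N ≤ s * 2 ^ (j + 2) → N ≤ 4 * N₁ →
        (N : ℝ) ^ d * Real.exp (-(((9 / 10 : ℝ) ^ j * ((N₁ - d).choose c : ℝ)) ^ 2 /
          (4 * ((N : ℝ) ^ (c - 1)) ^ 2 * N))) ≤ (1 / 2) ^ j / 8)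
    (ih : ∀ (m : ℕ) (U : Finset V), 2 ^ j ≤ m → m ≤ 2 ^ (j + 1) → U.card = s * m →
      HostDeg H d c (θ - 10 * (9 / 10) ^ j) U →
      HasSpreadPacking F H (K₀ * (2 - (1 / 2) ^ j)) m U)
    (m : ℕ) (U : Finset V) (hm1 : 2 ^ (j + 1) ≤ m) (hm2 : m ≤ 2 ^ (j + 2)) (hU : U.card = s * m)
    (hdeg : HostDeg H d c (θ - 10 * (9 / 10) ^ (j + 1)) U) :
    HasSpreadPacking F H (K₀ * (2 - (1 / 2) ^ (j + 1))) m U := by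
  obtain ⟨m₁, m₂, rfl, hm12, hm21⟩ : ∃ m₁ m₂, m = m₁ + m₂ ∧ m₁ ≤ m₂ ∧ m₂ ≤ m₁ + 1 :=
    ⟨m / 2, m - m / 2, by omega, by omega, by omega⟩
  rw [pow_succ] at hm1 hm2
  have hp : 2 ^ (j + 1) = 2 ^ j * 2 := pow_succ _ _
  have a1 : 2 ^ j ≤ m₁ := by omega
  have a2 : 2 ^ j ≤ m₂ := by omega
  have b1 : m₁ ≤ 2 ^ (j + 1) := by omega
  have b2 : m₂ ≤ 2 ^ (j + 1) := by omega
  set e : ℝ := (9 / 10) ^ j with he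
  have he0 : 0 ≤ e := by positivity
  have he1 : e ≤ 1 := pow_le_one₀ (by norm_num) (by norm_num)
  have hθ : θ - 10 * (9 / 10) ^ (j + 1) - e = θ - 10 * (9 / 10) ^ j := by
    rw [pow_succ, ← he]; ring
  set 𝒢 := (powersetCard (s * m₁) U).filter fun A =>
    HostDeg H d c (θ - 10 * (9 / 10) ^ j) A ∧ HostDeg H d c (θ - 10 * (9 / 10) ^ j) (U \ A) with h𝒢
  have hsm1 : s * m₁ ≤ U.card := by rw [hU]; exact Nat.mul_le_mul_left _ (Nat.le_add_right _ _)
  have hsm2 : s * m₂ ≤ U.card := by rw [hU]; exact Nat.mul_le_mul_left _ (Nat.le_add_left _ _)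
  have hsub : U.card - s * m₁ = s * m₂ := by rw [hU, mul_add, Nat.add_sub_cancel_left]
  have hchoose : U.card.choose (s * m₂) = U.card.choose (s * m₁) := by
    rw [← Nat.choose_symm hsm1, hsub]
  have hle : ∀ m' : ℕ, m' ≤ s * m' := fun m' => Nat.le_mul_of_pos_left _ hs
  have hbad : ∀ m', 2 ^ j ≤ m' → m₁ + m₂ ≤ 4 * m' → s * m' ≤ U.card →
      (((powersetCard (s * m') U).filter fun A =>
        ¬ HostDeg H d c (θ - 10 * (9 / 10) ^ j) A).card : ℝ) ≤
      U.card.choose (s * m') * ((1 / 2) ^ j / 8) := by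
    intro m' h1 h2 h3
    have h5 := card_filter_not_hostDeg_le hH hc he0 (by linarith) hdeg (N₁ := s * m')
      (by have := hle m'; omega) h3
    rw [hθ] at h5
    refine h5.trans ?_
    have h6 := hnum U.card (s * m') (Nat.mul_le_mul_left _ h1)
      (by have := hle (m₁ + m₂); omega)
      (by rw [hU]; exact Nat.mul_le_mul_left _ (by rw [pow_succ]; exact hm2))
      (by rw [hU, mul_left_comm]; exact Nat.mul_le_mul_left _ h2)
    calc _ = (U.card.choose (s * m') : ℝ) * ((U.card : ℝ) ^ d *
          Real.exp (-((e * ((s * m' - d).choose c : ℝ)) ^ 2 /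
        (4 * ((U.card : ℝ) ^ (c - 1)) ^ 2 * U.card)))) := by ring
      _ ≤ _ := mul_le_mul_of_nonneg_left h6 (Nat.cast_nonneg _)
  have hbad1 := hbad m₁ a1 (by omega) hsm1
  have hbad2 := hbad m₂ a2 (by omega) hsm2
  rw [hchoose] at hbad2
  have hcompl : ((powersetCard (s * m₁) U).filter fun A =>
        ¬ HostDeg H d c (θ - 10 * (9 / 10) ^ j) (U \ A)).card ≤
      ((powersetCard (s * m₂) U).filter fun A =>
        ¬ HostDeg H d c (θ - 10 * (9 / 10) ^ j) A).card := by
    refine card_le_card_of_injOn (fun A => U \ A) ?_ ?_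
    · intro A hA
      obtain ⟨hA, hbad⟩ := mem_filter.1 hA
      obtain ⟨hAU, hAc⟩ := mem_powersetCard.1 hA
      exact mem_coe.2 (mem_filter.2 ⟨mem_powersetCard.2 ⟨sdiff_subset, by
        rw [card_sdiff_of_subset hAU, hAc, hsub]⟩, hbad⟩)
    · intro A hA B hB h
      have hAU := (mem_powersetCard.1 (mem_filter.1 hA).1).1
      have hBU := (mem_powersetCard.1 (mem_filter.1 hB).1).1
      rw [← Finset.sdiff_sdiff_eq_self hAU, ← Finset.sdiff_sdiff_eq_self hBU]
      exact congrArg _ h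
  have hcover : (powersetCard (s * m₁) U).card ≤ 𝒢.card +
      (((powersetCard (s * m₁) U).filter fun A =>
        ¬ HostDeg H d c (θ - 10 * (9 / 10) ^ j) A).card +
      ((powersetCard (s * m₁) U).filter fun A =>
        ¬ HostDeg H d c (θ - 10 * (9 / 10) ^ j) (U \ A)).card) := by
    refine le_trans (card_le_card ?_) ((card_union_le _ _).trans
      (Nat.add_le_add_left (card_union_le _ _) _))
    intro A hA
    by_cases g1 : HostDeg H d c (θ - 10 * (9 / 10) ^ j) A
    · by_cases g2 : HostDeg H d c (θ - 10 * (9 / 10) ^ j) (U \ A)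
      · exact mem_union_left _ (mem_filter.2 ⟨hA, g1, g2⟩)
      · exact mem_union_right _ (mem_union_right _ (mem_filter.2 ⟨hA, g2⟩))
    · exact mem_union_right _ (mem_union_left _ (mem_filter.2 ⟨hA, g1⟩))
  have hp0 : (0 : ℝ) < (1 / 2) ^ j := by positivity
  have hp1 : ((1 : ℝ) / 2) ^ j ≤ 1 := pow_le_one₀ (by norm_num) (by norm_num)
  refine HasSpreadPacking.combine (η := (1 / 2) ^ j / 4) hs hU
    (mul_nonneg hK₀ (by linarith)) (by positivity) (by linarith) ?_ 𝒢 (filter_subset _ _) ?_ ?_ ?_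
    (K' := K₀ * (2 - (1 / 2) ^ j))
  · rw [mul_left_comm, pow_succ]
    refine mul_le_mul_of_nonneg_left ?_ hK₀
    nlinarith
  · rw [card_powersetCard] at hcover
    have h1 : (U.card.choose (s * m₁) : ℝ) ≤ 𝒢.card +
      (((powersetCard (s * m₁) U).filter fun A =>
        ¬ HostDeg H d c (θ - 10 * (9 / 10) ^ j) A).card +
      ((powersetCard (s * m₁) U).filter fun A =>
        ¬ HostDeg H d c (θ - 10 * (9 / 10) ^ j) (U \ A)).card : ℝ) := by exact_mod_cast hcover
    have h2 : (((powersetCard (s * m₁) U).filter fun A =>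
        ¬ HostDeg H d c (θ - 10 * (9 / 10) ^ j) (U \ A)).card : ℝ) ≤
      ((powersetCard (s * m₂) U).filter fun A =>
        ¬ HostDeg H d c (θ - 10 * (9 / 10) ^ j) A).card := by exact_mod_cast hcompl
    linarith
  · intro A hA
    obtain ⟨hA, g1, -⟩ := mem_filter.1 hA
    exact ih m₁ A a1 b1 (mem_powersetCard.1 hA).2 g1
  · intro A hA
    obtain ⟨hA, -, g2⟩ := mem_filter.1 hA
    obtain ⟨hAU, hAc⟩ := mem_powersetCard.1 hA
    exact ih m₂ _ a2 b2 (by rw [card_sdiff_of_subset hAU, hAc, hsub]) g2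

/-- Above the transversal threshold there are well-spread perfect packings. -/
theorem exists_hasSpreadPacking {k s t d : ℕ} (hs : 1 ≤ s) (ht : 0 < t) (hdk : d < k)
    (F : Finset (Finset (Fin s))) {α : ℝ} (hα : 0 < α) :
    ∃ (K : ℝ) (n₀ : ℕ), 0 ≤ K ∧ ∀ n ≥ n₀, ∀ (V : Type) [DecidableEq V] [Fintype V]
      (H : Finset (Finset V)) (U : Finset V), (∀ e ∈ H, e.card = k) → U.card = s * n →
      HostDeg H d (k - d) (transversalDiracThreshold k s t d F + α) U →
      HasSpreadPacking F H K n U := by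
  obtain ⟨m₀, hm₀⟩ := exists_isPacking (d := d) hs ht hdk.le F (half_pos hα)
  obtain ⟨j₀, hj1, hj2, hj3⟩ := exists_halving_level d (k - d) s hs (by omega) (half_pos hα) m₀
  set K₀ : ℝ := ((s * 2 ^ (j₀ + 1) : ℕ) : ℝ) ^ s with hK₀
  have hK₀0 : 0 ≤ K₀ := by positivity
  refine ⟨K₀ * 2, 2 ^ j₀, by positivity, fun n hn V _ _ H U hH hU hdeg => ?_⟩
  set θ := transversalDiracThreshold k s t d F + α with hθ
  have hind : ∀ j ≥ j₀, ∀ (m : ℕ) (U : Finset V), 2 ^ j ≤ m → m ≤ 2 ^ (j + 1) → U.card = s * m →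
      HostDeg H d (k - d) (θ - 10 * (9 / 10) ^ j) U →
      HasSpreadPacking F H (K₀ * (2 - (1 / 2) ^ j)) m U := by
    intro j hj
    induction j, hj using Nat.le_induction with
    | base =>
      intro m U h1 h2 hU hdeg
      obtain ⟨M, hM⟩ := hm₀ m (hj1.trans h1) V H U hH hU (hdeg.mono (by rw [hθ]; linarith))
      refine hM.hasSpreadPacking h2 ?_
      have : ((1 : ℝ) / 2) ^ j₀ ≤ 1 := pow_le_one₀ (by norm_num) (by norm_num)
      rw [← hK₀]
      nlinarith
    | succ j hj ih =>
      intro m U h1 h2 hU hdeg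
      exact hasSpreadPacking_step hs (by omega) (by rwa [Nat.add_sub_cancel' hdk.le]) hK₀0
        (hj3 j hj).1 (hj3 j hj).2 ih m U h1 h2 hU hdeg
  have hn0 : n ≠ 0 := by
    have : 0 < 2 ^ j₀ := by positivity
    omega
  have hlog : j₀ ≤ Nat.log 2 n := (Nat.le_log_iff_pow_le (by norm_num) hn0).2 hn
  obtain ⟨ν, h1, h2, h3, h4⟩ := hind (Nat.log 2 n) hlog n U (Nat.pow_log_le_self 2 hn0)
    (Nat.lt_pow_succ_log_self (by norm_num) n).le hU (hdeg.mono (by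
      have : (0 : ℝ) ≤ (9 / 10) ^ Nat.log 2 n := by positivity
      linarith))
  refine ⟨ν, h1, h2, h3, fun S => (h4 S).trans ?_⟩
  have hp0 : (0 : ℝ) < (1 / 2) ^ Nat.log 2 n := by positivity
  have hp1 : ((1 : ℝ) / 2) ^ Nat.log 2 n ≤ 1 := pow_le_one₀ (by norm_num) (by norm_num)
  refine mul_le_mul_of_nonneg_right (pow_le_pow_left₀ (mul_nonneg hK₀0 (by linarith)) ?_ _)
    (Nat.cast_nonneg _)
  nlinarith

end SpreadExistence

section Colouring

lemma sum_ite_pushforward {γ β : Type*} [Fintype β] [DecidableEq β] (𝒢 : Finset γ)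
    (w : γ → ℝ) (g : γ → β) (P : β → Prop) [DecidablePred P] :
    (∑ N, if P N then ∑ x ∈ 𝒢, (if g x = N then w x else 0) else 0) =
      ∑ x ∈ 𝒢, if P (g x) then w x else 0 := by
  have e1 : ∀ N, (if P N then ∑ x ∈ 𝒢, (if g x = N then w x else 0) else 0) =
      ∑ x ∈ 𝒢, if N = g x then (if P N then w x else 0) else 0 := by
    intro N
    by_cases hN : P N
    · simp only [hN, if_true, eq_comm]
    · simp only [hN, if_false, ite_self, sum_const_zero]
  rw [sum_congr rfl fun N _ => e1 N, sum_comm]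
  refine sum_congr rfl fun x _ => ?_
  rw [sum_ite_eq' univ (g x)]
  simp

lemma card_perm_agree_on {K : Type*} [Fintype K] [DecidableEq K] (Q : Finset K)
    (π₀ : Equiv.Perm K) :
    (univ.filter fun π : Equiv.Perm K => ∀ x ∈ Q, π x = π₀ x).card =
      (Fintype.card K - Q.card).factorial := by
  classical
  have h1 : (univ.filter fun π : Equiv.Perm K => ∀ x ∈ Q, π x = π₀ x).card =
      Fintype.card {f : Equiv.Perm K // ∀ a, ¬ (a ∉ Q) → f a = a} := by
    rw [Fintype.card_subtype]
    refine card_bij' (fun π _ => π₀⁻¹ * π) (fun π _ => π₀ * π) ?_ ?_ ?_ ?_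
    · intro π hπ
      simp only [mem_filter, mem_univ, true_and, not_not] at hπ ⊢
      intro a ha
      simp [hπ a ha]
    · intro π hπ
      simp only [mem_filter, mem_univ, true_and, not_not] at hπ ⊢
      intro a ha
      simp [hπ a ha]
    · intro π _; simp
    · intro π _; simp
  rw [h1, ← Fintype.card_congr (Equiv.Perm.subtypeEquivSubtypePerm fun a => a ∉ Q),
    Fintype.card_perm, Fintype.card_subtype_compl]
  simp

lemma pow_le_six_pow_mul_descFactorial {N x : ℕ} (hx : x ≤ N) :
    (N : ℝ) ^ x ≤ 6 ^ x * (N.descFactorial x : ℝ) := by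
  rcases Nat.eq_zero_or_pos x with rfl | hx0
  · simp
  have hN : (0 : ℝ) < N := by exact_mod_cast hx0.trans_le hx
  rcases le_or_gt (2 * x) N with h | h
  · have h1 : ((N + 1 - x : ℕ) : ℝ) ^ x ≤ (N.descFactorial x : ℝ) := by
      exact_mod_cast Nat.pow_sub_le_descFactorial N x
    have h2 : (N : ℝ) ≤ 2 * ((N + 1 - x : ℕ) : ℝ) := by
      have : N ≤ 2 * (N + 1 - x) := by omega
      exact_mod_cast this
    calc (N : ℝ) ^ x ≤ (6 * ((N + 1 - x : ℕ) : ℝ)) ^ x := by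
          refine pow_le_pow_left₀ hN.le ?_ x
          have : (0 : ℝ) ≤ ((N + 1 - x : ℕ) : ℝ) := Nat.cast_nonneg _
          linarith
      _ = 6 ^ x * ((N + 1 - x : ℕ) : ℝ) ^ x := mul_pow _ _ _
      _ ≤ _ := mul_le_mul_of_nonneg_left h1 (by positivity)
  · have h1 : ((x.factorial : ℕ) : ℝ) ≤ (N.descFactorial x : ℝ) := by
      rw [← Nat.descFactorial_self]
      exact_mod_cast Nat.descFactorial_le x hx
    have h2 : (x : ℝ) ^ x ≤ 3 ^ x * x.factorial := by
      have h3 := Real.pow_div_factorial_le_exp (x : ℝ) (Nat.cast_nonneg _) x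
      rw [div_le_iff₀ (by positivity)] at h3
      refine h3.trans (mul_le_mul_of_nonneg_right ?_ (by positivity))
      rw [← mul_one (x : ℝ), Real.exp_nat_mul]
      exact pow_le_pow_left₀ (Real.exp_pos _).le Real.exp_one_lt_three.le _
    have h4 : (N : ℝ) ≤ 2 * x := by exact_mod_cast h.le
    calc (N : ℝ) ^ x ≤ (2 * x) ^ x := pow_le_pow_left₀ hN.le h4 x
      _ = 2 ^ x * (x : ℝ) ^ x := mul_pow _ _ _
      _ ≤ 2 ^ x * (3 ^ x * x.factorial) := mul_le_mul_of_nonneg_left h2 (by positivity)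
      _ = 6 ^ x * x.factorial := by rw [← mul_assoc, ← mul_pow]; norm_num
      _ ≤ _ := mul_le_mul_of_nonneg_left h1 (by positivity)

lemma colour_spread_bound {s t n r : ℕ} {κ q : ℝ} (hs : 1 ≤ s) (ht : 1 ≤ t) (hn : 1 ≤ n)
    (hr : r ≤ n) (hκ : 0 ≤ κ)
    (hq : ((s * n).descFactorial (s * r) : ℝ) * q ≤ κ ^ r * n.descFactorial r) :
    q / ((t * n).descFactorial (t * r) : ℝ) ≤ (6 ^ (s + t) * κ / (n : ℝ) ^ (s + t - 1)) ^ r := by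
  have hn' : (1 : ℝ) ≤ n := by exact_mod_cast hn
  have hn0 : (0 : ℝ) < n := by linarith
  have key : ∀ a : ℕ, 1 ≤ a → (n : ℝ) ^ (a * r) ≤ 6 ^ (a * r) * ((a * n).descFactorial (a * r) : ℝ) := by
    intro a ha
    refine le_trans ?_ (pow_le_six_pow_mul_descFactorial (Nat.mul_le_mul_left a hr))
    refine pow_le_pow_left₀ hn0.le ?_ _
    exact_mod_cast Nat.le_mul_of_pos_left n ha
  have pos : ∀ a : ℕ, (0 : ℝ) < ((a * n).descFactorial (a * r) : ℝ) := by
    intro a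
    exact_mod_cast Nat.descFactorial_pos.2 (Nat.mul_le_mul_left a hr)
  have hd : (n.descFactorial r : ℝ) ≤ (n : ℝ) ^ r := by exact_mod_cast Nat.descFactorial_le_pow n r
  set X : ℝ := ((s * n).descFactorial (s * r) : ℝ)
  set Y : ℝ := ((t * n).descFactorial (t * r) : ℝ)
  have hX := pos s
  have hY := pos t
  have h1 : X * q ≤ κ ^ r * (n : ℝ) ^ r :=
    hq.trans (mul_le_mul_of_nonneg_left hd (by positivity))
  have hq' : q ≤ κ ^ r * (n : ℝ) ^ r / X := by rw [le_div_iff₀ hX]; linarith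
  have h2 : (n : ℝ) ^ (s * r) * (n : ℝ) ^ (t * r) ≤ (6 ^ (s * r) * X) * (6 ^ (t * r) * Y) :=
    mul_le_mul (key s hs) (key t ht) (by positivity) (by positivity)
  have hst : (n : ℝ) ^ (s * r) * (n : ℝ) ^ (t * r) =
      ((n : ℝ) ^ (s + t - 1)) ^ r * (n : ℝ) ^ r := by
    rw [← pow_add, ← mul_pow, ← pow_succ, Nat.sub_add_cancel (by omega), ← pow_mul, add_mul]
  calc q / Y ≤ κ ^ r * (n : ℝ) ^ r / X / Y := div_le_div_of_nonneg_right hq' hY.le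
    _ = κ ^ r * (n : ℝ) ^ r / (X * Y) := by rw [div_div]
    _ ≤ (6 ^ (s + t)) ^ r * κ ^ r / ((n : ℝ) ^ (s + t - 1)) ^ r := by
        rw [div_le_div_iff₀ (by positivity) (by positivity)]
        have h6 : (6 ^ (s * r) * X) * (6 ^ (t * r) * Y) = (6 ^ (s + t)) ^ r * (X * Y) := by
          rw [← pow_mul, add_mul, pow_add]; ring
        rw [hst, h6] at h2
        have := mul_le_mul_of_nonneg_left h2 (show 0 ≤ κ ^ r by positivity)
        nlinarith
    _ = _ := by rw [div_pow, mul_pow]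

end Colouring

section RandomColouring

variable {s : ℕ} {V K : Type} [DecidableEq V] [DecidableEq K]

open Classical in
/-- The copies in `M`, with the edges coloured by `β` followed by the permutation `π`. -/
noncomputable def colouredFamily {F : Finset (Finset (Fin s))} (β : (Fin s ↪ V) × {e // e ∈ F} → K)
    (M : Finset (Fin s ↪ V)) (π : Equiv.Perm K) :
    Finset ((Fin s ↪ V) × ({e // e ∈ F} → K)) :=
  M.image fun φ => (φ, fun f => π (β (φ, f)))

lemma mem_colouredFamily {F : Finset (Finset (Fin s))} {β : (Fin s ↪ V) × {e // e ∈ F} → K}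
    {M : Finset (Fin s ↪ V)} {π : Equiv.Perm K} {A : (Fin s ↪ V) × ({e // e ∈ F} → K)} :
    A ∈ colouredFamily β M π ↔ A.1 ∈ M ∧ ∀ f, A.2 f = π (β (A.1, f)) := by
  obtain ⟨φ, c⟩ := A
  simp only [colouredFamily, mem_image, Prod.mk.injEq]
  constructor
  · rintro ⟨φ', h, rfl, rfl⟩
    exact ⟨h, fun _ => rfl⟩
  · rintro ⟨h, h'⟩
    exact ⟨φ, h, rfl, (funext h').symm⟩

open Classical in
lemma card_perm_subset_colouredFamily [Fintype K] {F : Finset (Finset (Fin s))}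
    {β : (Fin s ↪ V) × {e // e ∈ F} → K} {M : Finset (Fin s ↪ V)}
    (hβ : Set.InjOn β {x | x.1 ∈ M}) (S : Finset ((Fin s ↪ V) × ({e // e ∈ F} → K)))
    (hne : ∃ π, S ⊆ colouredFamily β M π) :
    S.image Prod.fst ⊆ M ∧ (S.image Prod.fst).card = S.card ∧
      ((univ.filter fun π : Equiv.Perm K => S ⊆ colouredFamily β M π).card : ℕ) ≤
        (Fintype.card K - F.card * S.card).factorial := by
  obtain ⟨π₀, h₀⟩ := hne
  have hfst : Set.InjOn (Prod.fst : (Fin s ↪ V) × ({e // e ∈ F} → K) → _) S := by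
    intro A hA B hB hAB
    have hA' := mem_colouredFamily.1 (h₀ hA)
    have hB' := mem_colouredFamily.1 (h₀ hB)
    refine Prod.ext hAB (funext fun f => ?_)
    rw [hA'.2, hB'.2, hAB]
  have hsub : S.image Prod.fst ⊆ M := by
    intro φ hφ
    obtain ⟨A, hA, rfl⟩ := mem_image.1 hφ
    exact (mem_colouredFamily.1 (h₀ hA)).1
  have hc : (S.image Prod.fst).card = S.card := card_image_of_injOn hfst
  refine ⟨hsub, hc, ?_⟩
  set Q : Finset K := (S.image Prod.fst ×ˢ (univ : Finset {e // e ∈ F})).image β with hQ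
  have hQc : Q.card = F.card * S.card := by
    rw [hQ, card_image_of_injOn, card_product, hc, card_univ, Fintype.card_coe, mul_comm]
    intro x hx y hy hxy
    rw [mem_coe, mem_product] at hx hy
    exact hβ (hsub hx.1) (hsub hy.1) hxy
  rw [← hQc, ← card_perm_agree_on Q π₀]
  refine card_le_card fun π hπ => ?_
  simp only [mem_filter, mem_univ, true_and] at hπ ⊢
  intro x hx
  obtain ⟨⟨φ, f⟩, hy, rfl⟩ := mem_image.1 hx
  obtain ⟨A, hA, hAφ⟩ := mem_image.1 (mem_product.1 hy).1
  simp only at hAφ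
  subst hAφ
  rw [← (mem_colouredFamily.1 (hπ hA)).2, ← (mem_colouredFamily.1 (h₀ hA)).2]

open Classical in
theorem exists_spread_rainbowPacking [Fintype V] [Fintype K] {F : Finset (Finset (Fin s))}
    {H : Finset (Finset V)} {κ : ℝ} {n : ℕ} (hs : 1 ≤ s) (ht : 1 ≤ F.card) (hn : 1 ≤ n)
    (hκ : 0 ≤ κ) (hK : Fintype.card K = F.card * n) (h : HasSpreadPacking F H κ n univ) :
    ∃ ν : Finset ((Fin s ↪ V) × ({e // e ∈ F} → K)) → ℝ, (∀ M, 0 ≤ ν M) ∧ ∑ M, ν M = 1 ∧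
      (∀ M, ν M ≠ 0 → IsRainbowPacking F M ∧ M.card = n ∧
        ∀ A ∈ M, coloredEdges F A ⊆ univ ×ˢ H) ∧
      ∀ S : Finset ((Fin s ↪ V) × ({e // e ∈ F} → K)), (∑ M, if S ⊆ M then ν M else 0) ≤
        (6 ^ (s + F.card) * κ / (n : ℝ) ^ (s + F.card - 1)) ^ S.card := by
  obtain ⟨μ, hμ0, hμ1, hμM, hμS⟩ := h
  have : Nonempty K := Fintype.card_pos_iff.1 (by rw [hK]; exact Nat.mul_pos ht hn)
  have exβ : ∀ M : Finset (Fin s ↪ V), ∃ β : (Fin s ↪ V) × {e // e ∈ F} → K,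
      M.card = n → Set.InjOn β {x | x.1 ∈ M} := by
    intro M
    by_cases hM : M.card = n
    · have hc : Fintype.card {x // x ∈ M ×ˢ (univ : Finset {e // e ∈ F})} = Fintype.card K := by
        rw [Fintype.card_coe, card_product, hM, card_univ, Fintype.card_coe, hK, mul_comm]
      let e := Fintype.equivOfCardEq hc
      refine ⟨fun x => if hx : x ∈ M ×ˢ (univ : Finset {e // e ∈ F}) then e ⟨x, hx⟩
        else Classical.arbitrary K, fun _ => ?_⟩
      intro x hx y hy hxy
      have hx' : x ∈ M ×ˢ (univ : Finset {e // e ∈ F}) := mem_product.2 ⟨hx, mem_univ _⟩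
      have hy' : y ∈ M ×ˢ (univ : Finset {e // e ∈ F}) := mem_product.2 ⟨hy, mem_univ _⟩
      simp only [hx', hy', dif_pos] at hxy
      exact congrArg Subtype.val (e.injective hxy)
    · exact ⟨fun _ => Classical.arbitrary K, fun h => absurd h hM⟩
  choose β hβ using exβ
  set T : ℝ := ((Fintype.card K).factorial : ℝ) with hT
  have hTpos : 0 < T := by rw [hT]; exact_mod_cast Nat.factorial_pos _
  set 𝒢 : Finset (Finset (Fin s ↪ V) × Equiv.Perm K) := univ ×ˢ univ with h𝒢
  set g : Finset (Fin s ↪ V) × Equiv.Perm K → Finset ((Fin s ↪ V) × ({e // e ∈ F} → K)) :=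
    fun x => colouredFamily (β x.1) x.1 x.2 with hg
  set w : Finset (Fin s ↪ V) × Equiv.Perm K → ℝ := fun x => μ x.1 / T with hw
  have hw0 : ∀ x, 0 ≤ w x := fun x => div_nonneg (hμ0 _) hTpos.le
  have hpush : ∀ (P : Finset ((Fin s ↪ V) × ({e // e ∈ F} → K)) → Prop) [DecidablePred P],
      (∑ N, if P N then ∑ x ∈ 𝒢, (if g x = N then w x else 0) else 0) =
      ∑ M, ∑ π, if P (g (M, π)) then μ M / T else 0 := by
    intro P _
    rw [sum_ite_pushforward 𝒢 w g P, h𝒢, sum_product]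
  refine ⟨fun N => ∑ x ∈ 𝒢, if g x = N then w x else 0, ?_, ?_, ?_, ?_⟩
  · intro N
    exact sum_nonneg fun x _ => by split_ifs; exacts [hw0 x, le_rfl]
  · have := hpush fun _ => True
    simp only [if_true] at this
    rw [this]
    simp only [sum_const, card_univ, Fintype.card_perm, nsmul_eq_mul]
    rw [← hμ1]
    refine sum_congr rfl fun M _ => ?_
    rw [← hT]
    field_simp
  · intro N hN
    obtain ⟨⟨M, π⟩, -, hx⟩ := exists_ne_zero_of_sum_ne_zero hN
    split_ifs at hx with hgN
    · subst hgN
      have hM : μ M ≠ 0 := fun h0 => hx (by simp [hw, h0])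
      have pM := hμM M hM
      have iβ := hβ M pM.card_eq
      refine ⟨⟨?_, ?_⟩, ?_, ?_⟩
      · intro A hA B hB a b hab
        have hA' := mem_colouredFamily.1 hA
        have hB' := mem_colouredFamily.1 hB
        have h1 := pM.disjoint _ hA'.1 _ hB'.1 a b hab
        refine Prod.ext h1 (funext fun f => ?_)
        rw [hA'.2, hB'.2, h1]
      · intro A hA B hB f f' hff
        have hA' := mem_colouredFamily.1 hA
        have hB' := mem_colouredFamily.1 hB
        rw [hA'.2, hB'.2] at hff
        have h1 := iβ (show (A.1, f) ∈ {x : _ × _ | x.1 ∈ M} from hA'.1)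
          (show (B.1, f') ∈ {x : _ × _ | x.1 ∈ M} from hB'.1) (π.injective hff)
        rw [Prod.mk.injEq] at h1
        refine ⟨Prod.ext h1.1 (funext fun f => ?_), h1.2⟩
        rw [hA'.2, hB'.2, h1.1]
      · rw [← pM.card_eq]
        refine card_image_of_injective _ fun φ ψ h => ?_
        exact congrArg Prod.fst h
      · intro A hA x hx
        have hA' := mem_colouredFamily.1 hA
        simp only [coloredEdges, mem_image, mem_univ, true_and] at hx
        obtain ⟨f, rfl⟩ := hx
        exact mem_product.2 ⟨mem_univ _, pM.edge _ hA'.1 _ f.2⟩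
    · exact absurd rfl hx
  · intro S
    beta_reduce
    rw [hpush fun N => S ⊆ N]
    by_cases hS : ∃ M, μ M ≠ 0 ∧ ∃ π, S ⊆ g (M, π)
    swap
    · push Not at hS
      rw [sum_eq_zero]
      · positivity
      intro M _
      refine sum_eq_zero fun π _ => ?_
      split_ifs with h1
      · by_cases h0 : μ M = 0
        · simp [h0]
        · exact absurd h1 (hS M h0 π)
      · rfl
    obtain ⟨M₁, hM₁, hne₁⟩ := hS
    obtain ⟨hsub₁, hc, -⟩ := card_perm_subset_colouredFamily (hβ M₁ (hμM M₁ hM₁).card_eq) S hne₁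
    have hr : S.card ≤ n := by
      rw [← hc, ← (hμM M₁ hM₁).card_eq]
      exact card_le_card hsub₁
    have hq := hμS (S.image Prod.fst)
    rw [hc] at hq
    refine le_trans ?_ (colour_spread_bound hs ht hn hr hκ hq)
    rw [sum_div]
    refine sum_le_sum fun M _ => ?_
    rw [← sum_filter, sum_const, nsmul_eq_mul]
    by_cases h0 : μ M = 0
    · simp [h0]
    by_cases hne : ∃ π, S ⊆ g (M, π)
    · obtain ⟨hsub, -, hcard⟩ := card_perm_subset_colouredFamily (hβ M (hμM M h0).card_eq) S hne
      rw [if_pos hsub]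
      have hfac := Nat.factorial_mul_descFactorial (Nat.mul_le_mul_left F.card hr)
      rw [hK] at hcard
      have hT' : T = ((F.card * n - F.card * S.card).factorial : ℝ) *
          ((F.card * n).descFactorial (F.card * S.card) : ℝ) := by
        rw [hT, hK]
        exact_mod_cast hfac.symm
      have hd : (0 : ℝ) < ((F.card * n).descFactorial (F.card * S.card) : ℝ) := by
        exact_mod_cast Nat.descFactorial_pos.2 (Nat.mul_le_mul_left _ hr)
      have hcard' : ((univ.filter fun π : Equiv.Perm K => S ⊆ g (M, π)).card : ℝ) ≤
          ((F.card * n - F.card * S.card).factorial : ℝ) := by exact_mod_cast hcard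
      rw [← mul_div_assoc, div_le_div_iff₀ hTpos hd, hT']
      have := mul_le_mul_of_nonneg_right hcard' (mul_nonneg (hμ0 M) hd.le)
      linarith
    · push Not at hne
      rw [filter_false_of_mem fun π _ => hne π, card_empty, Nat.cast_zero, zero_mul]
      split_ifs
      · exact div_nonneg (hμ0 M) (Nat.cast_nonneg _)
      · simp

end RandomColouring

section Assembly

open Classical in
lemma sysSparsProb_eq_subsetExp {M : ℕ} {V : Type*} [DecidableEq V] (H : Finset (Finset V))
    (p : ℝ) (E : (Fin M → Finset (Finset V)) → Prop) :
    sysSparsProb (fun _ : Fin M => H) p E =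
      subsetExp p ((univ : Finset (Fin M)) ×ˢ H)
        (fun G => if E (fun i => H.filter fun e => (i, e) ∈ G) then 1 else 0) := by
  unfold sysSparsProb subsetExp
  refine sum_bij' (fun σ _ => (univ ×ˢ H).filter fun x : Fin M × Finset V => x.2 ∈ σ x.1)
    (fun G _ => fun i => H.filter fun e => (i, e) ∈ G) ?_ ?_ ?_ ?_ ?_
  · intro σ _
    exact mem_powerset.2 (filter_subset _ _)
  · intro G _
    exact Fintype.mem_piFinset.2 fun i => mem_powerset.2 (filter_subset _ _)
  · intro σ hσ
    have hσ' := fun i => mem_powerset.1 (Fintype.mem_piFinset.1 hσ i)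
    funext i
    ext e
    simp only [mem_filter, mem_product, mem_univ, true_and]
    exact ⟨fun h => h.2.2, fun h => ⟨hσ' i h, hσ' i h, h⟩⟩
  · intro G hG
    have hG' := mem_powerset.1 hG
    ext ⟨i, e⟩
    simp only [mem_filter, mem_product, mem_univ, true_and]
    exact ⟨fun h => h.2.2, fun h => ⟨(mem_product.1 (hG' h)).2, (mem_product.1 (hG' h)).2, h⟩⟩
  · intro σ hσ
    have hσ' := fun i => mem_powerset.1 (Fintype.mem_piFinset.1 hσ i)
    have e1 : (fun i => H.filter fun e => (i, e) ∈
        (univ ×ˢ H).filter fun x : Fin M × Finset V => x.2 ∈ σ x.1) = σ := by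
      funext i
      ext e
      simp only [mem_filter, mem_product, mem_univ, true_and]
      exact ⟨fun h => h.2.2, fun h => ⟨hσ' i h, hσ' i h, h⟩⟩
    have e2 : ((univ ×ˢ H).filter fun x : Fin M × Finset V => x.2 ∈ σ x.1).card =
        ∑ i, (σ i).card := by
      rw [card_filter, sum_product]
      refine sum_congr rfl fun i _ => ?_
      rw [← card_filter]
      congr 1
      ext e
      simp only [mem_filter]
      exact ⟨fun h => h.2, fun h => ⟨hσ' i h, h⟩⟩
    have e3 : ((univ : Finset (Fin M)) ×ˢ H).card - ∑ i, (σ i).card =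
        ∑ i, (H.card - (σ i).card) := by
      rw [card_product, sum_tsub_distrib _ fun i _ => card_le_card (hσ' i)]
      simp
    simp only [e1, e2, e3, mul_ite, mul_one, mul_zero]
    rw [prod_mul_distrib, prod_pow_eq_pow_sum, prod_pow_eq_pow_sum]

lemma IsRainbowPacking.isTransversalFFactor {s n : ℕ} {F : Finset (Finset (Fin s))}
    {M : Finset ((Fin s ↪ Fin (s * n)) × ({e // e ∈ F} → Fin (F.card * n)))}
    (hM : IsRainbowPacking F M) (hcard : M.card = n)
    {σ : Fin (F.card * n) → Finset (Finset (Fin (s * n)))}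
    (hσ : ∀ A ∈ M, ∀ x ∈ coloredEdges F A, x.2 ∈ σ x.1) : IsTransversalFFactor F σ := by
  classical
  let e : Fin n ≃ {A // A ∈ M} := (Fintype.equivOfCardEq (by simp [hcard]))
  have hinj : Function.Injective
      (fun x : Fin n × {e // e ∈ F} => (e x.1).1.2 x.2) := by
    rintro ⟨j, f⟩ ⟨j', f'⟩ h
    obtain ⟨h1, h2⟩ := hM.rainbow _ (e j).2 _ (e j').2 f f' h
    exact Prod.ext (e.injective (Subtype.ext h1)) h2
  refine ⟨fun j => (e j).1.1, fun j => (e j).1.1.injective, ?_,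
    fun x => (e x.1).1.2 x.2, ?_, ?_⟩
  · intro j j' hj a b hab
    exact hj (e.injective (Subtype.ext (hM.disjoint _ (e j).2 _ (e j').2 a b hab)))
  · refine (Fintype.bijective_iff_injective_and_card _).2 ⟨hinj, ?_⟩
    simp [mul_comm]
  · intro j f
    have := hσ _ (e j).2 ((e j).1.2 f, f.1.map (e j).1.1)
      (mem_image.2 ⟨f, mem_univ _, rfl⟩)
    rwa [map_eq_image] at this

lemma threshold_pow {s t : ℕ} (hs : 2 ≤ s) (ht : 0 < t) {F : Finset (Finset (Fin s))}
    (hF : F.card = t) {n : ℕ} (hn : 1 ≤ n) {C : ℝ} :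
    (C * (n : ℝ) ^ (-(1 / oneDensity F) - 1) * (Real.log n) ^ ((1 : ℝ) / t)) ^ t =
      C ^ t * Real.log n / (n : ℝ) ^ (s + t - 1) := by
  have hn0 : (0 : ℝ) < n := by exact_mod_cast hn
  have hL : 0 ≤ Real.log n := Real.log_natCast_nonneg n
  have ht' : (t : ℝ) ≠ 0 := by exact_mod_cast ht.ne'
  have h1 : ((n : ℝ) ^ (-(1 / oneDensity F) - 1)) ^ t = ((n : ℝ) ^ (s + t - 1))⁻¹ := by
    rw [← Real.rpow_natCast, ← Real.rpow_mul hn0.le, ← Real.rpow_natCast (n : ℝ) (s + t - 1),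
      ← Real.rpow_neg hn0.le]
    congr 1
    unfold oneDensity
    rw [hF, Fintype.card_fin, Nat.cast_sub (by omega)]
    push_cast
    field_simp
    ring
  have h2 : ((Real.log n) ^ ((1 : ℝ) / t)) ^ t = Real.log n := by
    rw [← Real.rpow_natCast, ← Real.rpow_mul hL, one_div, inv_mul_cancel₀ ht', Real.rpow_one]
  rw [mul_pow, mul_pow, h1, h2]
  field_simp

end Assembly

section FixedPattern

lemma exists_threshold_constant {α : ℝ} (hα : 0 < α) {k s t d : ℕ} (hs : 2 ≤ s) (ht : 0 < t)
    (hd : 1 ≤ d) (hdk : d ≤ k - 1) (F : Finset (Finset (Fin s))) (hF : ∀ e ∈ F, e.card = k)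
    (hFt : F.card = t) (hbal : StrictlyOneBalanced F) :
    ∃ C₀ : ℝ, ∀ C : ℝ, C₀ ≤ C → ∀ ε : ℝ, 0 < ε → ∃ n₀ : ℕ, ∀ n : ℕ, n₀ ≤ n →
      ∀ H : Finset (Finset (Fin (s * n))),
        (∀ e ∈ H, e.card = k) →
        (∀ D : Finset (Fin (s * n)), D.card = d →
          (transversalDiracThreshold k s t d F + α) * ((s * n - d).choose (k - d) : ℝ) ≤
            ((H.filter fun e => D ⊆ e).card : ℝ)) →
      ∀ p : ℝ, 0 ≤ p → p ≤ 1 →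
        C * (n : ℝ) ^ (-(1 / oneDensity F) - 1) * (Real.log n) ^ ((1 : ℝ) / t) ≤ p →
        1 - ε ≤ sysSparsProb (fun _ : Fin (t * n) => H) p
          (fun σ => IsTransversalFFactor F σ) := by
  classical
  subst hFt
  obtain ⟨K, n₁, hK, hspread⟩ := exists_hasSpreadPacking (k := k) (d := d) (by omega : 1 ≤ s) ht
    (by omega) F hα
  set b := 2 * F.card with hb
  set B := F.card * ((s * (s * (k * (F.card * b + 1)))) ^ s * (F.card * b + 1) ^ F.card) with hB
  set κ₀ : ℝ := 6 ^ (s + F.card) * K with hκ₀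
  refine ⟨max 1 (κ₀ * (512 * 2 ^ B)), fun C hC ε hε => ?_⟩
  have hC1 : 1 ≤ C := (le_max_left _ _).trans hC
  have hC2 : κ₀ * (512 * 2 ^ B) ≤ C ^ F.card :=
    ((le_max_right _ _).trans hC).trans (le_self_pow₀ hC1 ht.ne')
  obtain ⟨n₂, hn₂⟩ := spread_theorem F.card B (ε / 2) (half_pos hε)
  obtain ⟨n₃, hn₃⟩ := exists_failure_bound ht (D := C ^ F.card)
    (Q := 2 ^ F.card * ((F.card * b + 1 : ℕ) ^ F.card *
        (s * (s * (s * (k * (F.card * b + 1 : ℕ)))) ^ s))) (half_pos hε)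
  refine ⟨max (max n₁ n₂) (max n₃ 3), fun n hn H hH hdeg p hp hp1 hpC => ?_⟩
  simp only [max_le_iff] at hn
  obtain ⟨⟨hnn₁, hnn₂⟩, hnn₃, hn3⟩ := hn
  have hn1 : 1 ≤ n := by omega
  have hn1' : (1 : ℝ) ≤ n := by exact_mod_cast hn1
  have hnpos : (0 : ℝ) < (n : ℝ) ^ (s + F.card - 1) := by positivity
  have hL : 1 ≤ Real.log n := by
    rw [Real.le_log_iff_exp_le (by linarith)]
    have : (3 : ℝ) ≤ n := by exact_mod_cast hn3
    linarith [Real.exp_one_lt_three]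
  set p₀ : ℝ := C * (n : ℝ) ^ (-(1 / oneDensity F) - 1) * (Real.log n) ^ ((1 : ℝ) / F.card)
    with hp₀
  have hp₀0 : 0 ≤ p₀ := mul_nonneg (mul_nonneg (by linarith) (by positivity))
    (Real.rpow_nonneg (by linarith) _)
  have hp₀t : p₀ ^ F.card = C ^ F.card * Real.log n / (n : ℝ) ^ (s + F.card - 1) :=
    threshold_pow hs ht rfl hn1
  have hH' : HostDeg H d (k - d) (transversalDiracThreshold k s F.card d F + α) univ := by
    intro D _ hD
    simpa using hdeg D hD
  obtain ⟨ν, hν0, hν1, hνM, hνS⟩ := exists_spread_rainbowPacking (K := Fin (F.card * n))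
    (by omega) ht hn1 hK (by simp) (hspread n hnn₁ _ H univ hH (by simp) hH')
  set 𝓜 : Finset ((Fin s ↪ Fin (s * n)) × ({e // e ∈ F} → Fin (F.card * n))) → Prop :=
    fun M => IsRainbowPacking F M ∧ M.card = n with h𝓜
  have main := hn₂ n hnn₂ ((Fin s ↪ Fin (s * n)) × ({e // e ∈ F} → Fin (F.card * n)))
    (Fin (F.card * n) × Finset (Fin (s * n))) (coloredEdges F) 𝓜
    (fun A => (card_coloredEdges F A).le) (univ ×ˢ H) p₀ hp₀0 (hpC.trans hp1) ν hν0 hν1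
    (fun M hM => (hνM M hM).2.2) (fun M hM => ⟨(hνM M hM).1, (hνM M hM).2.1⟩)
    (fun M hM => (hνM M hM).2.1.le) (κ₀ / (n : ℝ) ^ (s + F.card - 1)) (by positivity)
    (fun S => by convert hνS S)
    (by
      rw [hp₀t, div_mul_eq_mul_div]
      refine div_le_div_of_nonneg_right ?_ hnpos.le
      have := mul_le_mul_of_nonneg_right hC2 (by linarith : 0 ≤ Real.log n)
      linarith)
  have hdens : ((n : ℝ) * p₀) ^ F.card * (n : ℝ) ^ (s - 1) ≤ C ^ F.card * Real.log n := by
    rw [mul_pow, hp₀t, show s + F.card - 1 = F.card + (s - 1) by omega, pow_add]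
    refine le_of_eq ?_
    field_simp
  have hfail : ∑ M, ν M * subsetExp p₀ (univ ×ˢ H)
      (fun G => if FewNewCopies (coloredEdges F) B M G then 0 else 1) ≤ ε / 2 := by
    calc _ ≤ ∑ M, ν M * (ε / 2) := by
          refine sum_le_sum fun M _ => ?_
          by_cases hM : ν M = 0
          · simp [hM]
          obtain ⟨hM1, hM2, -⟩ := hνM M hM
          refine mul_le_mul_of_nonneg_left ?_ (hν0 M)
          have h := subsetExp_not_fewNewCopies_le (b := b) hs (by omega : 2 ≤ k) ht hF hbal hM1
            (by simp [hM2]) (X₀ := univ ×ˢ H) hp₀0 (hpC.trans hp1)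
            (ζ := F.card ^ F.card * (C ^ F.card * Real.log n) * (n : ℝ) ^ (-(1 / F.card : ℝ)))
            (fun j r _ hj hr hjr => by
              rw [hM2, Fintype.card_fin]
              push_cast
              exact mul_pow_le_of_density ht hn1' (one_le_pow₀ hC1) hL hp₀0 hdens hj hr hjr)
          rw [hM2] at h
          refine le_trans (le_of_eq ?_) (h.trans (hn₃ n hnn₃))
          congr!
      _ = ε / 2 := by rw [← sum_mul, hν1, one_mul]
  set ev : Finset (Fin (F.card * n) × Finset (Fin (s * n))) → ℝ :=
    fun G => if ∃ M, 𝓜 M ∧ M ⊆ copiesIn (coloredEdges F) G then 1 else 0 with hev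
  have h1 : 1 - ε ≤ subsetExp p₀ (univ ×ˢ H) ev := by
    have : 1 - subsetExp p₀ (univ ×ˢ H) ev ≤ ε / 2 + ε / 2 := by
      refine le_trans (le_of_eq ?_) (main.trans (add_le_add_left (le_trans (le_of_eq ?_) hfail) _))
      · congr!
      · congr!
    linarith
  have hmono : Monotone ev := by
    intro G G' hGG
    simp only [hev]
    split_ifs with h h'
    · exact le_rfl
    · refine absurd ?_ h'
      obtain ⟨M, hM, hMG⟩ := h
      refine ⟨M, hM, fun A hA => ?_⟩
      have := mem_filter.1 (hMG hA)
      exact mem_filter.2 ⟨mem_univ _, this.2.trans hGG⟩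
    · exact zero_le_one
    · exact le_rfl
  rw [sysSparsProb_eq_subsetExp]
  refine (h1.trans (subsetExp_mono_prob hp₀0 hpC hp1 hmono)).trans
    (subsetExp_mono hp hp1 fun G hG => ?_)
  simp only [hev]
  split_ifs with h h'
  · exact le_rfl
  · refine absurd ?_ h'
    obtain ⟨M, hM, hMG⟩ := h
    refine hM.1.isTransversalFFactor hM.2 fun A hA x hx => ?_
    have hxG := (mem_filter.1 (hMG hA)).2 hx
    exact mem_filter.2 ⟨(mem_product.1 (hG hxG)).2, hxG⟩
  · exact zero_le_one
  · exact le_rfl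

end FixedPattern

end Helpers

theorem transversal_factor_iid_copies
    (α : ℝ) (hα : 0 < α) (k s t : ℕ) (hk : 0 < k) (hs : 2 ≤ s) (ht : 0 < t) :
    ∃ C : ℝ, 0 < C ∧
      ∀ d : ℕ, 1 ≤ d → d ≤ k - 1 →
      ∀ F : Finset (Finset (Fin s)),
        (∀ e ∈ F, e.card = k) → F.card = t → StrictlyOneBalanced F →
      ∀ ε : ℝ, 0 < ε →
      ∃ n₀ : ℕ, ∀ n : ℕ, n₀ ≤ n →
      ∀ H : Finset (Finset (Fin (s * n))),
        (∀ e ∈ H, e.card = k) →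
        (∀ D : Finset (Fin (s * n)), D.card = d →
          (transversalDiracThreshold k s t d F + α) * ((s * n - d).choose (k - d) : ℝ) ≤
            ((H.filter fun e => D ⊆ e).card : ℝ)) →
      ∀ p : ℝ, 0 ≤ p → p ≤ 1 →
        C * (n : ℝ) ^ (-(1 / oneDensity F) - 1) * (Real.log n) ^ ((1 : ℝ) / t) ≤ p →
        -- the system `{H_1, …, H_{tn}}` consists of independent copies of `H(p)`
        1 - ε ≤ sysSparsProb (fun _ : Fin (t * n) => H) p
          (fun σ => IsTransversalFFactor F σ) := by
  classical
  have ex : ∀ x : ℕ × Finset (Finset (Fin s)), ∃ C₀ : ℝ, 1 ≤ x.1 → x.1 ≤ k - 1 →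
      (∀ e ∈ x.2, e.card = k) → x.2.card = t → StrictlyOneBalanced x.2 →
      ∀ C : ℝ, C₀ ≤ C → ∀ ε : ℝ, 0 < ε → ∃ n₀ : ℕ, ∀ n : ℕ, n₀ ≤ n →
      ∀ H : Finset (Finset (Fin (s * n))),
        (∀ e ∈ H, e.card = k) →
        (∀ D : Finset (Fin (s * n)), D.card = x.1 →
          (transversalDiracThreshold k s t x.1 x.2 + α) *
            ((s * n - x.1).choose (k - x.1) : ℝ) ≤
            ((H.filter fun e => D ⊆ e).card : ℝ)) →
      ∀ p : ℝ, 0 ≤ p → p ≤ 1 →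
        C * (n : ℝ) ^ (-(1 / oneDensity x.2) - 1) * (Real.log n) ^ ((1 : ℝ) / t) ≤ p →
        1 - ε ≤ sysSparsProb (fun _ : Fin (t * n) => H) p
          (fun σ => IsTransversalFFactor x.2 σ) := by
    intro x
    by_cases h : 1 ≤ x.1 ∧ x.1 ≤ k - 1 ∧ (∀ e ∈ x.2, e.card = k) ∧ x.2.card = t ∧
      StrictlyOneBalanced x.2
    · obtain ⟨h1, h2, h3, h4, h5⟩ := h
      obtain ⟨C₀, hC₀⟩ := exists_threshold_constant hα hs ht h1 h2 x.2 h3 h4 h5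
      exact ⟨C₀, fun _ _ _ _ _ => hC₀⟩
    · exact ⟨0, fun h1 h2 h3 h4 h5 => absurd ⟨h1, h2, h3, h4, h5⟩ h⟩
  choose C₀ hC₀ using ex
  have hpos : 0 < 1 + ∑ x ∈ Finset.range k ×ˢ (Finset.univ : Finset (Finset (Finset (Fin s)))),
      |C₀ x| := by
    have := Finset.sum_nonneg fun x
      (_ : x ∈ Finset.range k ×ˢ (Finset.univ : Finset (Finset (Finset (Fin s))))) =>
      abs_nonneg (C₀ x)
    linarith
  refine ⟨_, hpos, fun d hd hdk F hF hFt hbal => ?_⟩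
  refine hC₀ (d, F) hd hdk hF hFt hbal _ ?_
  have hmem : (d, F) ∈ Finset.range k ×ˢ (Finset.univ : Finset (Finset (Finset (Fin s)))) :=
    Finset.mem_product.2 ⟨Finset.mem_range.2 (by omega), Finset.mem_univ _⟩
  have h1 := Finset.single_le_sum (fun x _ => abs_nonneg (C₀ x)) hmem
  have h2 := le_abs_self (C₀ (d, F))
  linarith
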